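/- Let Y ⊆ ℂ^N be a compact polynomially convex set, and let Γ = γ([0,1]) be a rectifiable arc, where γ : [0,1] → ℂ^N is an injective continuous map of bounded variation, such that γ(0), γ(1) ∈ Y and Γ ∩ Y = {γ(0), γ(1)}. Suppose there is a complex affine line L ⊆ ℂ^N (the image of a map t ↦ z₀ + t·v, t ∈ ℂ, with v ≠ 0) and parameters 0 ≤ s < t ≤ 1 such that γ((s,t)) ⊆ L but Γ is not entirely contained in L. Then Y ∪ Γ is polynomially convex. -/

import Mathlib

section

open Set MvPolynomial Topology MeasureTheory

noncomputable section

/-- The polynomial hull of a set `X ⊆ ℂ^N`: points where every polynomial in the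
coordinates is dominated by its supremum over `X`. -/
def polyHull {N : ℕ} (X : Set (Fin N → ℂ)) : Set (Fin N → ℂ) :=
  {z | ∀ p : MvPolynomial (Fin N) ℂ, ‖eval z p‖ ≤ ⨆ x ∈ X, ‖eval x p‖}

/-- A set is polynomially convex if it equals its polynomial hull. -/
def IsPolynomiallyConvex {N : ℕ} (X : Set (Fin N → ℂ)) : Prop :=
  polyHull X = X

/-- `J` is an arc from `a` to `b`: the image of an injective continuous map on `[0,1]`
(equivalently, in a Hausdorff space, a subset homeomorphic to `[0,1]`). -/
def IsArcFrom {α : Type*} [TopologicalSpace α] (J : Set α) (a b : α) : Prop :=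
  ∃ γ : ℝ → α, ContinuousOn γ (Icc 0 1) ∧ InjOn γ (Icc 0 1) ∧
    γ '' Icc 0 1 = J ∧ γ 0 = a ∧ γ 1 = b

/-- `J` is an arc: a subset homeomorphic to the closed unit interval. -/
def IsArc {α : Type*} [TopologicalSpace α] (J : Set α) : Prop :=
  ∃ a b, IsArcFrom J a b

/-- `J` is a simple closed curve: a subset homeomorphic to the unit circle. -/
def IsSimpleClosedCurve {α : Type*} [TopologicalSpace α] (J : Set α) : Prop :=
  ∃ γ : Circle → α, Continuous γ ∧ Function.Injective γ ∧ Set.range γ = J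

/-- A `C^∞`-smooth open arc: the image of an injective `C^∞` map on an open interval,
with nowhere vanishing derivative, that is a homeomorphism onto its image. -/
def IsSmoothOpenArc {E : Type*} [NormedAddCommGroup E] [NormedSpace ℝ E]
    (A : Set E) : Prop :=
  ∃ (a b : ℝ) (γ : ℝ → E), a < b ∧ ContDiffOn ℝ (⊤ : ℕ∞) γ (Ioo a b) ∧
    (∀ t ∈ Ioo a b, derivWithin γ (Ioo a b) t ≠ 0) ∧
    InjOn γ (Ioo a b) ∧
    IsEmbedding ((Ioo a b).restrict γ) ∧
    γ '' Ioo a b = A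

/-- `P(X) = C(X)`: every continuous function on `X` is a uniform limit of polynomials. -/
def PolyEqContinuous {N : ℕ} (X : Set (Fin N → ℂ)) : Prop :=
  ∀ f : (Fin N → ℂ) → ℂ, ContinuousOn f X → ∀ δ : ℝ, 0 < δ →
    ∃ p : MvPolynomial (Fin N) ℂ, ∀ x ∈ X, ‖f x - eval x p‖ < δ

/-- `L` is a complex affine line in `ℂ^N`. -/
def IsComplexAffineLine {N : ℕ} (L : Set (Fin N → ℂ)) : Prop :=
  ∃ (z₀ v : Fin N → ℂ), v ≠ 0 ∧ L = {z | ∃ t : ℂ, z = z₀ + t • v}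

end

end

section
open Set Topology MeasureTheory Filter
noncomputable section
namespace SA

/-- primitive on star-shaped open set -/
theorem star_primitive {S : Set ℂ} (hS : IsOpen S) (hst : ∀ z ∈ S, ∀ t ∈ Icc (0:ℝ) 1, (t:ℂ) * z ∈ S)
    {h : ℂ → ℂ} (hh : DifferentiableOn ℂ h S) :
    ∃ Q : ℂ → ℂ, ∀ z ∈ S, HasDerivAt Q (h z) z := by
  have hd : ∀ z ∈ S, HasDerivAt h (deriv h z) z := fun z hz =>
    (hh.differentiableAt (hS.mem_nhds hz)).hasDerivAt
  have hdc : ContinuousOn (deriv h) S := (hh.deriv hS).continuousOn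
  refine ⟨fun z => ∫ t in (0:ℝ)..1, z * h (t * z), fun z hz => ?_⟩
  obtain ⟨ε, hε, hball⟩ := Metric.nhds_basis_closedBall.mem_iff.1 (hS.mem_nhds hz)
  -- compact set
  let Kc : Set ℂ := (fun p : ℝ × ℂ => (p.1 : ℂ) * p.2) '' (Icc (0:ℝ) 1 ×ˢ Metric.closedBall z ε)
  have hKc : IsCompact Kc := (isCompact_Icc.prod (isCompact_closedBall z ε)).image (by fun_prop)
  have hKS : Kc ⊆ S := by
    rintro _ ⟨⟨t, w⟩, ⟨ht, hw⟩, rfl⟩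
    exact hst w (hball hw) t ht
  obtain ⟨C1, hC1⟩ := hKc.exists_bound_of_continuousOn (hh.continuousOn.mono hKS)
  obtain ⟨C2, hC2⟩ := hKc.exists_bound_of_continuousOn (hdc.mono hKS)
  have hmem : ∀ t ∈ Icc (0:ℝ) 1, ∀ w ∈ Metric.closedBall z ε, (t:ℂ) * w ∈ Kc :=
    fun t ht w hw => ⟨(t, w), ⟨ht, hw⟩, rfl⟩
  have hcont : ∀ w ∈ Metric.closedBall z ε, ContinuousOn (fun t : ℝ => w * h (t * w)) (Icc 0 1) := by
    intro w hw
    apply continuousOn_const.mul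
    exact hh.continuousOn.comp (by fun_prop) (fun t ht => hKS (hmem t ht w hw))
  have hcont' : ContinuousOn (fun t : ℝ => h (t * z) + z * (deriv h (t * z) * t)) (Icc 0 1) := by
    have hz' := Metric.mem_closedBall_self (x := z) hε.le
    apply ContinuousOn.add
    · exact hh.continuousOn.comp (by fun_prop) (fun t ht => hKS (hmem t ht z hz'))
    · apply continuousOn_const.mul
      apply ContinuousOn.mul _ (by fun_prop)
      exact hdc.comp (by fun_prop) (fun t ht => hKS (hmem t ht z hz'))
  have key := intervalIntegral.hasDerivAt_integral_of_dominated_loc_of_deriv_le (𝕜 := ℂ)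
    (μ := volume) (F := fun w (t:ℝ) => w * h (t * w))
    (F' := fun w (t:ℝ) => h (t * w) + w * (deriv h (t * w) * t)) (x₀ := z)
    (s := Metric.ball z ε) (bound := fun _ => C1 + (‖z‖ + ε) * C2) (a := 0) (b := 1)
    (Metric.ball_mem_nhds z hε) ?_ ?_ ?_ ?_ ?_ ?_
  · have e : ∫ t in (0:ℝ)..1, (h (t * z) + z * (deriv h (t * z) * t)) = h z := by
      have hz' := Metric.mem_closedBall_self (x := z) hε.le
      have := intervalIntegral.integral_eq_sub_of_hasDerivAt (a := 0) (b := 1)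
        (f := fun t : ℝ => (t:ℂ) * h (t * z))
        (f' := fun t : ℝ => h (t * z) + z * (deriv h (t * z) * t)) ?_ ?_
      · rw [this]; simp
      · intro t ht
        rw [uIcc_of_le zero_le_one] at ht
        have h1 := hd _ (hKS (hmem t ht z hz'))
        have h2 : HasDerivAt (fun s : ℝ => (s:ℂ) * z) z t := by
          simpa using (Complex.ofRealCLM.hasDerivAt (x := t)).mul_const z
        have h4 : HasDerivAt (fun s : ℝ => h (s * z)) (deriv h (t * z) * z) t := by
          have := HasDerivAt.scomp (𝕜 := ℝ) (𝕜' := ℂ) t h1 h2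
          simpa [mul_comm, Function.comp_def] using this
        have h5 : HasDerivAt (fun s : ℝ => (s:ℂ)) 1 t := by
          simpa using (hasDerivAt_id t).ofReal_comp
        have := h5.mul h4
        refine this.congr_deriv ?_
        ring
      · apply ContinuousOn.intervalIntegrable
        rwa [uIcc_of_le zero_le_one]
    rw [← e]
    exact key.2
  · filter_upwards [Metric.closedBall_mem_nhds z hε] with w hw
    have := (hcont w hw).mono (uIoc_of_le (zero_le_one' ℝ) ▸ Ioc_subset_Icc_self)
    exact this.aestronglyMeasurable measurableSet_uIoc
  · apply ContinuousOn.intervalIntegrable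
    rw [uIcc_of_le zero_le_one]
    exact hcont z (Metric.mem_closedBall_self hε.le)
  · have := hcont'.mono (uIoc_of_le (zero_le_one' ℝ) ▸ Ioc_subset_Icc_self)
    exact this.aestronglyMeasurable measurableSet_uIoc
  · refine ae_of_all _ fun t ht w hw => ?_
    rw [uIoc_of_le zero_le_one] at ht
    have hm := hmem t (Ioc_subset_Icc_self ht) w (Metric.ball_subset_closedBall hw)
    have hw' : ‖w‖ ≤ ‖z‖ + ε := by
      have := norm_le_norm_add_norm_sub' w z
      have h2 : ‖w - z‖ < ε := by simpa [dist_eq_norm] using hw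
      linarith
    have hC20 : 0 ≤ C2 := (norm_nonneg _).trans (hC2 _ hm)
    have ht' : ‖(t:ℂ)‖ ≤ 1 := by simp [abs_of_nonneg ht.1.le, ht.2]
    refine (norm_add_le _ _).trans (add_le_add (hC1 _ hm) ?_)
    rw [norm_mul, norm_mul]
    have := hC2 _ hm
    calc ‖w‖ * (‖deriv h (t * w)‖ * ‖(t:ℂ)‖) ≤ (‖z‖ + ε) * (C2 * 1) := by gcongr
      _ = _ := by ring
  · exact intervalIntegrable_const
  · refine ae_of_all _ fun t ht w hw => ?_
    rw [uIoc_of_le zero_le_one] at ht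
    have hm := hmem t (Ioc_subset_Icc_self ht) w (Metric.ball_subset_closedBall hw)
    have h1 := hd _ (hKS hm)
    have h2 : HasDerivAt (fun s : ℂ => (t:ℂ) * s) t w := by
      simpa using (hasDerivAt_id w).const_mul (t:ℂ)
    have h3 := (hasDerivAt_id w).mul (h1.comp w h2)
    refine h3.congr_deriv ?_
    simp

theorem curve_le {R P : ℂ → ℂ} {c : ℝ → ℂ} {Λ a b : ℝ} (hΛ : 0 < Λ) (hab : a ≤ b)
    (hc : ∀ x y, ‖c x - c y‖ ≤ Λ * |x - y|)
    (hR : ∀ t, HasDerivAt R (P (c t)) (c t)) (hP : Continuous fun t => P (c t)) :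
    ‖R (c b) - R (c a)‖ ≤ Λ * ∫ t in a..b, ‖P (c t)‖ := by
  have hcc : Continuous c := by
    have : LipschitzWith Λ.toNNReal c := LipschitzWith.of_dist_le_mul (fun x y => by
      rw [dist_eq_norm, dist_eq_norm, Real.coe_toNNReal _ hΛ.le]; exact hc x y)
    exact this.continuous
  have hRc : Continuous fun t => R (c t) - R (c a) := by
    have : Continuous fun t => R (c t) := continuous_iff_continuousAt.2 fun t =>
      ContinuousAt.comp (f := c) (hR t).continuousAt hcc.continuousAt
    exact this.sub continuous_const
  have hd : ∀ x, HasDerivAt (fun y => Λ * ∫ t in a..y, ‖P (c t)‖) (Λ * ‖P (c x)‖) x := fun x =>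
    (intervalIntegral.integral_hasDerivAt_right (hP.norm.intervalIntegrable _ _)
      hP.norm.stronglyMeasurable.stronglyMeasurableAtFilter hP.norm.continuousAt).const_mul Λ
  refine image_le_of_liminf_slope_right_le_deriv_boundary (f := fun t => ‖R (c t) - R (c a)‖)
    (B := fun y => Λ * ∫ t in a..y, ‖P (c t)‖) (B' := fun x => Λ * ‖P (c x)‖)
    (a := a) (b := b) hRc.norm.continuousOn (by simp)
    (fun x _ => (hd x).continuousAt.continuousWithinAt) (fun x _ => (hd x).hasDerivWithinAt) ?_
    ⟨hab, le_rfl⟩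
  intro x _ r hr
  apply Eventually.frequently
  have hε : 0 < (r / Λ - ‖P (c x)‖) / 2 := by
    have : ‖P (c x)‖ < r / Λ := by rw [lt_div_iff₀ hΛ]; linarith
    linarith
  have h1 := (hasDerivAt_iff_isLittleO.1 (hR x)).def hε
  have h2 : ∀ᶠ z in 𝓝[>] x, ‖R (c z) - R (c x) - (c z - c x) • P (c x)‖
      ≤ (r / Λ - ‖P (c x)‖) / 2 * ‖c z - c x‖ :=
    (hcc.continuousAt.tendsto.mono_left nhdsWithin_le_nhds).eventually h1
  filter_upwards [h2, self_mem_nhdsWithin] with z hz hzx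
  have hzx : x < z := hzx
  rw [slope_def_field, div_lt_iff₀ (by linarith)]
  have e1 : ‖R (c z) - R (c a)‖ - ‖R (c x) - R (c a)‖ ≤ ‖R (c z) - R (c x)‖ := by
    have := norm_sub_norm_le (R (c z) - R (c a)) (R (c x) - R (c a))
    simpa using this
  have e2 : ‖R (c z) - R (c x)‖ ≤ ((r / Λ - ‖P (c x)‖) / 2 + ‖P (c x)‖) * ‖c z - c x‖ := by
    have := norm_add_le (R (c z) - R (c x) - (c z - c x) • P (c x)) ((c z - c x) • P (c x))
    rw [sub_add_cancel, norm_smul] at this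
    nlinarith
  have e3 := hc z x
  rw [abs_of_pos (by linarith)] at e3
  have e4 : ((r / Λ - ‖P (c x)‖) / 2 + ‖P (c x)‖) * ‖c z - c x‖ ≤
    ((r / Λ - ‖P (c x)‖) / 2 + ‖P (c x)‖) * (Λ * (z - x)) := by gcongr
  have e5 : ((r / Λ - ‖P (c x)‖) / 2 + ‖P (c x)‖) * Λ < r := by
    have : r / Λ * Λ = r := by field_simp
    nlinarith
  have : ((r / Λ - ‖P (c x)‖) / 2 + ‖P (c x)‖) * (Λ * (z - x)) < r * (z - x) := by
    rw [← mul_assoc]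
    apply mul_lt_mul_of_pos_right e5; linarith
  linarith

/-- gauge of a star domain -/
structure StarG (g : ℂ → ℝ) (κ : ℝ) : Prop where
  pos : ∀ z, z ≠ 0 → 0 < g z
  hom : ∀ t : ℝ, 0 ≤ t → ∀ z, g (t * z) = t * g z
  lip : ∃ K : ℝ, 0 < K ∧ ∀ z w, |g z - g w| ≤ K * ‖z - w‖
  ang : ∀ θ θ' : ℝ, |Real.log (g (Complex.exp (θ * Complex.I))) - Real.log (g (Complex.exp (θ' * Complex.I)))| ≤ κ * |θ - θ'|

def el (g : ℂ → ℝ) (θ : ℝ) : ℝ := - Real.log (g (Complex.exp (θ * Complex.I)))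
def cv (g : ℂ → ℝ) (θ : ℝ) : ℂ := (el g θ : ℂ) + θ * Complex.I
def bt (g : ℂ → ℝ) (θ : ℝ) : ℂ := Complex.exp (cv g θ)

namespace StarG
variable {g : ℂ → ℝ} {κ : ℝ}

theorem zero (h : StarG g κ) : g 0 = 0 := by simpa using h.hom 0 le_rfl 0
theorem nonneg (h : StarG g κ) (z : ℂ) : 0 ≤ g z := by
  by_cases hz : z = 0
  · rw [hz, h.zero]
  · exact (h.pos z hz).le
theorem cont (h : StarG g κ) : Continuous g := by
  obtain ⟨K, hK, hl⟩ := h.lip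
  have : LipschitzWith K.toNNReal g := LipschitzWith.of_dist_le_mul (fun x y => by
      rw [dist_eq_norm, dist_eq_norm, Real.coe_toNNReal _ hK.le]; exact hl x y)
  exact this.continuous
theorem isOpen (h : StarG g κ) : IsOpen {z | g z < 1} := isOpen_lt h.cont continuous_const
theorem isClosed (h : StarG g κ) : IsClosed {z | g z ≤ 1} := isClosed_le h.cont continuous_const
theorem g_bt (h : StarG g κ) (θ : ℝ) : g (bt g θ) = 1 := by
  have hp := h.pos (Complex.exp (θ * Complex.I)) (Complex.exp_ne_zero _)
  rw [bt, cv, Complex.exp_add, ← Complex.ofReal_exp, h.hom _ (Real.exp_pos _).le, el, Real.exp_neg,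
    Real.exp_log hp]
  exact inv_mul_cancel₀ hp.ne'
theorem eq_bt (h : StarG g κ) {z : ℂ} (hz : z ≠ 0) : z = g z * bt g z.arg := by
  have h1 : z = ‖z‖ * Complex.exp (z.arg * Complex.I) := (Complex.norm_mul_exp_arg_mul_I z).symm
  have hp := h.pos (Complex.exp (z.arg * Complex.I)) (Complex.exp_ne_zero _)
  have h2 : g z = ‖z‖ * g (Complex.exp (z.arg * Complex.I)) := by
    conv_lhs => rw [h1]
    exact h.hom _ (norm_nonneg _) _
  rw [bt, cv, Complex.exp_add, ← Complex.ofReal_exp, el, Real.exp_neg, Real.exp_log hp, h2]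
  have : (g (Complex.exp (z.arg * Complex.I)) : ℂ) ≠ 0 := by exact_mod_cast hp.ne'
  push_cast
  field_simp
  rw [← h1]
theorem bt_of_eq_one (h : StarG g κ) {z : ℂ} (hz : g z = 1) : z = bt g z.arg := by
  have : z ≠ 0 := by rintro rfl; rw [h.zero] at hz; norm_num at hz
  simpa [hz] using h.eq_bt this
theorem cv_lip (h : StarG g κ) (x y : ℝ) : ‖cv g x - cv g y‖ ≤ √(1 + κ ^ 2) * |x - y| := by
  have h1 := h.ang x y
  have : cv g x - cv g y = ((el g x - el g y : ℝ) : ℂ) + ((x - y : ℝ) : ℂ) * Complex.I := by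
    simp [cv]; ring
  rw [this, Complex.norm_add_mul_I]
  have h2 : |el g x - el g y| ≤ κ * |x - y| := by
    rw [el, el, ← abs_neg]; convert h1 using 2; ring
  have h3 : (el g x - el g y) ^ 2 ≤ κ ^ 2 * |x - y| ^ 2 := by
    rw [← sq_abs, ← mul_pow]; gcongr
  calc √((el g x - el g y) ^ 2 + (x - y) ^ 2) ≤ √((1 + κ ^ 2) * |x - y| ^ 2) := by
        apply Real.sqrt_le_sqrt; nlinarith [sq_abs (x - y)]
    _ = _ := by rw [Real.sqrt_mul (by positivity), Real.sqrt_sq (abs_nonneg _)]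
theorem cv_cont (h : StarG g κ) : Continuous (cv g) := by
  have : LipschitzWith (√(1 + κ ^ 2)).toNNReal (cv g) := LipschitzWith.of_dist_le_mul (fun x y => by
      rw [dist_eq_norm, dist_eq_norm, Real.coe_toNNReal _ (by positivity)]; exact h.cv_lip x y)
  exact this.continuous
theorem bt_cont (h : StarG g κ) : Continuous (bt g) := Complex.continuous_exp.comp h.cv_cont
theorem star (h : StarG g κ) {z : ℂ} (hz : g z < 1) {t : ℝ} (ht : t ∈ Icc (0:ℝ) 1) : g (t * z) < 1 := by
  rw [h.hom _ ht.1]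
  have := h.nonneg z
  nlinarith [ht.1, ht.2]
theorem isCompact (h : StarG g κ) : IsCompact {z | g z ≤ 1} := by
  have : {z | g z ≤ 1} = (fun p : ℝ × ℝ => (p.1 : ℂ) * bt g p.2) '' (Icc 0 1 ×ˢ Icc (-Real.pi) Real.pi) := by
    ext z
    constructor
    · intro hz
      by_cases h0 : z = 0
      · exact ⟨(0, 0), ⟨⟨le_rfl, zero_le_one⟩, ⟨by simp [Real.pi_pos.le], Real.pi_pos.le⟩⟩, by simp [h0]⟩
      · refine ⟨(g z, z.arg), ⟨⟨h.nonneg z, hz⟩, ⟨(Complex.neg_pi_lt_arg z).le, Complex.arg_le_pi z⟩⟩, ?_⟩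
        exact (h.eq_bt h0).symm
    · rintro ⟨⟨t, θ⟩, ⟨ht, _⟩, rfl⟩
      change g _ ≤ 1
      rw [h.hom _ ht.1, h.g_bt, mul_one]; exact ht.2
  rw [this]
  refine (isCompact_Icc.prod isCompact_Icc).image ?_
  have := h.bt_cont
  fun_prop

theorem P1 (h : StarG g κ) {p : ℂ → ℂ} (hc : ContinuousOn p {z | g z ≤ 1}) (hd : DifferentiableOn ℂ p {z | g z < 1}) :
    2 * Real.pi * ‖p 0‖ ≤ √(1 + κ ^ 2) * ∫ θ in (0:ℝ)..(2 * Real.pi), ‖p (bt g θ)‖ := by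
  have h0 : (0:ℂ) ∈ {z | g z < 1} := by simp [h.zero]
  have hnh : {z | g z < 1} ∈ 𝓝 (0:ℂ) := h.isOpen.mem_nhds h0
  obtain ⟨Q, hQ⟩ := star_primitive h.isOpen (fun z hz t ht => h.star hz ht)
    ((Complex.differentiableOn_dslope hnh).2 hd)
  have hlt : ∀ r ∈ Ioo (0:ℝ) 1, ∀ θ, g (r * bt g θ) < 1 := by
    intro r hr θ; rw [h.hom _ hr.1.le, h.g_bt, mul_one]; exact hr.2
  have step : ∀ r ∈ Ioo (0:ℝ) 1, 2 * Real.pi * ‖p 0‖ ≤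
      √(1 + κ ^ 2) * ∫ θ in (0:ℝ)..(2 * Real.pi), ‖p (r * bt g θ)‖ := by
    intro r hr
    have := curve_le (R := fun ζ => p 0 * ζ + Q (r * Complex.exp ζ))
      (P := fun ζ => p (r * Complex.exp ζ)) (c := cv g) (Λ := √(1 + κ ^ 2)) (a := 0) (b := 2 * Real.pi)
      (by positivity) (by positivity) h.cv_lip ?_ ?_
    · refine le_trans (le_of_eq ?_) this
      have e1 : Complex.exp (cv g (2 * Real.pi)) = Complex.exp (cv g 0) := by
        simp [cv, el, Complex.exp_add]
      have e2 : cv g (2 * Real.pi) - cv g 0 = 2 * Real.pi * Complex.I := by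
        simp [cv, el]
      have : p 0 * cv g (2 * Real.pi) + Q (r * Complex.exp (cv g (2 * Real.pi))) -
        (p 0 * cv g 0 + Q (r * Complex.exp (cv g 0))) = p 0 * (2 * Real.pi * Complex.I) := by
        rw [e1, ← e2]; ring
      rw [this]
      simp [abs_of_pos Real.pi_pos]
      ring
    · intro t
      have hz := hlt r hr t
      have h1 : HasDerivAt (fun ζ : ℂ => (r:ℂ) * Complex.exp ζ) (r * Complex.exp (cv g t)) (cv g t) :=
        (Complex.hasDerivAt_exp _).const_mul _
      have h2 := (hQ _ hz).comp (cv g t) h1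
      have h3 := ((hasDerivAt_id (cv g t)).const_mul (p 0)).add h2
      refine h3.congr_deriv ?_
      have hne : (r * bt g t : ℂ) ≠ 0 := by
        simp [bt, Complex.exp_ne_zero, hr.1.ne']
      have := sub_smul_dslope p 0 (r * bt g t)
      change p 0 * 1 + dslope p 0 (r * bt g t) * (r * bt g t) = p (r * bt g t)
      simp only [sub_zero, smul_eq_mul] at this
      rw [mul_comm (dslope p 0 _), this]; ring
    · have : ContinuousOn p {z | g z < 1} := hd.continuousOn
      refine this.comp_continuous ?_ (fun t => hlt r hr t)
      have := h.cv_cont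
      fun_prop
  -- limit r → 1
  have hcomp := h.isCompact
  obtain ⟨C, hC⟩ := hcomp.exists_bound_of_continuousOn hc
  have hlim : Tendsto (fun r : ℝ => ∫ θ in (0:ℝ)..(2 * Real.pi), ‖p (r * bt g θ)‖) (𝓝[<] 1)
      (𝓝 (∫ θ in (0:ℝ)..(2 * Real.pi), ‖p (bt g θ)‖)) := by
    have hev : ∀ᶠ r : ℝ in 𝓝[<] 1, r ∈ Ioo (0:ℝ) 1 := Ioo_mem_nhdsLT zero_lt_one
    apply intervalIntegral.tendsto_integral_filter_of_dominated_convergence (fun _ => C)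
    · filter_upwards [hev] with r hr
      have : Continuous fun θ => ‖p (r * bt g θ)‖ := by
        refine Continuous.norm (hd.continuousOn.comp_continuous ?_ (fun t => hlt r hr t))
        have := h.bt_cont
        fun_prop
      exact this.aestronglyMeasurable
    · filter_upwards [hev] with r hr
      refine ae_of_all _ fun θ _ => ?_
      rw [norm_norm]
      exact hC _ (hlt r hr θ).le
    · exact intervalIntegrable_const
    · refine ae_of_all _ fun θ _ => ?_
      have h1 : Tendsto (fun r : ℝ => (r:ℂ) * bt g θ) (𝓝[<] 1) (𝓝[{z | g z ≤ 1}] (bt g θ)) := by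
        apply tendsto_nhdsWithin_of_tendsto_nhds_of_eventually_within
        · have : Continuous fun r : ℝ => (r:ℂ) * bt g θ := by fun_prop
          have := this.tendsto 1
          simp only [Complex.ofReal_one, one_mul] at this
          exact this.mono_left nhdsWithin_le_nhds
        · filter_upwards [hev] with r hr using (hlt r hr θ).le
      exact ((hc _ (h.g_bt θ).le).tendsto.comp h1).norm
  refine ge_of_tendsto (hlim.const_mul _) ?_
  filter_upwards [Ioo_mem_nhdsLT (zero_lt_one (α := ℝ))] with r hr using step r hr

end StarG
end SA
end
end

section
open Set Topology MeasureTheory Filter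
noncomputable section
namespace SA

theorem hb_sublinear {E : Type*} [AddCommGroup E] [Module ℝ E] (N : E → ℝ)
    (N_hom : ∀ c : ℝ, 0 < c → ∀ x, N (c • x) = c * N x) (N_add : ∀ x y, N (x + y) ≤ N x + N y)
    (x₀ : E) : ∃ w : E →ₗ[ℝ] ℝ, w x₀ = N x₀ ∧ ∀ x, w x ≤ N x := by
  have N_0 : N 0 = 0 := by have := N_hom 2 (by norm_num) 0; rw [smul_zero] at this; linarith
  by_cases hx : x₀ = 0
  · obtain ⟨w, _, hw⟩ := exists_extension_of_le_sublinear (⊥ : E →ₗ.[ℝ] ℝ) N N_hom N_add (by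
      rintro ⟨x, hx⟩
      have : x = 0 := (Submodule.mem_bot ℝ).1 hx
      subst this
      rw [N_0]
      exact le_of_eq (LinearPMap.map_zero _))
    exact ⟨w, by simp [hx, N_0], hw⟩
  · obtain ⟨w, hw1, hw⟩ := exists_extension_of_le_sublinear (LinearPMap.mkSpanSingleton (σ := RingHom.id ℝ) x₀ (N x₀) hx) N N_hom N_add (by
      rintro ⟨x, hx'⟩
      obtain ⟨c, rfl⟩ := Submodule.mem_span_singleton.1 hx'
      rw [LinearPMap.mkSpanSingleton'_apply]
      simp only [RingHom.id_apply, smul_eq_mul]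
      rcases lt_trichotomy c 0 with hc | rfl | hc
      · have h1 := N_hom (-c) (by linarith) x₀
        have h2 := N_add (c • x₀) ((-c) • x₀)
        rw [neg_smul, add_neg_cancel, N_0] at h2
        rw [neg_smul] at h1
        linarith
      · simp [N_0]
      · rw [N_hom c hc])
    refine ⟨w, ?_, hw⟩
    have := hw1 ⟨x₀, Submodule.mem_span_singleton_self x₀⟩
    rw [LinearPMap.mkSpanSingleton_apply] at this
    exact this

theorem riesz {X : Type*} [TopologicalSpace X] [CompactSpace X] [T2Space X] [MeasurableSpace X]
    [BorelSpace X] (w : C(X, ℝ) →ₗ[ℝ] ℝ) (hw : ∀ h : C(X, ℝ), 0 ≤ h → 0 ≤ w h) :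
    ∃ μ : Measure X, IsFiniteMeasure μ ∧ ∀ h : C(X, ℝ), ∫ x, h x ∂μ = w h := by
  let L0 : CompactlySupportedContinuousMap X ℝ →ₗ[ℝ] ℝ :=
    { toFun := fun f => w f.toContinuousMap
      map_add' := fun f k => by rw [← map_add]; rfl
      map_smul' := fun c f => by rw [RingHom.id_apply, ← map_smul]; rfl }
  let L : PositiveLinearMap ℝ (CompactlySupportedContinuousMap X ℝ) ℝ :=
    { L0 with
      monotone' := fun f k hfk => by
        have : 0 ≤ w (k.toContinuousMap - f.toContinuousMap) := hw _ (by
          intro x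
          have := hfk x
          simpa using this)
        rw [map_sub] at this
        change w _ ≤ w _
        linarith }
  refine ⟨RealRMK.rieszMeasure L, ⟨?_⟩, fun h => ?_⟩
  · exact isCompact_univ.measure_lt_top
  · exact RealRMK.integral_rieszMeasure L (CompactlySupportedContinuousMap.continuousMapEquiv h)

theorem rep_measure {X : Type*} [TopologicalSpace X] [CompactSpace X] [T2Space X] [MeasurableSpace X]
    [BorelSpace X] (R : Submodule ℝ (C(X, ℝ) × ℝ)) (h1 : ((1 : C(X, ℝ)), (1:ℝ)) ∈ R)
    (hpos : ∀ p ∈ R, 0 ≤ p.1 → 0 ≤ p.2) (χ : C(X, ℝ)) (b : ℝ)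
    (hb : ∀ p ∈ R, χ ≤ p.1 → b ≤ p.2) :
    ∃ μ : Measure X, IsFiniteMeasure μ ∧ (∀ p ∈ R, ∫ x, p.1 x ∂μ = p.2) ∧ b ≤ ∫ x, χ x ∂μ := by
  let T : C(X, ℝ) → Set ℝ := fun h => {c | ∃ u, (u, c) ∈ R ∧ h ≤ u}
  have hne : ∀ h, (T h).Nonempty := by
    intro h
    refine ⟨‖h‖ * 1, ‖h‖ • (1 : C(X, ℝ)), R.smul_mem ‖h‖ h1, fun x => ?_⟩
    simpa using h.apply_le_norm x
  have hbd : ∀ h, BddBelow (T h) := by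
    intro h
    refine ⟨-‖h‖, ?_⟩
    rintro c ⟨u, hu, hle⟩
    have := hpos _ (R.add_mem hu (R.smul_mem ‖h‖ h1)) (fun x => by
      have h2 : h x ≤ u x := hle x
      have h3 := h.neg_norm_le_apply x
      simp
      linarith)
    simp at this
    linarith
  let N : C(X, ℝ) → ℝ := fun h => sInf (T h)
  have N_hom : ∀ c : ℝ, 0 < c → ∀ x, N (c • x) = c * N x := by
    intro c hc x
    apply le_antisymm
    · rw [← div_le_iff₀' hc]
      refine le_csInf (hne _) ?_
      rintro d ⟨u, hu, hle⟩
      rw [div_le_iff₀' hc]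
      refine csInf_le (hbd _) ⟨c • u, R.smul_mem c hu, fun y => ?_⟩
      have : x y ≤ u y := hle y
      change c * x y ≤ c * u y
      gcongr
    · refine le_csInf (hne _) ?_
      rintro d ⟨u, hu, hle⟩
      have : N x ≤ c⁻¹ * d := by
        refine csInf_le (hbd _) ⟨c⁻¹ • u, R.smul_mem c⁻¹ hu, fun y => ?_⟩
        have : c * x y ≤ u y := hle y
        change x y ≤ c⁻¹ * u y
        rw [← div_eq_inv_mul, le_div_iff₀' hc]; exact this
      rw [← div_eq_inv_mul, le_div_iff₀' hc] at this
      exact this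
  have N_add : ∀ x y, N (x + y) ≤ N x + N y := by
    intro x y
    have : ∀ c ∈ T x, ∀ d ∈ T y, N (x + y) ≤ c + d := by
      rintro c ⟨u, hu, hle⟩ d ⟨u', hu', hle'⟩
      exact csInf_le (hbd _) ⟨u + u', R.add_mem hu hu', add_le_add hle hle'⟩
    have h2 : ∀ c ∈ T x, N (x + y) - c ≤ N y := fun c hc => le_csInf (hne _) fun d hd => by
      linarith [this c hc d hd]
    have h3 : N (x + y) - N y ≤ N x := le_csInf (hne _) fun c hc => by linarith [h2 c hc]
    linarith
  obtain ⟨w, hw0, hw⟩ := hb_sublinear N N_hom N_add χ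
  · have hN : ∀ p ∈ R, N p.1 ≤ p.2 := fun p hp => csInf_le (hbd _) ⟨p.1, hp, le_rfl⟩
    have hwR : ∀ p ∈ R, w p.1 = p.2 := by
      intro p hp
      apply le_antisymm ((hw _).trans (hN p hp))
      have := (hw _).trans (hN (-p) (R.neg_mem hp))
      simp at this
      linarith
    obtain ⟨μ, hμ, hi⟩ := riesz w (fun h hh => by
      have h2 : N (-h) ≤ 0 := csInf_le (hbd _) ⟨0, R.zero_mem, by simpa using hh⟩
      have := hw (-h)
      rw [map_neg] at this
      linarith)
    refine ⟨μ, hμ, fun p hp => by rw [hi, hwR p hp], ?_⟩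
    rw [hi, hw0]
    refine le_csInf (hne _) ?_
    rintro c ⟨u, hu, hle⟩
    exact hb _ hu hle
end SA
end
end

section
open Set Topology MeasureTheory Filter
noncomputable section
namespace SA

def AS (g : ℂ → ℝ) (p : ℂ → ℂ) : Prop :=
  ContinuousOn p {z | g z ≤ 1} ∧ DifferentiableOn ℂ p {z | g z < 1}

def Bd (g : ℂ → ℝ) : Set ℂ := {z | g z = 1}

def IsRep (g : ℂ → ℝ) (μ : Measure (Bd g)) : Prop :=
  ∀ p, AS g p → ∫ z, (p z).re ∂μ = (p 0).re

namespace StarG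
variable {g : ℂ → ℝ} {κ : ℝ}

theorem bd_isCompact (h : StarG g κ) : IsCompact (Bd g) := by
  apply h.isCompact.of_isClosed_subset (isClosed_eq h.cont continuous_const)
  intro z hz
  exact le_of_eq hz

theorem bd_ne (h : StarG g κ) {z : ℂ} (hz : g z = 1) : z ≠ 0 := by
  rintro rfl; rw [h.zero] at hz; norm_num at hz

theorem as_cont_bd {p : ℂ → ℂ} (hp : AS g p) : Continuous (fun z : Bd g => p z) :=
  hp.1.comp_continuous continuous_subtype_val (fun z => le_of_eq z.2)

/-- max principle -/
theorem max_principle (h : StarG g κ) {r : ℝ} {p : ℂ → ℂ} (hp : DifferentiableOn ℂ p {z | g z < r})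
    (hc : ContinuousOn p {z | g z ≤ r}) {C : ℝ} (hr : 0 < r) 
    (hb : ∀ z, g z = r → ‖p z‖ ≤ C) {z : ℂ} (hz : g z < r) : ‖p z‖ ≤ C := by
  have hcl : closure {z | g z < r} ⊆ {z | g z ≤ r} :=
    closure_lt_subset_le h.cont continuous_const
  have hfr : frontier {z | g z < r} ⊆ {z | g z = r} := frontier_lt_subset_eq h.cont continuous_const
  have hbdd : Bornology.IsBounded {z | g z < r} := by
    have h1 : {z | g z < r} ⊆ (fun z => (r:ℂ) * z) '' {z | g z ≤ 1} := by
      intro z hz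
      refine ⟨((r⁻¹ : ℝ) : ℂ) * z, ?_, ?_⟩
      · change g _ ≤ 1
        rw [h.hom _ (inv_pos.2 hr).le, inv_mul_le_iff₀ hr, mul_one]
        exact le_of_lt hz
      · have : (r:ℂ) ≠ 0 := by exact_mod_cast hr.ne'
        push_cast
        field_simp
    exact ((h.isCompact.image (by fun_prop)).isBounded).subset h1
  exact Complex.norm_le_of_forall_mem_frontier_norm_le hbdd ⟨hp, hc.mono hcl⟩
    (fun w hw => hb w (hfr hw)) (subset_closure hz)

theorem re_nonneg (h : StarG g κ) {p : ℂ → ℂ} (hp : AS g p) (hb : ∀ z, g z = 1 → 0 ≤ (p z).re) : 0 ≤ (p 0).re := by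
  have := h.max_principle (r := 1) (p := fun z => Complex.exp (-p z)) (C := 1) (hp.2.neg.cexp)
    (hp.1.neg.cexp) one_pos (by
      intro z hz
      rw [Complex.norm_exp, Real.exp_le_one_iff]
      simpa using hb z hz) (z := 0) (by rw [h.zero]; norm_num)
  rw [Complex.norm_exp, Real.exp_le_one_iff] at this
  simpa using this

theorem star_rep (h : StarG g κ) (χ : C(Bd g, ℝ)) (b : ℝ)
    (hb : ∀ p, AS g p → (∀ z : Bd g, χ z ≤ (p z).re) → b ≤ (p 0).re) :
    ∃ μ : Measure (Bd g), IsFiniteMeasure μ ∧ IsRep g μ ∧ b ≤ ∫ z, χ z ∂μ := by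
  haveI : CompactSpace (Bd g) := isCompact_iff_compactSpace.1 h.bd_isCompact
  let R : Submodule ℝ (C(Bd g, ℝ) × ℝ) :=
    { carrier := {q | ∃ p, AS g p ∧ (∀ z : Bd g, q.1 z = (p z).re) ∧ q.2 = (p 0).re}
      add_mem' := by
        rintro a b ⟨p, hp, h1, h2⟩ ⟨q, hq, h3, h4⟩
        exact ⟨fun z => p z + q z, ⟨hp.1.add hq.1, hp.2.add hq.2⟩, fun z => by simp [h1, h3],
          by simp [h2, h4]⟩
      zero_mem' := ⟨fun _ => 0, ⟨continuousOn_const, differentiableOn_const _⟩, by simp, by simp⟩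
      smul_mem' := by
        rintro c a ⟨p, hp, h1, h2⟩
        refine ⟨fun z => c * p z, ⟨continuousOn_const.mul hp.1, hp.2.const_mul _⟩, fun z => by simp [h1],
          by simp [h2]⟩ }
  obtain ⟨μ, h1, h2, h3⟩ := rep_measure R
    ⟨fun _ => 1, ⟨continuousOn_const, differentiableOn_const _⟩, by simp, by simp⟩
    (by
      rintro ⟨u, c⟩ ⟨p, hp, h1, h2⟩ hpos
      simp only at h1 h2 hpos ⊢
      rw [h2]
      refine h.re_nonneg hp fun z hz => ?_
      have h3 : (0:ℝ) ≤ u ⟨z, hz⟩ := hpos ⟨z, hz⟩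
      rwa [h1] at h3)
    χ b (by
      rintro ⟨u, c⟩ ⟨p, hp, h1, h2⟩ hle
      simp only at h1 h2 hle ⊢
      rw [h2]
      refine hb p hp fun z => ?_
      rw [← h1]; exact hle z)
  refine ⟨μ, h1, fun p hp => ?_, h3⟩
  exact h2 (⟨fun z => (p z).re, Complex.continuous_re.comp (as_cont_bd hp)⟩, (p 0).re)
    ⟨p, hp, fun z => rfl, rfl⟩

theorem P2 (h : StarG g κ) {Z : Set ℝ} (hZm : MeasurableSet Z) (hZ : Z ⊆ Ioc 0 (2 * Real.pi))
    (hbig : √(1 + κ ^ 2) * (2 * Real.pi - volume.real Z) < 2 * Real.pi) :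
    ∃ c > 0, ∀ p, AS g p → (∀ z, g z = 1 → 0 ≤ (p z).re) → (∀ θ ∈ Z, 1 ≤ (p (bt g θ)).re) →
      c ≤ (p 0).re := by
  set Λ := √(1 + κ ^ 2) with hΛ
  have hΛ1 : 0 < Λ := by positivity
  have hπ := Real.pi_pos
  have ht : Tendsto (fun N : ℝ => Λ * ((2 * Real.pi - volume.real Z) + Real.exp (-N) * volume.real Z)) atTop
      (𝓝 (Λ * ((2 * Real.pi - volume.real Z) + 0 * volume.real Z))) :=
    ((Real.tendsto_exp_neg_atTop_nhds_zero.mul_const _).const_add _).const_mul _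
  rw [zero_mul, add_zero] at ht
  have hZfin : volume Z ≠ ⊤ := (measure_mono hZ |>.trans_lt measure_Ioc_lt_top).ne
  obtain ⟨N, hN1, hN0⟩ := ((ht.eventually_lt_const hbig).and (eventually_gt_atTop 0)).exists
  set A := Λ * ((2 * Real.pi - volume.real Z) + Real.exp (-N) * volume.real Z) with hA
  have hlog : 0 < Real.log (2 * Real.pi / (max A 1)) := by
    apply Real.log_pos
    rw [one_lt_div (by positivity)]
    apply max_lt hN1
    linarith [Real.pi_gt_three]
  refine ⟨Real.log (2 * Real.pi / (max A 1)) / N, by positivity, fun p hp h0 h1 => ?_⟩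
  have hq : AS g (fun z => Complex.exp (-(N * p z))) :=
    ⟨((continuousOn_const.mul hp.1).neg).cexp, ((hp.2.const_mul _).neg).cexp⟩
  have key := h.P1 hq.1 hq.2
  simp only [Complex.norm_exp] at key
  have hre : ∀ z, (-((N:ℂ) * p z)).re = -(N * (p z).re) := by intro z; simp
  simp only [hre] at key
  have hintg : ∫ θ in (0:ℝ)..(2 * Real.pi), Real.exp (-(N * (p (bt g θ)).re)) ≤
      (2 * Real.pi - volume.real Z) + Real.exp (-N) * volume.real Z := by
    have hcont : Continuous fun θ => Real.exp (-(N * (p (bt g θ)).re)) := by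
      have : Continuous fun θ => p (bt g θ) :=
        hp.1.comp_continuous h.bt_cont (fun t => (h.g_bt t).le)
      exact Real.continuous_exp.comp ((continuous_const.mul (Complex.continuous_re.comp this)).neg)
    rw [intervalIntegral.integral_of_le (by positivity)]
    have hi : IntegrableOn (fun θ => Real.exp (-(N * (p (bt g θ)).re))) (Ioc 0 (2 * Real.pi)) := 
      (hcont.integrableOn_Icc).mono_set Ioc_subset_Icc_self
    have hsplit : Ioc 0 (2 * Real.pi) = (Ioc 0 (2 * Real.pi) \ Z) ∪ Z := by
      rw [sdiff_union_self, union_eq_left.2 hZ]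
    rw [hsplit, setIntegral_union disjoint_sdiff_left hZm (hi.mono_set sdiff_subset) (hi.mono_set hZ)]
    apply add_le_add
    · have : ∫ θ in Ioc 0 (2 * Real.pi) \ Z, Real.exp (-(N * (p (bt g θ)).re)) ≤
        ∫ θ in Ioc 0 (2 * Real.pi) \ Z, (1:ℝ) := by
        apply setIntegral_mono_on (hi.mono_set sdiff_subset)
        · refine integrableOn_const ?_
          exact (measure_mono sdiff_subset |>.trans_lt measure_Ioc_lt_top).ne
        · exact measurableSet_Ioc.diff hZm
        · intro θ _
          rw [Real.exp_le_one_iff]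
          have := h0 _ (h.g_bt θ)
          have := mul_nonneg hN0.le this
          linarith
      refine this.trans (le_of_eq ?_)
      rw [setIntegral_const, smul_eq_mul, mul_one, measureReal_sdiff hZ hZm measure_Ioc_lt_top.ne]
      simp [Real.volume_real_Ioc_of_le (show (0:ℝ) ≤ 2 * Real.pi by positivity)]
    · have : ∫ θ in Z, Real.exp (-(N * (p (bt g θ)).re)) ≤ ∫ θ in Z, Real.exp (-N) := by
        apply setIntegral_mono_on (hi.mono_set hZ)
        · exact integrableOn_const hZfin
        · exact hZm
        · intro θ hθ
          apply Real.exp_le_exp.2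
          have := mul_le_mul_of_nonneg_left (h1 θ hθ) hN0.le
          linarith
      refine this.trans (le_of_eq ?_)
      rw [setIntegral_const, smul_eq_mul, mul_comm]
  have key2 : 2 * Real.pi * Real.exp (-(N * (p 0).re)) ≤ max A 1 :=
    (key.trans (mul_le_mul_of_nonneg_left hintg hΛ1.le)).trans (le_max_left _ _)
  rw [div_le_iff₀ hN0, ← Real.exp_le_exp, Real.exp_log (by positivity)]
  rw [div_le_iff₀ (by positivity)]
  rw [Real.exp_neg, ← div_eq_mul_inv, div_le_iff₀ (Real.exp_pos _)] at key2
  rw [mul_comm (p 0).re]; linarith [mul_comm (max A 1) (Real.exp (N * (p 0).re))]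

end StarG
end SA
end
end

section
open Set Topology MeasureTheory Filter
noncomputable section
namespace SA
namespace StarG
variable {g : ℂ → ℝ} {κ : ℝ}

theorem slit (h : StarG g κ) {z a : ℂ} (hlt : g z < g a) : 1 - z / a ∈ Complex.slitPlane := by
  by_contra hn
  rw [Complex.mem_slitPlane_iff_not_le_zero, not_not] at hn
  have ha : a ≠ 0 := by
    rintro rfl
    rw [h.zero] at hlt
    exact absurd hlt (not_lt.2 (h.nonneg z))
  obtain ⟨h1, h2⟩ := Complex.le_def.1 hn
  simp only [Complex.zero_re, Complex.zero_im] at h1 h2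
  have e : z / a = ((z / a).re : ℂ) := by
    apply Complex.ext
    · simp
    · simp only [Complex.sub_im, Complex.one_im] at h2
      simp only [Complex.ofReal_im]; linarith
  have h3 : 1 ≤ (z / a).re := by
    simp only [Complex.sub_re, Complex.one_re] at h1; linarith
  have : z = ((z / a).re : ℂ) * a := by rw [← e]; field_simp
  rw [this, h.hom _ (by linarith)] at hlt
  have := h.pos a ha
  nlinarith

variable {μ : Measure (Bd g)} [IsFiniteMeasure μ]

theorem mass (h : StarG g κ) (hμ : IsRep g μ) : μ.real univ = 1 := by
  have := hμ (fun _ => 1) ⟨continuousOn_const, differentiableOn_const _⟩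
  simpa using this

theorem integrable_of_cont (h : StarG g κ) {f : Bd g → ℝ} (hf : Continuous f) : Integrable f μ := by
  haveI : CompactSpace (Bd g) := isCompact_iff_compactSpace.1 h.bd_isCompact
  exact hf.integrable_of_hasCompactSupport (HasCompactSupport.of_compactSpace f)

theorem integrable_of_contC (h : StarG g κ) {f : Bd g → ℂ} (hf : Continuous f) : Integrable f μ := by
  haveI : CompactSpace (Bd g) := isCompact_iff_compactSpace.1 h.bd_isCompact
  exact hf.integrable_of_hasCompactSupport (HasCompactSupport.of_compactSpace f)

theorem log_cont (h : StarG g κ) {a : ℂ} (ha : g a ≠ 1) : Continuous fun z : Bd g => Real.log ‖(z:ℂ) - a‖ := by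
  apply Continuous.log (by fun_prop)
  intro z hz
  rw [norm_eq_zero, sub_eq_zero] at hz
  apply ha; rw [← hz]; exact z.2

theorem J1 (h : StarG g κ) (hμ : IsRep g μ) {a : ℂ} (ha : 1 < g a) : ∫ z : Bd g, Real.log ‖(z:ℂ) - a‖ ∂μ = Real.log ‖a‖ := by
  have ha0 : a ≠ 0 := by rintro rfl; rw [h.zero] at ha; norm_num at ha
  have hs : ∀ z, g z ≤ 1 → 1 - z / a ∈ Complex.slitPlane := fun z hz => h.slit (hz.trans_lt ha)
  have h1 := hμ (fun z => Complex.log (1 - z / a)) ⟨by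
    apply ContinuousOn.clog (by fun_prop) (fun z hz => hs z hz), by
    apply DifferentiableOn.clog (by fun_prop) (fun z hz => hs z (le_of_lt hz))⟩
  simp only [Complex.log_re, zero_div, sub_zero, norm_one, Real.log_one] at h1
  have h2 : ∀ z : Bd g, Real.log ‖1 - (z:ℂ) / a‖ = Real.log ‖(z:ℂ) - a‖ - Real.log ‖a‖ := by
    intro z
    have : (z:ℂ) - a ≠ 0 := by
      intro hz; rw [sub_eq_zero] at hz; rw [← hz] at ha; exact absurd z.2 (ne_of_gt ha)
    rw [← Real.log_div (norm_ne_zero_iff.2 this) (norm_ne_zero_iff.2 ha0), ← norm_div, ← norm_neg]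
    congr 2; field_simp; ring
  simp only [h2] at h1
  rw [integral_sub (h.integrable_of_cont (h.log_cont ha.ne')) (integrable_const _)] at h1
  simp [h.mass hμ] at h1
  linarith

theorem Phi_deriv (h : StarG g κ) {a : ℂ} (ha : g a < 1) :
    DifferentiableAt ℂ (fun a => ∫ z : Bd g, Complex.log (1 - a / z) ∂μ) a := by
  obtain ⟨K, hK, hlip⟩ := h.lip
  set r := (1 + g a) / 2 with hr
  have hU : {w | g w < r} ∈ 𝓝 a := (isOpen_lt h.cont continuous_const).mem_nhds (by
    change g a < r; rw [hr]; linarith)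
  have hsl : ∀ z : Bd g, ∀ w, g w < 1 → 1 - w / (z:ℂ) ∈ Complex.slitPlane := fun z w hw =>
    h.slit (hw.trans_eq (z.2 : g z = 1).symm)
  have hz0 : ∀ z : Bd g, (z:ℂ) ≠ 0 := fun z => h.bd_ne z.2
  have hcd : ∀ w : ℂ, Continuous fun z : Bd g => w / (z:ℂ) := fun w =>
    continuous_const.div continuous_subtype_val hz0
  have hr1 : r < 1 := by rw [hr]; linarith
  have hne : ∀ w, g w < 1 → ∀ z : Bd g, (w:ℂ) - z ≠ 0 := by
    intro w hw z hz
    rw [sub_eq_zero] at hz; rw [hz] at hw; exact absurd z.2 (ne_of_lt hw)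
  refine (hasDerivAt_integral_of_dominated_loc_of_deriv_le (μ := μ) (bound := fun _ => K / (1 - r))
    (F := fun a (z : Bd g) => Complex.log (1 - a / z)) (F' := fun w z => (w - (z:ℂ))⁻¹)
    hU ?_ ?_ ?_ ?_ ?_ ?_).2.differentiableAt
  · filter_upwards [hU] with w hw
    have : Continuous fun z : Bd g => Complex.log (1 - w / z) :=
      (continuous_const.sub (hcd w)).clog (fun z => hsl z w (lt_trans hw hr1))
    exact (h.integrable_of_contC (μ := μ) this).1
  · apply h.integrable_of_contC
    exact (continuous_const.sub (hcd a)).clog (fun z => hsl z a ha)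
  · have : Continuous fun z : Bd g => (a - (z:ℂ))⁻¹ :=
      (by fun_prop : Continuous fun z : Bd g => (a - (z:ℂ))).inv₀ (hne a ha)
    exact (h.integrable_of_contC (μ := μ) this).1
  · refine ae_of_all _ fun z w hw => ?_
    have hw' : g w < r := hw
    have h1 := hlip z w
    rw [(z.2 : g z = 1)] at h1
    have h2 : 1 - r ≤ K * ‖w - (z:ℂ)‖ := by
      rw [norm_sub_rev]
      exact (le_trans (by linarith) (le_abs_self _)).trans h1
    have h3 : 0 < ‖w - (z:ℂ)‖ := norm_pos_iff.2 (hne w (hw'.trans hr1) z)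
    rw [norm_inv, inv_le_iff_one_le_mul₀ h3, div_mul_eq_mul_div, le_div_iff₀ (by linarith)]
    linarith
  · exact integrable_const _
  · refine ae_of_all _ fun z w hw => ?_
    have hw' : g w < 1 := lt_trans hw hr1
    have h1 : HasDerivAt (fun w : ℂ => 1 - w / (z:ℂ)) (-(1 / (z:ℂ))) w := 
      ((hasDerivAt_id w).div_const _).const_sub 1
    refine (h1.clog (hsl z w hw')).congr_deriv ?_
    have h2 := hne w hw' z
    have h3 := hz0 z
    have h4 : 1 - w / (z:ℂ) ≠ 0 := Complex.slitPlane_ne_zero (hsl z w hw')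
    have h5 : (z:ℂ) - w ≠ 0 := by rw [← neg_sub]; exact neg_ne_zero.2 h2
    field_simp
    ring

theorem log_split (h : StarG g κ) {a : ℂ} (ha : g a < 1) (z : Bd g) : (Complex.log (1 - a / z)).re =
    Real.log ‖(z:ℂ) - a‖ - Real.log ‖(z:ℂ)‖ := by
  have hz0 : (z:ℂ) ≠ 0 := h.bd_ne z.2
  have hne : (z:ℂ) - a ≠ 0 := by
    intro hz; rw [sub_eq_zero] at hz; rw [← hz] at ha; exact absurd z.2 (ne_of_lt ha)
  rw [Complex.log_re, ← Real.log_div (norm_ne_zero_iff.2 hne) (norm_ne_zero_iff.2 hz0), ← norm_div]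
  congr 2; field_simp

theorem Phi_re (h : StarG g κ) {a : ℂ} (ha : g a < 1) : (∫ z : Bd g, Complex.log (1 - a / z) ∂μ).re =
    ∫ z : Bd g, Real.log ‖(z:ℂ) - a‖ ∂μ - ∫ z : Bd g, Real.log ‖(z:ℂ)‖ ∂μ := by
  have hz0 : ∀ z : Bd g, (z:ℂ) ≠ 0 := fun z => h.bd_ne z.2
  have hi : Integrable (fun z : Bd g => Complex.log (1 - a / z)) μ := by
    apply h.integrable_of_contC
    exact (continuous_const.sub (continuous_const.div continuous_subtype_val hz0)).clog
      (fun z => h.slit (ha.trans_eq (z.2 : g z = 1).symm))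
  have h1 : (∫ z : Bd g, Complex.log (1 - a / z) ∂μ).re = ∫ z : Bd g, (Complex.log (1 - a / z)).re ∂μ :=
    (Complex.reCLM.integral_comp_comm hi).symm
  rw [h1]
  simp only [h.log_split ha]
  apply integral_sub (h.integrable_of_cont (h.log_cont ha.ne))
  have := h.log_cont (a := 0) (by rw [h.zero]; norm_num)
  simp only [sub_zero] at this
  exact h.integrable_of_cont this

end StarG
end SA
end
end

section
open Set Topology MeasureTheory Filter
noncomputable section
namespace SA

theorem log_refl_aux {t t' d R K B ε : ℝ} (ht : 0 < t) (ht' : 0 < t') (hR : 1 ≤ R) (hK : 0 < K)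
    (hd : 0 < d) (hε : 0 < ε) (hB : 0 < B)
    (h1 : t' ≤ t + 4 * R * d) (h2 : d ≤ K * t) (h3 : t' ≤ B) (h4 : 4 * R * √d ≤ ε)
    (h5 : √d ≤ B / ((1 + 4 * R * K) * Real.exp (Real.log (1 + 4 * R * K) / ε))) :
    Real.log t' - Real.log t ≤ ε + ε * (Real.log B - Real.log t') := by
  have hlog : 0 ≤ Real.log B - Real.log t' := sub_nonneg.2 (Real.log_le_log ht' h3)
  have hsd : 0 < √d := Real.sqrt_pos.2 hd
  have hdd : √d * √d = d := Real.mul_self_sqrt hd.le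
  by_cases hc : √d ≤ t
  · have e1 : Real.log t' - Real.log t ≤ t' / t - 1 := by
      rw [← Real.log_div ht'.ne' ht.ne']
      exact Real.log_le_sub_one_of_pos (by positivity)
    have e2 : t' / t - 1 ≤ 4 * R * √d := by
      rw [div_sub_one ht.ne', div_le_iff₀ ht]
      calc t' - t ≤ 4 * R * d := by linarith
        _ = 4 * R * √d * √d := by rw [mul_assoc (4 * R), hdd]
        _ ≤ 4 * R * √d * t := by gcongr
    have : 0 ≤ ε * (Real.log B - Real.log t') := by positivity
    linarith
  · push Not at hc
    set C := 1 + 4 * R * K with hC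
    have hCp : 0 < C := by positivity
    have e1 : t' ≤ C * t := by
      rw [hC]
      have : 4 * R * d ≤ 4 * R * (K * t) := by gcongr
      nlinarith
    have e2 : Real.log t' - Real.log t ≤ Real.log C := by
      have := Real.log_le_log ht' e1
      rw [Real.log_mul hCp.ne' ht.ne'] at this
      linarith
    have e3 : Real.log t' ≤ Real.log B - Real.log C / ε := by
      have : t' ≤ B / Real.exp (Real.log C / ε) := by
        calc t' ≤ C * t := e1
          _ ≤ C * √d := by gcongr
          _ ≤ C * (B / (C * Real.exp (Real.log C / ε))) := by gcongr
          _ = _ := by field_simp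
      have := Real.log_le_log ht' this
      rwa [Real.log_div hB.ne' (Real.exp_pos _).ne', Real.log_exp] at this
    have e4 : Real.log C ≤ ε * (Real.log B - Real.log t') := by
      have : Real.log C / ε ≤ Real.log B - Real.log t' := by linarith
      rwa [div_le_iff₀' hε] at this
    linarith

namespace StarG
variable {g : ℂ → ℝ} {κ : ℝ}
variable {μ : Measure (Bd g)} [IsFiniteMeasure μ]

theorem J2_bound (h : StarG g κ) (hμ : IsRep g μ) : ∃ C : ℝ, ∀ ε > 0, ∃ r₀ < 1, ∀ r, r₀ < r → r < 1 → ∀ a, g a = r → 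
    Real.log ‖a‖ - ε * C ≤ ∫ z : Bd g, Real.log ‖(z:ℂ) - a‖ ∂μ := by
  obtain ⟨K, hK, hlip⟩ := h.lip
  obtain ⟨R0, hR0⟩ := h.isCompact.isBounded.exists_norm_le
  set R := max R0 1 with hRdef
  have hR1 : 1 ≤ R := le_max_right _ _
  have hR : ∀ z, g z ≤ 1 → ‖z‖ ≤ R := fun z hz => (hR0 z hz).trans (le_max_left _ _)
  set B := 4 * R with hB
  have hBp : 0 < B := by positivity
  refine ⟨1 + Real.log B + Real.log K, fun ε hε => ?_⟩
  set A := (1 + 4 * R * K) * Real.exp (Real.log (1 + 4 * R * K) / ε) with hA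
  have hAp : 0 < A := by positivity
  set s := min (ε / (4 * R)) (B / A) with hs
  have hsp : 0 < s := lt_min (by positivity) (by positivity)
  refine ⟨max (1/2) (1 - s ^ 2), max_lt (by norm_num) (by nlinarith), fun r hr0 hr1 a ha => ?_⟩
  have hr2 : 1/2 < r := (le_max_left _ _).trans_lt hr0
  have hr3 : 1 - s^2 < r := (le_max_right _ _).trans_lt hr0
  have hrp : 0 < r := by linarith
  set d := 1 - r with hd
  have hdp : 0 < d := by linarith
  have hsd : √d ≤ s := by
    rw [Real.sqrt_le_left hsp.le]; linarith
  -- reflected point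
  set a' : ℂ := ((r⁻¹ ^ 2 : ℝ) : ℂ) * a with ha'
  have hga' : g a' = r⁻¹ := by
    rw [ha', h.hom _ (by positivity), ha]; field_simp
  have hga1 : 1 < g a' := by rw [hga']; exact (one_lt_inv₀ hrp).2 hr1
  have hz1 : g (((r⁻¹ : ℝ):ℂ) * a) = 1 := by
    rw [h.hom _ (by positivity), ha]; field_simp
  have hna : ‖a‖ ≤ r * R := by
    have := hR _ hz1.le
    rw [norm_mul, Complex.norm_real, Real.norm_of_nonneg (by positivity), inv_mul_le_iff₀ hrp] at this
    exact this
  have ha0 : a ≠ 0 := by rintro rfl; rw [h.zero] at ha; linarith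
  have hsub : ‖a' - a‖ ≤ 4 * R * d := by
    have e : a' - a = ((r⁻¹ ^ 2 - 1 : ℝ) : ℂ) * a := by rw [ha']; push_cast; ring
    have e2 : 1 ≤ r⁻¹ ^ 2 := by
      rw [inv_pow]; exact (one_le_inv₀ (by positivity)).2 (by nlinarith)
    rw [e, norm_mul, Complex.norm_real, Real.norm_of_nonneg (by linarith)]
    calc (r⁻¹ ^ 2 - 1) * ‖a‖ ≤ (r⁻¹ ^ 2 - 1) * (r * R) := by gcongr
      _ = (1 + r) / r * d * R := by rw [hd]; field_simp; ring
      _ ≤ 4 * d * R := by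
        gcongr; rw [div_le_iff₀ hrp]; linarith
      _ = _ := by ring
  have hna' : ‖a'‖ ≤ 2 * R := by
    rw [ha', norm_mul, Complex.norm_real, Real.norm_of_nonneg (by positivity)]
    calc r⁻¹ ^ 2 * ‖a‖ ≤ r⁻¹ ^ 2 * (r * R) := by gcongr
      _ = r⁻¹ * R := by field_simp
      _ ≤ 2 * R := by
        gcongr
        rw [inv_le_comm₀ hrp (by norm_num)]; linarith
  have hpt : ∀ z : Bd g, Real.log ‖(z:ℂ) - a'‖ - Real.log ‖(z:ℂ) - a‖ ≤
      ε + ε * (Real.log B - Real.log ‖(z:ℂ) - a'‖) := by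
    intro z
    have hz : g z = 1 := z.2
    refine log_refl_aux (R := R) (K := K) (d := d) ?_ ?_ hR1 hK hdp hε hBp ?_ ?_ ?_ ?_ ?_
    · rw [norm_pos_iff, sub_ne_zero]; intro e; rw [e] at hz; linarith
    · rw [norm_pos_iff, sub_ne_zero]; intro e; rw [e] at hz; linarith
    · calc ‖(z:ℂ) - a'‖ = ‖((z:ℂ) - a) - (a' - a)‖ := by congr 1; ring
        _ ≤ _ := (norm_sub_le _ _).trans (by gcongr)
    · have := (le_abs_self _).trans (hlip z a)
      rw [hz, ha] at this
      exact this
    · calc ‖(z:ℂ) - a'‖ ≤ ‖(z:ℂ)‖ + ‖a'‖ := norm_sub_le _ _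
        _ ≤ R + 2 * R := add_le_add (hR _ hz.le) hna'
        _ ≤ B := by linarith
    · calc 4 * R * √d ≤ 4 * R * (ε / (4 * R)) := by gcongr; exact hsd.trans (min_le_left _ _)
        _ = ε := by field_simp
    · exact hsd.trans (min_le_right _ _)
  have hia := h.integrable_of_cont (μ := μ) (h.log_cont (a := a) (by rw [ha]; exact hr1.ne))
  have hia' := h.integrable_of_cont (μ := μ) (h.log_cont (a := a') hga1.ne')
  have hJ := h.J1 hμ hga1
  have hintg := integral_mono ((hia'.const_mul (1 + ε)).sub (integrable_const (ε + ε * Real.log B))) hia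
    (fun z => by
      have := hpt z
      simp only [Pi.sub_apply]
      linarith)
  simp only [Pi.sub_apply] at hintg
  rw [integral_sub (hia'.const_mul (1 + ε)) (integrable_const _), integral_const_mul, hJ, integral_const,
    h.mass hμ, one_smul] at hintg
  have e1 : 1 ≤ K * ‖a'‖ := by
    have := (le_abs_self _).trans (hlip a' 0)
    rw [h.zero, sub_zero, sub_zero] at this
    linarith
  have e0 : 0 < ‖a'‖ := by
    rcases (norm_nonneg a').eq_or_lt with e | e
    · rw [← e] at e1; linarith
    · exact e
  have e2 : 0 ≤ Real.log K + Real.log ‖a'‖ := by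
    rw [← Real.log_mul hK.ne' e0.ne']; exact Real.log_nonneg e1
  have e3 : Real.log ‖a‖ ≤ Real.log ‖a'‖ := by
    apply Real.log_le_log (norm_pos_iff.2 ha0)
    rw [ha', norm_mul, Complex.norm_real, Real.norm_of_nonneg (by positivity)]
    refine le_mul_of_one_le_left (norm_nonneg _) ?_
    rw [inv_pow]; exact (one_le_inv₀ (by positivity)).2 (by nlinarith)
  nlinarith [mul_nonneg hε.le e2]

theorem J2 (h : StarG g κ) (hμ : IsRep g μ) {a : ℂ} (ha0 : a ≠ 0) (ha : g a < 1) :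
    Real.log ‖a‖ ≤ ∫ z : Bd g, Real.log ‖(z:ℂ) - a‖ ∂μ := by
  obtain ⟨C, hC⟩ := h.J2_bound hμ
  set C0 := ∫ z : Bd g, Real.log ‖(z:ℂ)‖ ∂μ with hC0
  set Ψ : ℂ → ℂ := fun a => a * Complex.exp (-∫ z : Bd g, Complex.log (1 - a / z) ∂μ) with hΨ
  have hd : DifferentiableOn ℂ Ψ {a | g a < 1} := by
    intro w hw
    exact (differentiableAt_id.mul (h.Phi_deriv hw).neg.cexp).differentiableWithinAt
  have hn : ∀ w, w ≠ 0 → g w < 1 → ‖Ψ w‖ = Real.exp (Real.log ‖w‖ - ∫ z : Bd g, Real.log ‖(z:ℂ) - w‖ ∂μ + C0) := by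
    intro w hw0 hw
    rw [hΨ]
    simp only [norm_mul, Complex.norm_exp, Complex.neg_re, h.Phi_re hw]
    rw [sub_add, Real.exp_sub, Real.exp_log (norm_pos_iff.2 hw0), Real.exp_neg]
    field_simp
    rfl
  have key : ∀ ε > 0, Real.log ‖a‖ - ∫ z : Bd g, Real.log ‖(z:ℂ) - a‖ ∂μ ≤ ε * C := by
    intro ε hε
    obtain ⟨r₀, hr0, H⟩ := hC ε hε
    obtain ⟨r, hr1, hr2⟩ := exists_between (max_lt hr0 ha)
    have hr3 := (le_max_left _ _).trans_lt hr1
    have hr4 := (le_max_right _ _).trans_lt hr1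
    have hrp : 0 < r := (h.nonneg a).trans_lt hr4
    have := h.max_principle (r := r) (p := Ψ) (hd.mono fun w hw => lt_trans hw hr2)
      (hd.continuousOn.mono fun w hw => lt_of_le_of_lt hw hr2) (C := Real.exp (ε * C + C0)) hrp (by
        intro w hw
        have hw0 : w ≠ 0 := by rintro rfl; rw [h.zero] at hw; linarith
        rw [hn w hw0 (hw.trans_lt hr2)]
        apply Real.exp_le_exp.2
        have := H r hr3 hr2 w hw
        linarith) hr4
    rw [hn a ha0 ha] at this
    have := Real.exp_le_exp.1 this
    linarith
  have ht : Tendsto (fun ε : ℝ => ε * C) (𝓝[>] 0) (𝓝 (0 * C)) :=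
    (tendsto_id.mul_const C).mono_left nhdsWithin_le_nhds
  rw [zero_mul] at ht
  have := ge_of_tendsto ht (eventually_mem_nhdsWithin.mono key)
  linarith

end StarG
end SA
end
end

section
open Set Topology MeasureTheory Filter
noncomputable section
namespace SA

/-- divide out a zero -/
theorem divide_zero {U : Set ℂ} (hU : IsOpen U) (hUc : IsPreconnected U) {F : ℂ → ℂ} (hF : DifferentiableOn ℂ F U)
    {b a : ℂ} (hb : b ∈ U) (hFb : F b ≠ 0) (ha : a ∈ U) :
    ∃ (n : ℕ) (G : ℂ → ℂ), DifferentiableOn ℂ G U ∧ G a ≠ 0 ∧ ∀ z ∈ U, F z = (z - a) ^ n * G z := by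
  have han : AnalyticOnNhd ℂ F U := hF.analyticOnNhd hU
  have hne : ¬ ∀ᶠ z in 𝓝 a, F z = 0 := by
    intro hh
    exact hFb (han.eqOn_zero_of_preconnected_of_eventuallyEq_zero hUc ha hh hb)
  obtain ⟨n, G0, hG0, hG0a, hev⟩ := ((han a ha).exists_eventuallyEq_pow_smul_nonzero_iff).2 hne
  refine ⟨n, fun z => if z = a then G0 a else F z / (z - a) ^ n, ?_, by simpa using hG0a, ?_⟩
  · intro w hw
    apply DifferentiableAt.differentiableWithinAt
    by_cases hwa : w = a
    · subst hwa
      apply hG0.differentiableAt.congr_of_eventuallyEq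
      filter_upwards [hev] with z hz
      split_ifs with h1
      · rw [h1]
      · rw [hz, smul_eq_mul]
        have := sub_ne_zero.2 h1
        field_simp
    · have h1 : DifferentiableAt ℂ (fun z => F z / (z - a) ^ n) w := by
        have := (hF w hw).differentiableAt (hU.mem_nhds hw)
        exact this.div (by fun_prop) (pow_ne_zero _ (sub_ne_zero.2 hwa))
      apply h1.congr_of_eventuallyEq
      filter_upwards [isOpen_ne.mem_nhds hwa] with z hz
      simp only [if_neg (show z ≠ a from hz)]
  · intro z hz
    by_cases h1 : z = a
    · subst h1
      simp only [if_true]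
      simpa using hev.self_of_nhds
    · simp only [if_neg h1]
      have := sub_ne_zero.2 h1
      field_simp

theorem zeros_finite {U : Set ℂ} (hU : IsOpen U) (hUc : IsPreconnected U) {F : ℂ → ℂ} (hF : DifferentiableOn ℂ F U)
    {b : ℂ} (hb : b ∈ U) (hFb : F b ≠ 0) {T : Set ℂ} (hT : IsCompact T) (hTU : T ⊆ U) :
    (T ∩ {z | F z = 0}).Finite := by
  by_contra hinf
  obtain ⟨z, hz, hacc⟩ := Set.Infinite.exists_accPt_of_subset_isCompact hinf hT inter_subset_left
  have h1 := (accPt_iff_frequently_nhdsNE).1 hacc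
  have han : AnalyticOnNhd ℂ F U := hF.analyticOnNhd hU
  exact hFb (han.eqOn_zero_of_preconnected_of_frequently_eq_zero hUc (hTU hz) (h1.mono fun w hw => hw.2) hb)

namespace StarG
variable {g : ℂ → ℝ} {κ : ℝ}

theorem starR (h : StarG g κ) {R : ℝ} {z : ℂ} (hz : g z < R) {t : ℝ} (ht : t ∈ Icc (0:ℝ) 1) : g (t * z) < R := by
  rw [h.hom _ ht.1]
  have := h.nonneg z
  nlinarith [ht.1, ht.2]

theorem preconn (h : StarG g κ) {R : ℝ} : IsPreconnected {z | g z < R} := by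
  rcases le_or_gt R 0 with hR | hR
  · have : {z | g z < R} = ∅ := by
      ext z; simp; exact hR.trans (h.nonneg z)
    rw [this]; exact isPreconnected_empty
  · have : StarConvex ℝ 0 {z | g z < R} := by
      rw [starConvex_zero_iff]
      intro z hz a ha ha'
      simpa using h.starR hz ⟨ha, ha'⟩
    exact this.isPathConnected (show g 0 < R by rw [h.zero]; exact hR) |>.isConnected.isPreconnected

variable {μ : Measure (Bd g)} [IsFiniteMeasure μ]

theorem J3a (h : StarG g κ) (hμ : IsRep g μ) {R : ℝ} (hR : 1 < R) {F : ℂ → ℂ} (hF : DifferentiableOn ℂ F {z | g z < R})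
    (hne : ∀ z, g z < R → F z ≠ 0) : ∫ z : Bd g, Real.log ‖F z‖ ∂μ = Real.log ‖F 0‖ := by
  have hop : IsOpen {z | g z < R} := isOpen_lt h.cont continuous_const
  have h0 : g 0 < R := by rw [h.zero]; linarith
  obtain ⟨P, hP⟩ := star_primitive hop (fun z hz t ht => h.starR hz ht)
    (h := fun z => deriv F z / F z) ((hF.deriv hop).div hF hne)
  have hFd : ∀ z, g z < R → HasDerivAt F (deriv F z) z := fun z hz =>
    ((hF z hz).differentiableAt (hop.mem_nhds hz)).hasDerivAt
  have hconst : ∀ z, g z < R → F z * Complex.exp (-P z) = F 0 * Complex.exp (-P 0) := by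
    intro z hz
    have hd : ∀ w ∈ {z | g z < R}, HasDerivAt (fun z => F z * Complex.exp (-P z)) 0 w := by
      intro w hw
      refine ((hFd w hw).mul ((hP w hw).neg.cexp)).congr_deriv ?_
      have := hne w hw
      field_simp; ring
    exact hop.is_const_of_deriv_eq_zero h.preconn
      (fun w hw => (hd w hw).differentiableAt.differentiableWithinAt) (fun w hw => (hd w hw).deriv) hz h0
  have hlog : ∀ z, g z < R → Real.log ‖F z‖ = (P z).re + (Real.log ‖F 0‖ - (P 0).re) := by
    intro z hz
    have := congrArg (fun w => Real.log ‖w‖) (hconst z hz)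
    simp only [norm_mul, Complex.norm_exp] at this
    rw [Real.log_mul (norm_ne_zero_iff.2 (hne z hz)) (Real.exp_pos _).ne',
      Real.log_mul (norm_ne_zero_iff.2 (hne 0 h0)) (Real.exp_pos _).ne', Real.log_exp, Real.log_exp] at this
    simp only [Complex.neg_re] at this
    linarith
  have hPd : DifferentiableOn ℂ P {z | g z < R} := fun z hz =>
    (hP z hz).differentiableAt.differentiableWithinAt
  have hAS : AS g P := ⟨hPd.continuousOn.mono fun z hz => lt_of_le_of_lt hz hR,
    hPd.mono fun z hz => lt_trans hz hR⟩
  have h1 : ∀ z : Bd g, Real.log ‖F z‖ = (P z).re + (Real.log ‖F 0‖ - (P 0).re) :=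
    fun z => hlog z ((z.2 : g z = 1).trans_lt hR)
  simp only [h1]
  rw [integral_add (f := fun z : Bd g => (P z).re) (h.integrable_of_cont (Complex.continuous_re.comp (as_cont_bd hAS))) (integrable_const _),
    hμ P hAS, integral_const, h.mass hμ, one_smul]
  ring

theorem J3b (h : StarG g κ) (hμ : IsRep g μ) {R : ℝ} (hR : 1 < R) (n : ℕ) : ∀ {F : ℂ → ℂ}, DifferentiableOn ℂ F {z | g z < R} → 
    F 0 ≠ 0 → {z | g z < R ∧ F z = 0}.Finite → {z | g z < R ∧ F z = 0}.ncard = n →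
    (∀ z, g z = 1 → F z ≠ 0) →
    Real.log ‖F 0‖ ≤ ∫ z : Bd g, Real.log ‖F z‖ ∂μ := by
  have hop : IsOpen {z | g z < R} := isOpen_lt h.cont continuous_const
  have h0 : g 0 < R := by rw [h.zero]; linarith
  induction n with
  | zero =>
    intro F hF hF0 hfin hcard hbd
    rw [Set.ncard_eq_zero hfin] at hcard
    refine (h.J3a hμ hR hF fun z hz hz0 => ?_).ge
    have : z ∈ {z | g z < R ∧ F z = 0} := ⟨hz, hz0⟩
    rw [hcard] at this; exact this
  | succ n ih =>
    intro F hF hF0 hfin hcard hbd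
    obtain ⟨a, haR, haF⟩ : {z | g z < R ∧ F z = 0}.Nonempty := by
      rw [← Set.ncard_pos hfin]; omega
    obtain ⟨k, G, hG, hGa, hFG⟩ := divide_zero hop h.preconn hF h0 hF0 haR
    have ha0 : a ≠ 0 := by rintro rfl; exact hF0 haF
    have hset : {z | g z < R ∧ G z = 0} = {z | g z < R ∧ F z = 0} \ {a} := by
      ext z
      simp only [mem_ofPred_eq, Set.mem_sdiff, mem_singleton_iff]
      constructor
      · rintro ⟨h1, h2⟩
        exact ⟨⟨h1, by rw [hFG z h1, h2, mul_zero]⟩, fun e => hGa (e ▸ h2)⟩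
      · rintro ⟨⟨h1, h2⟩, h3⟩
        rw [hFG z h1, mul_eq_zero] at h2
        exact ⟨h1, h2.resolve_left (pow_ne_zero _ (sub_ne_zero.2 h3))⟩
    have hga : g a ≠ 1 := fun e => hbd a e haF
    have hG0 : G 0 ≠ 0 := by
      intro e; apply hF0; rw [hFG 0 h0, e, mul_zero]
    have hGbd : ∀ z, g z = 1 → G z ≠ 0 := by
      intro z hz e; apply hbd z hz; rw [hFG z (show g _ < R by rw [hz]; exact hR), e, mul_zero]
    have hih := ih hG hG0 (by rw [hset]; exact hfin.subset sdiff_subset)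
      (by rw [hset, Set.ncard_sdiff_singleton_of_mem (show a ∈ {z | g z < R ∧ F z = 0} from ⟨haR, haF⟩), hcard]; rfl) hGbd
    have hla : Real.log ‖a‖ ≤ ∫ z : Bd g, Real.log ‖(z:ℂ) - a‖ ∂μ := by
      rcases lt_or_gt_of_ne hga with e | e
      · exact h.J2 hμ ha0 e
      · exact (h.J1 hμ e).ge
    have e1 : Real.log ‖F 0‖ = k * Real.log ‖a‖ + Real.log ‖G 0‖ := by
      rw [hFG 0 h0, norm_mul, Real.log_mul (by simp [ha0]) (norm_ne_zero_iff.2 hG0), norm_pow, Real.log_pow]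
      simp
    have e2 : ∀ z : Bd g, Real.log ‖F z‖ = k * Real.log ‖(z:ℂ) - a‖ + Real.log ‖G z‖ := by
      intro z
      have hz : g z = 1 := z.2
      have hza : (z:ℂ) - a ≠ 0 := by
        intro e; rw [sub_eq_zero] at e; exact hga (by rw [← e]; exact hz)
      rw [hFG z (show g _ < R by rw [hz]; exact hR), norm_mul, norm_pow, Real.log_mul (by simp [hza])
        (norm_ne_zero_iff.2 (hGbd z hz)), Real.log_pow]
    simp only [e2, e1]
    rw [integral_add ((h.integrable_of_cont (h.log_cont hga)).const_mul _) ?_, integral_const_mul]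
    · gcongr
    · apply h.integrable_of_cont
      apply Continuous.log
      · apply Continuous.norm
        exact hG.continuousOn.comp_continuous continuous_subtype_val (fun z => (z.2 : g z = 1).trans_lt hR)
      · intro z; exact norm_ne_zero_iff.2 (hGbd z z.2)

theorem J3 (h : StarG g κ) (hμ : IsRep g μ) {D : ℂ → ℂ} (hD : AS g D) (hD0 : D 0 ≠ 0) {ε : ℝ} (hε : 0 < ε) :
    Real.log ‖D 0‖ ≤ ∫ z : Bd g, Real.log (max ‖D z‖ ε) ∂μ := by
  have hcont : ContinuousOn (fun z => Real.log (max ‖D z‖ ε)) {z | g z ≤ 1} := by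
    apply ContinuousOn.log (hD.1.norm.sup continuousOn_const)
    intro z _; positivity
  have huc := Metric.uniformContinuousOn_iff.1 (h.isCompact.uniformContinuousOn_of_continuous hcont)
  obtain ⟨R0, hR0⟩ := h.isCompact.isBounded.exists_norm_le
  have h01 : g 0 < 1 := by rw [h.zero]; norm_num
  have key : ∀ η > 0, Real.log ‖D 0‖ - η ≤ ∫ z : Bd g, Real.log (max ‖D z‖ ε) ∂μ := by
    intro η hη
    obtain ⟨δ, hδ, H⟩ := huc η hη
    set R1 := |R0| + 1 with hR1
    have hR1p : 0 < R1 := by positivity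
    set r₀ := max (1/2) (1 - δ / R1) with hr0
    have hr01 : r₀ < 1 := max_lt (by norm_num) (by linarith [div_pos hδ hR1p])
    obtain ⟨ρ, hρ1, hρ2⟩ := exists_between hr01
    have hfin : ({z | g z ≤ ρ} ∩ {z | D z = 0}).Finite := by
      apply zeros_finite h.isOpen h.preconn hD.2 h01 hD0
      · exact h.isCompact.of_isClosed_subset (isClosed_le h.cont continuous_const)
          (fun z hz => le_trans hz hρ2.le)
      · intro z hz; exact lt_of_le_of_lt hz hρ2
    obtain ⟨r, ⟨hr1, hr2⟩, hr3⟩ := ((Ioo_infinite hρ1).sdiff (hfin.image g)).nonempty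
    have hrh : 1/2 < r := (le_max_left _ _).trans_lt hr1
    have hrδ : 1 - δ / R1 < r := (le_max_right _ _).trans_lt hr1
    have hrp : 0 < r := by linarith
    set F : ℂ → ℂ := fun z => D (r * z) with hF
    have hRR : 1 < ρ / r := (one_lt_div hrp).2 hr2
    have hgr : ∀ z, g z < ρ / r → g (r * z) < ρ := by
      intro z hz; rw [h.hom _ hrp.le]; rwa [lt_div_iff₀' hrp] at hz
    have hFd : DifferentiableOn ℂ F {z | g z < ρ / r} := by
      apply hD.2.comp (by fun_prop)
      intro z hz; exact (hgr z hz).trans hρ2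
    have hFfin : {z | g z < ρ / r ∧ F z = 0}.Finite := by
      have hinj : Function.Injective (fun z : ℂ => (r:ℂ) * z) :=
        mul_right_injective₀ (by exact_mod_cast hrp.ne')
      apply (hfin.preimage hinj.injOn).subset
      rintro z ⟨h1, h2⟩
      exact ⟨(hgr z h1).le, h2⟩
    have hbd : ∀ z, g z = 1 → F z ≠ 0 := by
      intro z hz e
      apply hr3
      refine ⟨r * z, ⟨?_, e⟩, by rw [h.hom _ hrp.le, hz, mul_one]⟩
      change g _ ≤ ρ
      rw [h.hom _ hrp.le, hz, mul_one]; exact hr2.le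
    have := h.J3b hμ hRR _ hFd (by simpa [hF] using hD0) hFfin rfl hbd
    have hF0 : F 0 = D 0 := by simp [hF]
    rw [hF0] at this
    have hle : ∫ z : Bd g, Real.log ‖F z‖ ∂μ ≤ ∫ z : Bd g, (Real.log (max ‖D z‖ ε) + η) ∂μ := by
      apply integral_mono
      · apply h.integrable_of_cont
        apply Continuous.log
        · apply Continuous.norm
          exact hFd.continuousOn.comp_continuous continuous_subtype_val
            (fun z => (z.2 : g z = 1).trans_lt hRR)
        · intro z; exact norm_ne_zero_iff.2 (hbd z z.2)
      · apply h.integrable_of_cont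
        refine Continuous.add ?_ continuous_const
        exact hcont.comp_continuous continuous_subtype_val (fun z => le_of_eq z.2)
      · intro z
        have hz : g z = 1 := z.2
        have hz' : g (r * z) ≤ 1 := by rw [h.hom _ hrp.le, hz]; linarith
        have h1 := H (r * z) hz' z hz.le (by
          rw [dist_eq_norm]
          have e : (r:ℂ) * z - z = ((r - 1 : ℝ) : ℂ) * z := by push_cast; ring
          rw [e, norm_mul, Complex.norm_real, Real.norm_eq_abs, abs_of_neg (by linarith)]
          have : ‖(z:ℂ)‖ ≤ R1 := (hR0 z hz.le).trans (by rw [hR1]; linarith [le_abs_self R0])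
          calc -(r - 1) * ‖(z:ℂ)‖ ≤ -(r - 1) * R1 := by gcongr; linarith
            _ < δ / R1 * R1 := by gcongr; linarith
            _ = δ := by field_simp)
        rw [Real.dist_eq] at h1
        have h2 := (abs_lt.1 h1).2
        have h3 : Real.log ‖F z‖ ≤ Real.log (max ‖F z‖ ε) :=
          Real.log_le_log (norm_pos_iff.2 (hbd z hz)) (le_max_left _ _)
        change Real.log (max ‖F z‖ ε) - _ < η at h2
        change Real.log ‖F z‖ ≤ _
        linarith
    rw [integral_add ?_ (integrable_const _), integral_const, h.mass hμ, one_smul] at hle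
    · linarith
    · apply h.integrable_of_cont
      exact hcont.comp_continuous continuous_subtype_val (fun z => le_of_eq z.2)
  apply le_of_forall_pos_sub_le
  intro η hη
  exact key η hη

end StarG
end SA
end
end

section
open Set Topology MeasureTheory Filter
noncomputable section
namespace SA
namespace StarG
variable {g : ℂ → ℝ} {κ : ℝ}

theorem lemP0 (h : StarG g κ) {D : ℂ → ℂ} (hD : AS g D) (hb : ∀ z, g z ≤ 1 → ‖D z‖ ≤ 1) {Z : Set ℝ} (hZm : MeasurableSet Z)
    (hZ : Z ⊆ Ioc 0 (2 * Real.pi)) (hbig : √(1 + κ ^ 2) * (2 * Real.pi - volume.real Z) < 2 * Real.pi)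
    (hDZ : ∀ θ ∈ Z, D (bt g θ) = 0) : D 0 = 0 := by
  by_contra hD0
  obtain ⟨c, hc, hP2⟩ := h.P2 hZm hZ hbig
  have key : ∀ M : ℝ, 0 < M → Real.log ‖D 0‖ ≤ -(M * c) := by
    intro M hM
    have hcont : Continuous fun z : Bd g => -Real.log (max ‖D z‖ (Real.exp (-M))) / M := by
      have := as_cont_bd hD
      refine Continuous.div_const (Continuous.neg (Continuous.log (this.norm.max continuous_const) ?_)) _
      intro z; positivity
    obtain ⟨μ, hfin, hrep, hle⟩ := h.star_rep ⟨_, hcont⟩ c (by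
      intro p hp hχ
      apply hP2 p hp
      · intro z hz
        refine le_trans ?_ (hχ ⟨z, hz⟩)
        simp only [ContinuousMap.coe_mk]
        apply div_nonneg _ hM.le
        rw [neg_nonneg]
        apply Real.log_nonpos (by positivity)
        exact max_le (hb z hz.le) (Real.exp_le_one_iff.2 (by linarith))
      · intro θ hθ
        refine le_trans ?_ (hχ ⟨bt g θ, h.g_bt θ⟩)
        simp only [ContinuousMap.coe_mk]
        rw [hDZ θ hθ, norm_zero, max_eq_right (Real.exp_pos _).le, Real.log_exp, neg_neg, div_self hM.ne'])
    have hJ := h.J3 hrep hD hD0 (Real.exp_pos (-M))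
    simp only [ContinuousMap.coe_mk] at hle
    rw [integral_div, integral_neg, le_div_iff₀ hM] at hle
    linarith
  have h1 := key ((|Real.log ‖D 0‖| + 1) / c) (by positivity)
  rw [div_mul_cancel₀ _ hc.ne'] at h1
  linarith [neg_abs_le (Real.log ‖D 0‖)]

theorem lemP (h : StarG g κ) {D : ℂ → ℂ} (hD : AS g D) {Z : Set ℝ} (hZm : MeasurableSet Z)
    (hZ : Z ⊆ Ioc 0 (2 * Real.pi)) (hbig : √(1 + κ ^ 2) * (2 * Real.pi - volume.real Z) < 2 * Real.pi)
    (hDZ : ∀ θ ∈ Z, D (bt g θ) = 0) : ∀ z, g z < 1 → D z = 0 := by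
  by_contra! hcon
  obtain ⟨b, hb, hDb⟩ := hcon
  have h01 : g 0 < 1 := by rw [h.zero]; norm_num
  obtain ⟨n, G0, hG0, hG00, hDG⟩ := divide_zero h.isOpen h.preconn hD.2 hb hDb h01
  set G : ℂ → ℂ := fun z => if g z < 1 then G0 z else D z / z ^ n with hG
  have hG1 : ∀ z, g z < 1 → G z = G0 z := fun z hz => by simp [hG, hz]
  have hG2 : ∀ z, z ≠ 0 → G z = D z / z ^ n := by
    intro z hz
    by_cases hz1 : g z < 1
    · rw [hG1 z hz1, hDG z hz1, sub_zero]; field_simp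
    · simp [hG, hz1]
  have hGd : DifferentiableOn ℂ G {z | g z < 1} := hG0.congr hG1
  have hAS : AS g G := by
    refine ⟨fun z hz => ?_, hGd⟩
    by_cases hz1 : g z < 1
    · exact ((hGd z hz1).differentiableAt (h.isOpen.mem_nhds hz1)).continuousAt.continuousWithinAt
    · have hz0 : z ≠ 0 := by rintro rfl; exact hz1 h01
      have h1 : ContinuousWithinAt (fun z => D z / z ^ n) {z | g z ≤ 1} z :=
        (hD.1 z hz).div (by fun_prop) (pow_ne_zero _ hz0)
      apply h1.congr_of_eventuallyEq
      · filter_upwards [mem_nhdsWithin_of_mem_nhds (isOpen_ne.mem_nhds hz0)] with w hw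
        exact hG2 w hw
      · exact hG2 z hz0
  obtain ⟨B, hB⟩ := h.isCompact.exists_bound_of_continuousOn hAS.1
  have hB0 : 0 ≤ B := (norm_nonneg _).trans (hB 0 h01.le)
  have := h.lemP0 (D := fun z => ((B + 1 : ℝ) : ℂ)⁻¹ * G z) 
    ⟨continuousOn_const.mul hAS.1, hAS.2.const_mul _⟩ (by
      intro z hz
      rw [norm_mul, norm_inv, Complex.norm_real, Real.norm_of_nonneg (by linarith), inv_mul_le_iff₀ (by linarith)]
      linarith [hB z hz]) hZm hZ hbig (by
      intro θ hθ
      have := h.bd_ne (h.g_bt θ)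
      rw [hG2 _ this, hDZ θ hθ, zero_div, mul_zero])
  rw [hG1 0 h01, mul_eq_zero] at this
  rcases this with e | e
  · rw [inv_eq_zero] at e
    have : (B + 1 : ℝ) = 0 := by exact_mod_cast e
    linarith
  · exact hG00 e

end StarG
end SA
end
end

section
open Set Topology MeasureTheory Filter
noncomputable section
namespace SA
open InnerProductGeometry

theorem angle_exp_le (x y : ℝ) : angle (Complex.exp (x * Complex.I)) (Complex.exp (y * Complex.I)) ≤ |x - y| := by
  rcases lt_or_ge |x - y| Real.pi with hlt | hge
  · rw [Complex.angle_exp_exp, (toIocMod_eq_self Real.two_pi_pos).2]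
    rw [abs_lt] at hlt
    exact ⟨hlt.1, by linarith [hlt.2]⟩
  · exact (angle_le_pi _ _).trans hge

theorem norm_mul_angle_le {z w : ℂ} (hz : z ≠ 0) (hw : w ≠ 0) : ‖z‖ * angle z w ≤ Real.pi * ‖z - w‖ := by
  have hzn := norm_pos_iff.2 hz
  have hwn := norm_pos_iff.2 hw
  have h1 : angle z w = angle ((‖z‖⁻¹ : ℝ) • z) ((‖w‖⁻¹ : ℝ) • w) := by
    rw [angle_smul_left_of_pos _ _ (inv_pos.2 hzn), angle_smul_right_of_pos _ _ (inv_pos.2 hwn)]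
  have h2 := Complex.angle_le_mul_norm_sub (x := (‖z‖⁻¹ : ℝ) • z) (y := (‖w‖⁻¹ : ℝ) • w)
    (by rw [norm_smul, norm_inv, norm_norm, inv_mul_cancel₀ hzn.ne'])
    (by rw [norm_smul, norm_inv, norm_norm, inv_mul_cancel₀ hwn.ne'])
  rw [← h1] at h2
  have h3 : ‖z‖ * ‖(‖z‖⁻¹ : ℝ) • z - (‖w‖⁻¹ : ℝ) • w‖ ≤ 2 * ‖z - w‖ := by
    have e : ‖z‖ * ‖(‖z‖⁻¹ : ℝ) • z - (‖w‖⁻¹ : ℝ) • w‖ = ‖z - (‖z‖ * ‖w‖⁻¹) • w‖ := by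
      rw [← norm_norm z, ← norm_smul, norm_norm, smul_sub, smul_smul, smul_smul, mul_inv_cancel₀ hzn.ne', one_smul]
    rw [e]
    have e2 : z - (‖z‖ * ‖w‖⁻¹) • w = (z - w) + (1 - ‖z‖ * ‖w‖⁻¹) • w := by
      rw [sub_smul, one_smul]; abel
    rw [e2]
    have e3 : ‖(1 - ‖z‖ * ‖w‖⁻¹) • w‖ ≤ ‖z - w‖ := by
      rw [norm_smul, Real.norm_eq_abs]
      calc |1 - ‖z‖ * ‖w‖⁻¹| * ‖w‖ = |‖w‖ - ‖z‖| := by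
            rw [← abs_of_pos hwn, ← abs_mul, abs_of_pos hwn]; congr 1; field_simp
        _ ≤ ‖z - w‖ := by rw [norm_sub_rev]; exact abs_norm_sub_norm_le _ _
    linarith [norm_add_le (z - w) ((1 - ‖z‖ * ‖w‖⁻¹) • w)]
  calc ‖z‖ * angle z w ≤ ‖z‖ * (Real.pi / 2 * ‖(‖z‖⁻¹ : ℝ) • z - (‖w‖⁻¹ : ℝ) • w‖) := by gcongr
    _ = Real.pi / 2 * (‖z‖ * ‖(‖z‖⁻¹ : ℝ) • z - (‖w‖⁻¹ : ℝ) • w‖) := by ring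
    _ ≤ Real.pi / 2 * (2 * ‖z - w‖) := by gcongr
    _ = _ := by ring

def gF (κ : ℝ) (z v : ℂ) : ℝ := ‖z‖ / ‖v‖ * Real.exp (κ * angle z v)
def gV (κ : ℝ) (V : Set ℂ) (z : ℂ) : ℝ := sInf (gF κ z '' V)

section
variable {κ : ℝ} {V : Set ℂ}

theorem gV_spec (hV : IsCompact V) (hne : V.Nonempty) (h0 : (0:ℂ) ∉ V) (z : ℂ) : ∃ v ∈ V, gV κ V z = gF κ z v ∧ ∀ v' ∈ V, gV κ V z ≤ gF κ z v' := by
  have hc : ContinuousOn (gF κ z) V := by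
    by_cases hz : z = 0
    · subst hz
      unfold gF
      simp only [norm_zero, zero_div, zero_mul]
      exact continuousOn_const
    · intro v hv
      have hv0 : v ≠ 0 := fun e => h0 (e ▸ hv)
      have h1 : ContinuousAt (fun v => angle z v) v :=
        (continuousAt_angle (x := (z, v)) hz hv0).comp (f := fun v : ℂ => (z, v)) (by fun_prop)
      apply ContinuousAt.continuousWithinAt
      refine ContinuousAt.mul (continuousAt_const.div continuous_norm.continuousAt (norm_ne_zero_iff.2 hv0)) ?_
      exact Real.continuous_exp.continuousAt.comp (continuousAt_const.mul h1)
  obtain ⟨v, hv, hmin⟩ := hV.exists_isMinOn hne hc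
  have : gV κ V z = gF κ z v := by
    apply IsLeast.csInf_eq
    exact ⟨mem_image_of_mem _ hv, by rintro _ ⟨w, hw, rfl⟩; exact hmin hw⟩
  exact ⟨v, hv, this, fun v' hv' => this.trans_le (hmin hv')⟩

theorem gV_cmp (hκ : 0 ≤ κ) (hV : IsCompact V) (hne : V.Nonempty) (h0 : (0:ℂ) ∉ V) {z w : ℂ} (hw : w ≠ 0) :
    gV κ V z ≤ gV κ V w * (‖z‖ / ‖w‖) * Real.exp (κ * angle z w) := by
  obtain ⟨v, hv, e, -⟩ := gV_spec (κ := κ) hV hne h0 w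
  obtain ⟨-, -, -, hle⟩ := gV_spec (κ := κ) hV hne h0 z
  refine (hle v hv).trans ?_
  rw [e]
  unfold gF
  have hv0 : v ≠ 0 := fun e => h0 (e ▸ hv)
  have hvn := norm_pos_iff.2 hv0
  have hwn := norm_pos_iff.2 hw
  calc ‖z‖ / ‖v‖ * Real.exp (κ * angle z v) ≤ ‖z‖ / ‖v‖ * Real.exp (κ * (angle z w + angle w v)) := by
        gcongr; exact angle_le_angle_add_angle _ _ _
    _ = _ := by rw [mul_add, Real.exp_add]; field_simp

theorem gV_star (hκ : 0 ≤ κ) (hV : IsCompact V) (hne : V.Nonempty) (h0 : (0:ℂ) ∉ V) : StarG (gV κ V) κ := by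
  have hpos : ∀ z, z ≠ 0 → 0 < gV κ V z := by
    intro z hz
    obtain ⟨v, hv, e, -⟩ := gV_spec (κ := κ) hV hne h0 z
    rw [e]
    have hv0 : v ≠ 0 := fun e => h0 (e ▸ hv)
    unfold gF; positivity
  have hzero : gV κ V 0 = 0 := by
    obtain ⟨v, hv, e, -⟩ := gV_spec (κ := κ) hV hne h0 0
    rw [e]; simp [gF]
  refine ⟨hpos, ?_, ?_, ?_⟩
  · intro t ht z
    rcases ht.eq_or_lt with e | ht
    · subst e; simp [hzero]
    · have hF : ∀ v, gF κ (t * z) v = t * gF κ z v := by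
        intro v
        unfold gF
        have : angle ((t:ℂ) * z) v = angle z v := by
          rw [← Complex.real_smul]; exact angle_smul_left_of_pos _ _ ht
        rw [this, norm_mul, Complex.norm_real, Real.norm_of_nonneg ht.le]; ring
      obtain ⟨v, hv, e, hle⟩ := gV_spec (κ := κ) hV hne h0 z
      obtain ⟨v', hv', e', hle'⟩ := gV_spec (κ := κ) hV hne h0 (t * z)
      apply le_antisymm
      · rw [e, ← hF]; exact hle' v hv
      · rw [e', hF]; gcongr; exact hle v' hv'
  · obtain ⟨v₀, hv₀⟩ := hne
    have hv₀0 : v₀ ≠ 0 := fun e => h0 (e ▸ hv₀)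
    set c := Real.exp (κ * Real.pi) / ‖v₀‖ with hc
    have hcp : 0 < c := by positivity
    have hgc : ∀ z, gV κ V z ≤ c * ‖z‖ := by
      intro z
      obtain ⟨-, -, -, hle⟩ := gV_spec (κ := κ) hV ⟨v₀, hv₀⟩ h0 z
      refine (hle v₀ hv₀).trans ?_
      unfold gF
      calc ‖z‖ / ‖v₀‖ * Real.exp (κ * angle z v₀) ≤ ‖z‖ / ‖v₀‖ * Real.exp (κ * Real.pi) := by
            gcongr; exact angle_le_pi _ _
        _ = _ := by rw [hc]; ring
    set K := c * (1 + κ * Real.pi * Real.exp (κ * Real.pi)) with hK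
    have hKc : c ≤ K := by
      rw [hK]; apply le_mul_of_one_le_right hcp.le
      have := Real.pi_pos
      have : 0 ≤ κ * Real.pi * Real.exp (κ * Real.pi) := by positivity
      linarith
    have main : ∀ z w, gV κ V z - gV κ V w ≤ K * ‖z - w‖ := by
      intro z w
      by_cases hz : z = 0
      · subst hz
        rw [hzero]
        have : 0 ≤ gV κ V w := by
          by_cases hw : w = 0
          · rw [hw, hzero]
          · exact (hpos w hw).le
        have : 0 ≤ K * ‖0 - w‖ := by have := hcp.le.trans hKc; positivity
        linarith
      by_cases hw : w = 0
      · subst hw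
        rw [hzero, sub_zero, sub_zero]
        exact (hgc z).trans (by gcongr)
      have hwn := norm_pos_iff.2 hw
      have hzn := norm_pos_iff.2 hz
      have h1 := gV_cmp hκ hV ⟨v₀, hv₀⟩ h0 (z := z) hw
      set A := angle z w with hA
      have hA0 : 0 ≤ A := angle_nonneg _ _
      have hAp : A ≤ Real.pi := angle_le_pi _ _
      have h2 : Real.exp (κ * A) - 1 ≤ κ * A * Real.exp (κ * Real.pi) := by
        have e1 : 1 - κ * A ≤ Real.exp (-(κ * A)) := by linarith [Real.add_one_le_exp (-(κ * A))]
        have e2 : Real.exp (κ * A) * Real.exp (-(κ * A)) = 1 := by rw [← Real.exp_add]; simp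
        have e3 : Real.exp (κ * A) ≤ Real.exp (κ * Real.pi) := by gcongr
        have e4 : 0 ≤ κ * A := by positivity
        nlinarith [Real.exp_pos (κ * A), mul_le_mul_of_nonneg_left e1 (Real.exp_pos (κ * A)).le,
          mul_le_mul_of_nonneg_left e3 e4]
      have h3 : ‖z‖ * A ≤ Real.pi * ‖z - w‖ := norm_mul_angle_le hz hw
      have h4 : ‖z‖ - ‖w‖ ≤ ‖z - w‖ := norm_sub_norm_le _ _
      have h5 : gV κ V w / ‖w‖ ≤ c := by rw [div_le_iff₀ hwn]; exact hgc w
      have h6 : 0 ≤ gV κ V w / ‖w‖ := div_nonneg (hpos w hw).le hwn.le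
      have h7 : ‖z‖ * Real.exp (κ * A) - ‖w‖ ≤ ‖z - w‖ * (1 + κ * Real.pi * Real.exp (κ * Real.pi)) := by
        calc ‖z‖ * Real.exp (κ * A) - ‖w‖ = (‖z‖ - ‖w‖) + ‖z‖ * (Real.exp (κ * A) - 1) := by ring
          _ ≤ ‖z - w‖ + ‖z‖ * (κ * A * Real.exp (κ * Real.pi)) := by gcongr
          _ = ‖z - w‖ + κ * Real.exp (κ * Real.pi) * (‖z‖ * A) := by ring
          _ ≤ ‖z - w‖ + κ * Real.exp (κ * Real.pi) * (Real.pi * ‖z - w‖) := by gcongr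
          _ = _ := by ring
      have hpp : 0 ≤ ‖z - w‖ * (1 + κ * Real.pi * Real.exp (κ * Real.pi)) := by
        have := Real.pi_pos; positivity
      calc gV κ V z - gV κ V w ≤ gV κ V w * (‖z‖ / ‖w‖) * Real.exp (κ * A) - gV κ V w := by linarith
        _ = gV κ V w / ‖w‖ * (‖z‖ * Real.exp (κ * A) - ‖w‖) := by field_simp
        _ ≤ gV κ V w / ‖w‖ * (‖z - w‖ * (1 + κ * Real.pi * Real.exp (κ * Real.pi))) := by gcongr
        _ ≤ c * (‖z - w‖ * (1 + κ * Real.pi * Real.exp (κ * Real.pi))) := by gcongr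
        _ = _ := by rw [hK]; ring
    refine ⟨K, hcp.trans_le hKc, fun z w => abs_le.2 ⟨?_, main z w⟩⟩
    have := main w z
    rw [norm_sub_rev] at this
    linarith
  · have main : ∀ θ θ' : ℝ, Real.log (gV κ V (Complex.exp (θ * Complex.I))) -
        Real.log (gV κ V (Complex.exp (θ' * Complex.I))) ≤ κ * |θ - θ'| := by
      intro θ θ'
      have h1 := gV_cmp hκ hV hne h0 (z := Complex.exp (θ * Complex.I)) (Complex.exp_ne_zero (θ' * Complex.I))
      rw [Complex.norm_exp_ofReal_mul_I, Complex.norm_exp_ofReal_mul_I, div_one, mul_one] at h1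
      have p1 := hpos _ (Complex.exp_ne_zero (θ * Complex.I))
      have p2 := hpos _ (Complex.exp_ne_zero (θ' * Complex.I))
      have h2 := Real.log_le_log p1 h1
      rw [Real.log_mul p2.ne' (Real.exp_pos _).ne', Real.log_exp] at h2
      have := mul_le_mul_of_nonneg_left (angle_exp_le θ θ') hκ
      linarith
    intro θ θ'
    refine abs_le.2 ⟨?_, main θ θ'⟩
    have := main θ' θ
    rw [abs_sub_comm] at this
    linarith
end
end SA
end
end

section
open Set Topology MeasureTheory Filter
noncomputable section
namespace SA
open InnerProductGeometry

/-- lower cone with vertex q -/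
def Lc (κ R : ℝ) (q : ℂ) : Set ℂ := {w | ‖w - q‖ < R ∧ κ * ‖w - q‖ < (q - w).im}

theorem exp_sub_le {a b : ℂ} {M : ℝ} (ha : ‖Complex.exp a‖ ≤ M) (hb : ‖Complex.exp b‖ ≤ M) :
    ‖Complex.exp a - Complex.exp b‖ ≤ M * ‖a - b‖ := by
  have hM : 0 < M := lt_of_lt_of_le (norm_pos_iff.2 (Complex.exp_ne_zero a)) ha
  have hc : Convex ℝ {z : ℂ | z.re ≤ Real.log M} := convex_halfSpace_re_le _
  have key : ∀ z : ℂ, ‖Complex.exp z‖ ≤ M ↔ z ∈ {z : ℂ | z.re ≤ Real.log M} := by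
    intro z
    rw [Complex.norm_exp]
    exact (Real.le_log_iff_exp_le hM).symm
  exact hc.norm_image_sub_le_of_norm_hasDerivWithin_le (f := Complex.exp) (f' := Complex.exp)
    (fun x _ => (Complex.hasDerivAt_exp x).hasDerivWithinAt) (fun x hx => (key x).2 hx)
    ((key b).1 hb) ((key a).1 ha)

theorem cone_aux {κ r : ℝ} (hκ : 0 < κ) (hκ1 : κ ≤ 1/1000) (hr : 0 < r) {v z : ℂ}
    (h1 : |v.re| ≤ κ * r / 4) (h2 : |v.im - r| ≤ r / 100)
    (hz : gF (2 * κ) z v ≤ 1) (hne : z ≠ v) :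
    ‖z - v‖ < 3 * r ∧ κ * ‖z - v‖ < (v - z).im := by
  have hvi : 99/100 * r ≤ v.im := by linarith [(abs_le.1 h2).1]
  have hvi2 : v.im ≤ 101/100 * r := by linarith [(abs_le.1 h2).2]
  have hv0 : v ≠ 0 := by
    rintro rfl
    simp at hvi; linarith
  have hvn : ‖v‖ ≤ 102/100 * r := by
    refine (Complex.norm_le_abs_re_add_abs_im v).trans ?_
    rw [abs_of_pos (by linarith : 0 < v.im)]
    nlinarith
  have hvp : 0 < ‖v‖ := norm_pos_iff.2 hv0
  set ζ := z / v with hζ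
  have hzv : z = v * ζ := by rw [hζ]; field_simp
  have hζ1 : ζ.re + 2 * κ * |ζ.im| ≤ 1 ∧ ‖ζ‖ ≤ 1 := by
    by_cases hz0 : z = 0
    · simp [hζ, hz0]
    have : angle z v = |ζ.arg| := Complex.angle_eq_abs_arg hz0 hv0
    rw [gF, this, ← norm_div, ← hζ] at hz
    have e1 : 1 + 2 * κ * |ζ.arg| ≤ Real.exp (2 * κ * |ζ.arg|) := by
      linarith [Real.add_one_le_exp (2 * κ * |ζ.arg|)]
    have hab : 0 ≤ |ζ.arg| := abs_nonneg _
    have hn : 0 ≤ ‖ζ‖ := norm_nonneg _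
    have e2 : ‖ζ‖ * (1 + 2 * κ * |ζ.arg|) ≤ 1 := (mul_le_mul_of_nonneg_left e1 hn).trans hz
    have e3 : |ζ.im| ≤ ‖ζ‖ * |ζ.arg| := by
      have := Complex.norm_mul_sin_arg ζ
      rw [← this, abs_mul, abs_norm]
      exact mul_le_mul_of_nonneg_left Real.abs_sin_le_abs hn
    have e4 := Complex.re_le_norm ζ
    constructor
    · have : 2 * κ * |ζ.im| ≤ 2 * κ * (‖ζ‖ * |ζ.arg|) := by gcongr
      nlinarith
    · have : 0 ≤ ‖ζ‖ * (2 * κ * |ζ.arg|) := by positivity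
      nlinarith
  set u := 1 - ζ with hu
  have hvu : v - z = v * u := by rw [hu, hzv]; ring
  have hur : u.re = 1 - ζ.re := by simp [hu]
  have hui : |u.im| = |ζ.im| := by simp [hu]
  have hu1 : 2 * κ * |u.im| ≤ u.re := by rw [hur, hui]; linarith [hζ1.1]
  have hu0 : u ≠ 0 := by
    intro h0
    apply hne
    rw [h0, mul_zero] at hvu
    exact (sub_eq_zero.1 hvu).symm
  have hup : 0 < u.re := by
    have h0 : 0 ≤ u.re := le_trans (by positivity) hu1
    rcases h0.lt_or_eq with h | h
    · exact h
    · exfalso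
      rw [← h] at hu1
      have : |u.im| ≤ 0 := by
        by_contra hc
        push Not at hc
        have : 0 < 2 * κ * |u.im| := by positivity
        linarith
      have : u.im = 0 := abs_eq_zero.1 (le_antisymm this (abs_nonneg _))
      exact hu0 (Complex.ext h.symm this)
  have hun : ‖u‖ ≤ u.re + |u.im| := by
    have := Complex.norm_le_abs_re_add_abs_im u
    rwa [abs_of_pos hup] at this
  have hnorm : ‖z - v‖ = ‖v‖ * ‖u‖ := by rw [norm_sub_rev, hvu, norm_mul]
  have hu2 : ‖u‖ ≤ 2 := by
    calc ‖u‖ ≤ ‖(1:ℂ)‖ + ‖ζ‖ := norm_sub_le _ _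
      _ ≤ 2 := by rw [norm_one]; linarith [hζ1.2]
  constructor
  · rw [hnorm]
    nlinarith [norm_nonneg u]
  · rw [hnorm, hvu, Complex.mul_im]
    have a1 : κ * (‖v‖ * ‖u‖) ≤ κ * ((102/100 * r) * (u.re + |u.im|)) := by gcongr
    have a2 : κ * ((102/100 * r) * (u.re + |u.im|)) ≤ (102/100 * r) * ((1/1000 + 1/2) * u.re) := by
      have : κ * (u.re + |u.im|) ≤ (1/1000 + 1/2) * u.re := by nlinarith
      calc κ * ((102/100 * r) * (u.re + |u.im|)) = (102/100 * r) * (κ * (u.re + |u.im|)) := by ring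
        _ ≤ _ := by gcongr
    have a3 : -(r / 8 * u.re) ≤ v.re * u.im := by
      have : |v.re * u.im| ≤ r / 8 * u.re := by
        rw [abs_mul]
        calc |v.re| * |u.im| ≤ κ * r / 4 * |u.im| := by gcongr
          _ = r / 8 * (2 * κ * |u.im|) := by ring
          _ ≤ _ := by gcongr
      linarith [neg_abs_le (v.re * u.im)]
    have a4 : 99/100 * r * u.re ≤ v.im * u.re := by gcongr
    have : 0 < r * u.re := by positivity
    nlinarith

theorem pair_aux {κ : ℝ} (hκ : 0 < κ) (hκ1 : κ ≤ 1/1000) {q q' w : ℂ}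
    (hp : |(q - q').im| ≤ κ / 2 * ‖q - q'‖) (hw : κ * ‖w - q'‖ < (q' - w).im) :
    ‖w - q'‖ ≤ 4 / κ * ‖w - q‖ := by
  have h1 : ‖q - q'‖ ≤ ‖w - q'‖ + ‖w - q‖ := by
    have : q - q' = (w - q') - (w - q) := by ring
    rw [this]; exact norm_sub_le _ _
  have h2 : (q' - w).im = -(q - q').im - (w - q).im := by simp
  have h3 := Complex.abs_im_le_norm (w - q)
  have h4 := neg_abs_le (q - q').im
  have h5 := neg_abs_le (w - q).im
  have h6 : κ / 2 * ‖q - q'‖ ≤ κ / 2 * (‖w - q'‖ + ‖w - q‖) := by gcongr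
  rw [div_mul_eq_mul_div, le_div_iff₀ hκ]
  nlinarith [norm_nonneg (w - q)]

theorem LcE {κ : ℝ} (hκ : 0 < κ) {R : ℝ} {E : Set ℂ}
    (hp : ∀ q ∈ E, ∀ q' ∈ E, |(q - q').im| ≤ κ / 2 * ‖q - q'‖) {q w : ℂ} (hq : q ∈ E)
    (hw : w ∈ Lc κ R q) : w ∉ E := by
  intro hwE
  have h1 := hp q hq w hwE
  have h2 := hw.2
  rw [norm_sub_rev] at h2
  have h3 := le_abs_self (q - w).im
  nlinarith [norm_nonneg (q - w)]

theorem lemQ1 {κ r R C : ℝ} (hκ : 0 < κ) (hκ1 : κ ≤ 1/1000) (hr : 0 < r) (hR : 3 * r < R) {E : Set ℂ}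
    (hE : IsCompact E) (hne : E.Nonempty)
    (hp : ∀ q ∈ E, ∀ q' ∈ E, |(q - q').im| ≤ κ / 2 * ‖q - q'‖) {z0 : ℂ}
    (h1 : ∀ q ∈ E, |(q - z0).re| ≤ κ * r / 4) (h2 : ∀ q ∈ E, |(q - z0).im - r| ≤ r / 100)
    (hvol : ENNReal.ofReal (κ * r / 4) ≤ volume (Complex.re '' E))
    {D : ℂ → ℂ} (hD : ∀ q ∈ E, ∀ w ∈ Lc κ R q, DifferentiableAt ℂ D w)
    (hDb : ∀ q ∈ E, ∀ w ∈ Lc κ R q, ‖D w‖ ≤ C * √‖w - q‖) :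
    ∀ᶠ w in 𝓝 z0, D w = 0 := by
  classical
  set V : Set ℂ := (fun q => q - z0) '' E with hV
  have hVc : IsCompact V := hE.image (by fun_prop)
  have hVne : V.Nonempty := hne.image _
  have hV0 : (0:ℂ) ∉ V := by
    rintro ⟨q, hq, hq0⟩
    have := h2 q hq
    simp only at hq0
    rw [hq0] at this
    simp [abs_of_pos hr] at this
    linarith
  set g := gV (2 * κ) V with hg
  have hS : StarG g (2 * κ) := gV_star (by positivity) hVc hVne hV0
  have spec : ∀ z, ∃ q ∈ E, g z = gF (2 * κ) z (q - z0) := by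
    intro z
    obtain ⟨v, ⟨q, hq, rfl⟩, hv, -⟩ := gV_spec (κ := 2 * κ) hVc hVne hV0 z
    exact ⟨q, hq, hv⟩
  have gle : ∀ q ∈ E, ∀ z, g z ≤ gF (2 * κ) z (q - z0) := by
    intro q hq z
    obtain ⟨v, -, -, hv⟩ := gV_spec (κ := 2 * κ) hVc hVne hV0 z
    exact hv _ ⟨q, hq, rfl⟩
  have claimA : ∀ q ∈ E, ∀ z, gF (2 * κ) z (q - z0) ≤ 1 → z ≠ q - z0 → z0 + z ∈ Lc κ R q := by
    intro q hq z hz hzq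
    obtain ⟨a, b⟩ := cone_aux hκ hκ1 hr (h1 q hq) (h2 q hq) hz hzq
    have e : z0 + z - q = z - (q - z0) := by ring
    have e2 : q - (z0 + z) = (q - z0) - z := by ring
    refine ⟨?_, ?_⟩
    · rw [e]; linarith
    · rw [e, e2]; exact b
  have gFself : ∀ q ∈ E, gF (2 * κ) (q - z0) (q - z0) = 1 := by
    intro q hq
    have : q - z0 ≠ 0 := fun h => hV0 ⟨q, hq, h⟩
    rw [gF, angle_self this, div_self (norm_ne_zero_iff.2 this)]
    simp
  have claimB : ∀ q ∈ E, g (q - z0) = 1 := by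
    intro q hq
    refine le_antisymm ((gle q hq _).trans (gFself q hq).le) ?_
    by_contra hlt
    push Not at hlt
    obtain ⟨q', hq', he⟩ := spec (q - z0)
    rw [he] at hlt
    have hne' : q - z0 ≠ q' - z0 := by
      intro h
      rw [h, gFself q' hq'] at hlt
      exact lt_irrefl _ hlt
    have := claimA q' hq' _ hlt.le hne'
    rw [add_sub_cancel] at this
    exact LcE hκ hp hq' this hq
  have claimA' : ∀ z, g z ≤ 1 → z0 + z ∉ E → ∃ q ∈ E, z0 + z ∈ Lc κ R q := by
    intro z hz hzE
    obtain ⟨q, hq, he⟩ := spec z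
    refine ⟨q, hq, claimA q hq z (he ▸ hz) ?_⟩
    rintro rfl
    rw [add_sub_cancel] at hzE
    exact hzE hq
  have hltE : ∀ z, g z < 1 → z0 + z ∉ E := by
    intro z hz hzE
    have := claimB _ hzE
    rw [add_sub_cancel_left] at this
    linarith
  set D1 : ℂ → ℂ := fun z => if z0 + z ∈ E then 0 else D (z0 + z) with hD1
  have hev : ∀ z, z0 + z ∉ E → D1 =ᶠ[𝓝 z] fun z => D (z0 + z) := by
    intro z hz
    have : ∀ᶠ y in 𝓝 z, z0 + y ∈ Eᶜ :=
      (by fun_prop : Continuous fun y : ℂ => z0 + y).continuousAt.eventually (hE.isClosed.isOpen_compl.mem_nhds hz)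
    filter_upwards [this] with y hy
    simp only [hD1]
    rw [if_neg hy]
  have hdiff : ∀ z, g z ≤ 1 → z0 + z ∉ E → DifferentiableAt ℂ D1 z := by
    intro z hz hzE
    rw [(hev z hzE).differentiableAt_iff]
    obtain ⟨q, hq, hm⟩ := claimA' z hz hzE
    exact (hD q hq _ hm).comp z (by fun_prop)
  have hAS : AS g D1 := by
    refine ⟨?_, fun z hz => (hdiff z (le_of_lt hz) (hltE z hz)).differentiableWithinAt⟩
    intro z hz
    by_cases hzE : z0 + z ∈ E
    · have hb : ∀ z', g z' ≤ 1 → ‖D1 z'‖ ≤ |C| * √(4 / κ * ‖z' - z‖) := by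
        intro z' hz'
        by_cases hzE' : z0 + z' ∈ E
        · simp only [hD1, if_pos hzE', norm_zero]; positivity
        · simp only [hD1, if_neg hzE']
          obtain ⟨q, hq, hm⟩ := claimA' z' hz' hzE'
          have := pair_aux hκ hκ1 (hp _ hzE _ hq) hm.2
          rw [add_sub_add_left_eq_sub] at this
          calc ‖D (z0 + z')‖ ≤ C * √‖z0 + z' - q‖ := hDb q hq _ hm
            _ ≤ |C| * √‖z0 + z' - q‖ := by gcongr; exact le_abs_self C
            _ ≤ _ := by gcongr
      have h0 : D1 z = 0 := by simp only [hD1, if_pos hzE]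
      rw [ContinuousWithinAt, h0]
      refine squeeze_zero_norm' (a := fun z' => |C| * √(4 / κ * ‖z' - z‖)) ?_ ?_
      · filter_upwards [self_mem_nhdsWithin] with z' hz' using hb z' hz'
      · have : Continuous fun z' : ℂ => |C| * √(4 / κ * ‖z' - z‖) := by fun_prop
        have := this.tendsto z
        simp only [sub_self, norm_zero, mul_zero, Real.sqrt_zero] at this
        exact this.mono_left nhdsWithin_le_nhds
    · exact (hdiff z hz hzE).continuousAt.continuousWithinAt
  set Z : Set ℝ := Ioc 0 (2 * Real.pi) ∩ {θ | z0 + bt g θ ∈ E} with hZ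
  have hZm : MeasurableSet Z := by
    refine measurableSet_Ioc.inter ?_
    have : Continuous fun θ => z0 + bt g θ := continuous_const.add hS.bt_cont
    exact (hE.isClosed.preimage this).measurableSet
  have hZlip : LipschitzOnWith (Real.toNNReal (2 * r)) (fun θ => (z0 + bt g θ).re) Z := by
    apply LipschitzOnWith.of_dist_le_mul
    have hb : ∀ θ ∈ Z, ‖bt g θ‖ ≤ 102/100 * r := by
      intro θ hθ
      have a1 := h1 _ hθ.2
      have a2 := h2 _ hθ.2
      rw [add_sub_cancel_left] at a1 a2
      refine (Complex.norm_le_abs_re_add_abs_im _).trans ?_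
      have : |(bt g θ).im| ≤ 101/100 * r := by
        rw [abs_le] at a2 ⊢
        constructor <;> linarith [a2.1, a2.2]
      nlinarith
    intro x hx y hy
    rw [Real.coe_toNNReal _ (by positivity), Real.dist_eq, Real.dist_eq, ← Complex.sub_re]
    refine (Complex.abs_re_le_norm _).trans ?_
    rw [add_sub_add_left_eq_sub]
    refine (exp_sub_le (hb x hx) (hb y hy)).trans ?_
    have hs : √(1 + (2 * κ) ^ 2) ≤ 11/10 := by
      rw [Real.sqrt_le_left (by norm_num)]
      nlinarith
    calc 102/100 * r * ‖cv g x - cv g y‖ ≤ 102/100 * r * (11/10 * |x - y|) := by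
          gcongr
          exact (hS.cv_lip x y).trans (by gcongr)
      _ ≤ _ := by nlinarith [abs_nonneg (x - y), mul_nonneg hr.le (abs_nonneg (x - y))]
  have hsub : Complex.re '' E ⊆ (fun θ => (z0 + bt g θ).re) '' Z := by
    rintro _ ⟨q, hq, rfl⟩
    have hb := hS.bt_of_eq_one (claimB q hq)
    have him : 0 < (q - z0).im := by linarith [(abs_le.1 (h2 q hq)).1]
    have hbq : z0 + bt g (q - z0).arg = q := by rw [← hb]; ring
    refine ⟨(q - z0).arg, ⟨⟨?_, ?_⟩, ?_⟩, ?_⟩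
    · rcases (Complex.arg_nonneg_iff.2 him.le).lt_or_eq with h | h
      · exact h
      · exact absurd (Complex.arg_eq_zero_iff.1 h.symm).2 him.ne'
    · linarith [Complex.arg_le_pi (q - z0), Real.pi_pos]
    · change z0 + bt g (q - z0).arg ∈ E
      rw [hbq]; exact hq
    · change (z0 + bt g (q - z0).arg).re = q.re
      rw [hbq]
  have hZvol : κ / 8 ≤ volume.real Z := by
    have a1 := hZlip.hausdorffMeasure_image_le (d := 1) (by norm_num)
    rw [hausdorffMeasure_real, ENNReal.rpow_one] at a1
    have a2 := (hvol.trans (measure_mono hsub)).trans a1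
    have hfin : volume Z ≠ ⊤ := ((measure_mono inter_subset_left).trans_lt measure_Ioc_lt_top).ne
    rw [← ENNReal.ofReal_toReal hfin] at a2
    change _ ≤ ENNReal.ofReal (2 * r) * _ at a2
    rw [← ENNReal.ofReal_mul (by positivity), ENNReal.ofReal_le_ofReal_iff (by positivity)] at a2
    change κ * r / 4 ≤ 2 * r * volume.real Z at a2
    by_contra hc
    push Not at hc
    have := mul_lt_mul_of_pos_left hc (by positivity : 0 < 2 * r)
    linarith
  have hbig : √(1 + (2 * κ) ^ 2) * (2 * Real.pi - volume.real Z) < 2 * Real.pi := by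
    have hs : √(1 + (2 * κ) ^ 2) ≤ 1 + 2 * κ ^ 2 := by
      rw [Real.sqrt_le_left (by positivity)]
      nlinarith [sq_nonneg (κ ^ 2)]
    have hle : volume.real Z ≤ 2 * Real.pi := by
      have := measureReal_mono (μ := volume) (inter_subset_left : Z ⊆ Ioc 0 (2 * Real.pi)) measure_Ioc_lt_top.ne
      rwa [Real.volume_real_Ioc_of_le (by positivity), sub_zero] at this
    calc √(1 + (2 * κ) ^ 2) * (2 * Real.pi - volume.real Z)
        ≤ (1 + 2 * κ ^ 2) * (2 * Real.pi - volume.real Z) := by gcongr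
      _ < 2 * Real.pi := by
        have := Real.pi_lt_d2
        nlinarith [sq_nonneg κ, mul_nonneg (sq_nonneg κ) (measureReal_nonneg (μ := volume) (s := Z))]
  have hDZ : ∀ θ ∈ Z, D1 (bt g θ) = 0 := by
    intro θ hθ
    exact if_pos hθ.2
  have hfin := hS.lemP hAS hZm inter_subset_left hbig hDZ
  have hopen : ∀ᶠ w in 𝓝 z0, g (w - z0) < 1 := by
    have hc : Continuous fun w => g (w - z0) := hS.cont.comp (by fun_prop)
    refine hc.continuousAt.eventually_lt continuousAt_const ?_
    rw [sub_self, hS.zero]; norm_num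
  filter_upwards [hopen] with w hw
  have a := hfin _ hw
  have b := hltE _ hw
  simp only [hD1] at a
  rw [if_neg b, add_sub_cancel] at a
  exact a

theorem Lc_convex {κ R : ℝ} (hκ : 0 ≤ κ) (q : ℂ) : Convex ℝ (Lc κ R q) := by
  have e : Lc κ R q = Metric.ball q R ∩ {w | κ * ‖w - q‖ + w.im < q.im} := by
    ext w
    simp only [Lc, mem_inter_iff, Metric.mem_ball, dist_eq_norm, Complex.sub_im]
    exact and_congr Iff.rfl (by constructor <;> (intro h; simp only [mem_ofPred_eq] at *; linarith))
  rw [e]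
  refine (convex_ball _ _).inter ?_
  have : ConvexOn ℝ univ (fun w : ℂ => κ * ‖w - q‖ + w.im) := by
    refine ConvexOn.add ?_ ?_
    · refine ConvexOn.smul hκ ?_
      have := (convexOn_norm (convex_univ (𝕜 := ℝ) (E := ℂ))).translate_left (-q)
      simpa [Function.comp_def, sub_eq_add_neg] using this
    · exact Complex.imLm.convexOn convex_univ
  simpa using this.convex_lt q.im

theorem Lc_open {κ R : ℝ} (q : ℂ) : IsOpen (Lc κ R q) := by
  have h1 : Continuous fun w : ℂ => ‖w - q‖ := by fun_prop
  have h2 : Continuous fun w : ℂ => (q - w).im := Complex.continuous_im.comp (by fun_prop)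
  exact IsOpen.inter (isOpen_lt h1 continuous_const) (isOpen_lt (continuous_const.mul h1) h2)

theorem lemQ {κ R C : ℝ} (hκ : 0 < κ) (hκ1 : κ ≤ 1/1000) (hR : 0 < R) {E : Set ℂ}
    (hE : IsCompact E)
    (hp : ∀ q ∈ E, ∀ q' ∈ E, |(q - q').im| ≤ κ / 2 * ‖q - q'‖)
    (hvol : 0 < volume (Complex.re '' E))
    {D : ℂ → ℂ} (hD : ∀ q ∈ E, ∀ w ∈ Lc κ R q, DifferentiableAt ℂ D w)
    (hDb : ∀ q ∈ E, ∀ w ∈ Lc κ R q, ‖D w‖ ≤ C * √‖w - q‖) :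
    ∃ q ∈ E, ∀ w ∈ Lc κ R q, D w = 0 := by
  have hPc : IsCompact (Complex.re '' E) := hE.image Complex.continuous_re
  obtain ⟨x0, ⟨q0, hq0, rfl⟩, hx0⟩ : ∃ x0 ∈ Complex.re '' E, Tendsto
      (fun r : ℝ => volume (Complex.re '' E ∩ Metric.closedBall x0 r) / volume (Metric.closedBall x0 r)) (𝓝[>] 0) (𝓝 1) := by
    have h := IsUnifLocDoublingMeasure.ae_tendsto_measure_inter_div (volume : Measure ℝ) (Complex.re '' E) 1
    rw [ae_restrict_iff' hPc.measurableSet] at h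
    obtain ⟨x, hx, hh⟩ := Measure.exists_mem_of_measure_ne_zero_of_ae hvol.ne' (ae_restrict_of_ae h)
    refine ⟨x, hx, hh hx (fun _ => x) id tendsto_id ?_⟩
    filter_upwards [self_mem_nhdsWithin] with r hr
    have hr : (0:ℝ) < r := hr
    simp [hr.le]
  have hev : ∀ᶠ r : ℝ in 𝓝[>] 0, (1/2 : ENNReal) < volume (Complex.re '' E ∩ Metric.closedBall q0.re r) / volume (Metric.closedBall q0.re r) :=
    hx0.eventually_const_lt (by norm_num)
  have hev2 : ∀ᶠ r : ℝ in 𝓝[>] 0, r < κ * R / 16 := 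
    mem_nhdsWithin_of_mem_nhds (Iio_mem_nhds (by positivity))
  obtain ⟨ρ, ⟨hρ1, hρ2⟩, hρ0⟩ := ((hev.and hev2).and self_mem_nhdsWithin).exists
  have hρ0 : 0 < ρ := hρ0
  set r := 4 * ρ / κ with hr
  have hr0 : 0 < r := by positivity
  have hρr : ρ = κ * r / 4 := by rw [hr]; field_simp
  have hrR : 3 * r < R := by
    rw [hρr] at hρ2
    by_contra hc
    push Not at hc
    nlinarith
  set z0 : ℂ := q0 - r * Complex.I with hz0
  set E' := E ∩ {q | |q.re - q0.re| ≤ ρ} with hE'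
  have hE'c : IsCompact E' := hE.inter_right (isClosed_le (by
    exact (Complex.continuous_re.sub continuous_const).abs) continuous_const)
  have him : Complex.re '' E ∩ Metric.closedBall q0.re ρ = Complex.re '' E' := by
    ext x
    constructor
    · rintro ⟨⟨q, hq, rfl⟩, h⟩
      exact ⟨q, ⟨hq, by rwa [Metric.mem_closedBall, Real.dist_eq] at h⟩, rfl⟩
    · rintro ⟨q, ⟨hq, h⟩, rfl⟩
      exact ⟨⟨q, hq, rfl⟩, by rw [Metric.mem_closedBall, Real.dist_eq]; exact h⟩
  have hvol' : ENNReal.ofReal (κ * r / 4) ≤ volume (Complex.re '' E') := by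
    rw [← him, ← hρr]
    rw [Real.volume_closedBall] at hρ1
    have : 1/2 * ENNReal.ofReal (2 * ρ) ≤ volume (Complex.re '' E ∩ Metric.closedBall q0.re ρ) :=
      (ENNReal.le_div_iff_mul_le (Or.inl (by simpa using hρ0)) (Or.inl ENNReal.ofReal_ne_top)).1 hρ1.le
    refine le_trans (le_of_eq ?_) this
    rw [ENNReal.ofReal_mul (by norm_num), ← mul_assoc]
    simp [ENNReal.inv_mul_cancel]
  have hkey := lemQ1 hκ hκ1 hr0 hrR hE'c ⟨q0, hq0, by simp [hρ0.le]⟩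
    (fun q hq q' hq' => hp q hq.1 q' hq'.1) (z0 := z0) (D := D) (C := C)
    (fun q hq => by
      have : (q - z0).re = q.re - q0.re := by simp [hz0]
      rw [this, ← hρr]; exact hq.2)
    (fun q hq => by
      have : (q - z0).im - r = (q - q0).im := by simp [hz0]; ring
      rw [this]
      have a := hp q hq.1 q0 hq0
      have b := Complex.norm_le_abs_re_add_abs_im (q - q0)
      have c : |(q - q0).re| ≤ κ * r / 4 := by rw [← hρr]; simpa using hq.2
      have d := abs_nonneg (q - q0).im
      have : |(q - q0).im| ≤ κ / 2 * (κ * r / 4 + |(q - q0).im|) := a.trans (by gcongr; linarith)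
      nlinarith)
    hvol' (fun q hq => hD q hq.1) (fun q hq => hDb q hq.1)
  refine ⟨q0, hq0, ?_⟩
  have hz0m : z0 ∈ Lc κ R q0 := by
    have : ‖z0 - q0‖ = r := by simp [hz0, abs_of_pos hr0]
    refine ⟨by rw [this]; linarith, ?_⟩
    rw [this]; simp [hz0]; nlinarith
  have han : AnalyticOnNhd ℂ D (Lc κ R q0) := DifferentiableOn.analyticOnNhd
    (fun w hw => (hD q0 hq0 w hw).differentiableWithinAt) (Lc_open q0)
  exact fun w hw => han.eqOn_zero_of_preconnected_of_eventuallyEq_zero (Lc_convex hκ.le q0).isPreconnected hz0m hkey hw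

end SA
end
end

section
open Set Topology MeasureTheory Filter
noncomputable section
namespace SA

theorem exists_rows {a k : ℕ} {J : Type*} [Fintype J] (A : Matrix (Fin a) J ℂ) (h : k ≤ A.rank) :
    ∃ e : Fin k → Fin a, LinearIndependent ℂ (fun i => A (e i)) := by
  obtain ⟨κ, e, he, hs, hl⟩ := exists_linearIndependent' ℂ (fun i => A i)
  have : Finite κ := Finite.of_injective e he
  have := Fintype.ofFinite κ
  have hc : A.rank = Fintype.card κ := by
    rw [Matrix.rank_eq_finrank_span_row, ← finrank_span_eq_card hl, hs]
    rfl
  rw [hc] at h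
  obtain ⟨φ⟩ : Nonempty (Fin k ↪ κ) := Function.Embedding.nonempty_of_card_le (by simpa using h)
  exact ⟨e ∘ φ, hl.comp φ φ.injective⟩

theorem exists_minor {a b k : ℕ} (A : Matrix (Fin a) (Fin b) ℂ) (h : k ≤ A.rank) :
    ∃ (e : Fin k → Fin a) (e' : Fin k → Fin b), (A.submatrix e e').det ≠ 0 := by
  obtain ⟨e, he⟩ := exists_rows A h
  have h1 : (A.submatrix e id).rank = k := by
    have := LinearIndependent.rank_matrix (M := A.submatrix e id) he
    simpa using this
  have h2 : k ≤ (A.submatrix e id).transpose.rank := by rw [Matrix.rank_transpose, h1]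
  obtain ⟨e', he'⟩ := exists_rows _ h2
  refine ⟨e, e', ?_⟩
  have := Matrix.linearIndependent_rows_iff_isUnit (A := (A.submatrix e e').transpose)
  have h3 : IsUnit (A.submatrix e e').transpose := this.1 he'
  rw [Matrix.isUnit_iff_isUnit_det, Matrix.det_transpose] at h3
  exact h3.ne_zero

theorem det_eq_zero_of_rank {n : ℕ} (A : Matrix (Fin n) (Fin n) ℂ) (h : A.rank < n) : A.det = 0 := by
  by_contra hc
  have := Matrix.rank_of_det_ne_zero hc
  simp at this
  omega

theorem rank_add_le' {n : ℕ} (A B : Matrix (Fin n) (Fin n) ℂ) : (A + B).rank ≤ A.rank + B.rank := by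
  unfold Matrix.rank
  rw [Matrix.mulVecLin_add]
  refine (Submodule.finrank_mono (LinearMap.range_add_le _ _)).trans ?_
  exact Submodule.finrank_add_le_finrank_add_finrank _ _

theorem det_sub_le (n : ℕ) : ∃ C : ℝ, 0 < C ∧ ∀ (A B : Matrix (Fin n) (Fin n) ℂ) (a ε : ℝ),
    (∀ i j, ‖A i j‖ ≤ a) → (∀ i j, ‖B i j‖ ≤ a) → (∀ i j, ‖A i j - B i j‖ ≤ ε) → 0 ≤ ε → 0 ≤ a →
    ‖A.det - B.det‖ ≤ C * a ^ (n - 1) * ε := by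
  obtain ⟨C, hC, hb⟩ := MultilinearMap.exists_bound_of_continuous 
    (Matrix.detRowAlternating (n := Fin n) (R := ℂ)).toMultilinearMap (by
      change Continuous fun M : Fin n → Fin n → ℂ => Matrix.det M
      exact Continuous.matrix_det continuous_id)
  refine ⟨C * n + 1, by positivity, ?_⟩
  intro A0 B0 a ε hA hB hAB hε ha
  let A : Fin n → Fin n → ℂ := A0
  let B : Fin n → Fin n → ℂ := B0
  have := MultilinearMap.norm_image_sub_le_of_bound _ hC.le hb A B
  have n1 : ‖A‖ ≤ a := (pi_norm_le_iff_of_nonneg ha).2 fun i => (pi_norm_le_iff_of_nonneg ha).2 (hA i)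
  have n2 : ‖B‖ ≤ a := (pi_norm_le_iff_of_nonneg ha).2 fun i => (pi_norm_le_iff_of_nonneg ha).2 (hB i)
  have n3 : ‖A - B‖ ≤ ε := (pi_norm_le_iff_of_nonneg hε).2 fun i => (pi_norm_le_iff_of_nonneg hε).2 (hAB i)
  refine (this.trans ?_ : ‖A0.det - B0.det‖ ≤ _)
  rw [Fintype.card_fin]
  calc _ ≤ C * n * a ^ (n - 1) * ε := by gcongr; exact max_le n1 n2
    _ ≤ (C * n + 1) * a ^ (n - 1) * ε := by gcongr; linarith

end SA
end
end

section
open Set Topology MeasureTheory Filter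
noncomputable section
namespace SA
set_option linter.unusedSectionVars false

variable {X : Type*} [MetricSpace X] [CompactSpace X] [MeasurableSpace X] [BorelSpace X]

/-- annihilating functions -/
def Un (ν : Measure X) (A : Subalgebra ℂ C(X, ℂ)) : Set (X → ℂ) :=
  {u | Integrable u ν ∧ ∀ p ∈ A, ∫ x, p x * u x ∂ν = 0}

def KK (ν : Measure X) (f p : C(X, ℂ)) (u : X → ℂ) (w : ℂ) : ℂ := ∫ x, p x * u x / (f x - w) ∂ν

theorem lower_bd (f : C(X, ℂ)) {w : ℂ} (hw : w ∉ range f) : ∃ d > 0, ∀ w' ∈ Metric.ball w d, ∀ x, d ≤ ‖f x - w'‖ := by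
  have hc : IsClosed (range f) := (isCompact_range f.continuous).isClosed
  obtain ⟨ε, hε, hb⟩ := Metric.isOpen_iff.1 hc.isOpen_compl w hw
  refine ⟨ε / 2, by positivity, fun w' hw' x => ?_⟩
  by_contra hlt
  push Not at hlt
  refine hb (?_ : f x ∈ _) ⟨x, rfl⟩
  rw [Metric.mem_ball, dist_eq_norm] at *
  calc ‖f x - w‖ = ‖(f x - w') + (w' - w)‖ := by ring_nf
    _ ≤ _ := norm_add_le _ _
    _ < ε := by linarith

theorem KK_integrable {ν : Measure X} (f p : C(X, ℂ)) {u : X → ℂ} (hu : Integrable u ν) {w : ℂ} (hw : w ∉ range f) :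
    Integrable (fun x => p x * u x / (f x - w)) ν := by
  have hne : ∀ x, f x - w ≠ 0 := fun x h => hw ⟨x, sub_eq_zero.1 h⟩
  let φ : C(X, ℂ) := ⟨fun x => p x / (f x - w), p.continuous.div (by fun_prop) hne⟩
  have : (fun x => p x * u x / (f x - w)) = fun x => φ x * u x := by
    ext x; simp only [φ, ContinuousMap.coe_mk]; ring
  rw [this]
  exact hu.bdd_mul φ.continuous.aestronglyMeasurable (c := ‖φ‖) (Eventually.of_forall fun x => φ.norm_coe_le_norm x)

theorem KK_diff {ν : Measure X} (f p : C(X, ℂ)) {u : X → ℂ} (hu : Integrable u ν) {w : ℂ} (hw : w ∉ range f) :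
    DifferentiableAt ℂ (KK ν f p u) w := by
  obtain ⟨d, hd, hlb⟩ := lower_bd f hw
  have hball : ∀ w' ∈ Metric.ball w d, w' ∉ range f := by
    rintro _ hw' ⟨x, rfl⟩
    have := hlb _ hw' x
    simp at this; linarith
  have := (hasDerivAt_integral_of_dominated_loc_of_deriv_le (μ := ν) (F := fun w x => p x * u x / (f x - w))
    (F' := fun w x => p x * u x / (f x - w) ^ 2) (x₀ := w) (s := Metric.ball w d) 
    (bound := fun x => ‖p‖ * ‖u x‖ / d ^ 2) (Metric.ball_mem_nhds w hd) ?_ ?_ ?_ ?_ ?_ ?_).2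
  · exact this.differentiableAt
  · filter_upwards [Metric.ball_mem_nhds w hd] with w' hw'
    exact (KK_integrable f p hu (hball w' hw')).aestronglyMeasurable
  · exact KK_integrable f p hu hw
  · have hne : ∀ x, (f x - w) ^ 2 ≠ 0 := fun x h => hw ⟨x, sub_eq_zero.1 (pow_eq_zero_iff (two_ne_zero) |>.1 h)⟩
    have hc : Continuous fun x => p x / (f x - w) ^ 2 := p.continuous.div (by fun_prop) hne
    have : (fun x => p x * u x / (f x - w) ^ 2) = fun x => p x / (f x - w) ^ 2 * u x := by
      ext x; ring
    rw [this]
    exact hc.aestronglyMeasurable.mul hu.aestronglyMeasurable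
  · refine Eventually.of_forall fun x w' hw' => ?_
    rw [norm_div, norm_mul, norm_pow]
    have h1 := hlb w' hw' x
    have h2 := p.norm_coe_le_norm x
    gcongr
  · exact (hu.norm.const_mul ‖p‖).div_const _
  · refine Eventually.of_forall fun x w' hw' => ?_
    have hne : f x - w' ≠ 0 := fun h => hball w' hw' ⟨x, sub_eq_zero.1 h⟩
    have := ((hasDerivAt_const w' (p x * u x)).div ((hasDerivAt_id w').const_sub (f x)) hne)
    have e : (0 * (f x - id w') - p x * u x * -1) / (f x - id w') ^ 2 = p x * u x / (f x - w') ^ 2 := by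
      simp
    rw [e] at this
    exact this

theorem KK_far {ν : Measure X} [IsFiniteMeasure ν] {A : Subalgebra ℂ C(X, ℂ)} {f p : C(X, ℂ)} (hf : f ∈ A) (hp : p ∈ A)
    {u : X → ℂ} (hu : u ∈ Un ν A) {w : ℂ} (hw : ‖f‖ < ‖w‖) : KK ν f p u w = 0 := by
  have hwr : w ∉ range f := by
    rintro ⟨x, rfl⟩
    exact absurd (f.norm_coe_le_norm x) (not_le.2 hw)
  have hw0 : w ≠ 0 := norm_pos_iff.1 ((norm_nonneg f).trans_lt hw)
  have step : ∀ p ∈ A, KK ν f p u w = w⁻¹ * KK ν f (f * p) u w := by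
    intro p hp
    have h0 := hu.2 p hp
    have i1 := KK_integrable f (f * p) hu.1 hwr
    have i2 : Integrable (fun x => p x * u x) ν := hu.1.bdd_mul p.continuous.aestronglyMeasurable (c := ‖p‖) (Eventually.of_forall fun x => p.norm_coe_le_norm x)
    have : KK ν f (f * p) u w - ∫ x, p x * u x ∂ν = w * KK ν f p u w := by
      unfold KK
      rw [← integral_sub i1 i2, ← integral_const_mul]
      congr 1
      ext x
      have hne : f x - w ≠ 0 := fun h => hwr ⟨x, sub_eq_zero.1 h⟩
      simp only [ContinuousMap.mul_apply]
      field_simp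
      ring
    rw [h0, sub_zero] at this
    rw [this]; field_simp
  have iter : ∀ N : ℕ, KK ν f p u w = w⁻¹ ^ N * KK ν f (f ^ N * p) u w := by
    intro N
    induction N with
    | zero => simp
    | succ N ih =>
      rw [ih, step _ (A.mul_mem (A.pow_mem hf N) hp), pow_succ, pow_succ', mul_assoc, mul_assoc]
  obtain ⟨d, hd, hlb⟩ := lower_bd f hwr
  have hbd : ∀ N : ℕ, ‖KK ν f p u w‖ ≤ (‖f‖ / ‖w‖) ^ N * (‖p‖ / d * ∫ x, ‖u x‖ ∂ν) := by
    intro N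
    rw [iter N, norm_mul, norm_pow, norm_inv]
    have : ‖KK ν f (f ^ N * p) u w‖ ≤ ‖f‖ ^ N * (‖p‖ / d) * ∫ x, ‖u x‖ ∂ν := by
      unfold KK
      rw [← integral_const_mul]
      refine norm_integral_le_of_norm_le (hu.1.norm.const_mul _) (Eventually.of_forall fun x => ?_)
      rw [norm_div, norm_mul, ContinuousMap.mul_apply, norm_mul, ContinuousMap.pow_apply, norm_pow]
      have h1 := hlb w (Metric.mem_ball_self hd) x
      have h2 := p.norm_coe_le_norm x
      have h3 := f.norm_coe_le_norm x
      calc ‖f x‖ ^ N * ‖p x‖ * ‖u x‖ / ‖f x - w‖ ≤ ‖f‖ ^ N * ‖p‖ * ‖u x‖ / d := by gcongr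
        _ = _ := by ring
    calc _ ≤ ‖w‖⁻¹ ^ N * (‖f‖ ^ N * (‖p‖ / d) * ∫ x, ‖u x‖ ∂ν) := by gcongr
      _ = _ := by rw [div_pow, inv_pow]; ring
  have hlim : Tendsto (fun N : ℕ => (‖f‖ / ‖w‖) ^ N * (‖p‖ / d * ∫ x, ‖u x‖ ∂ν)) atTop (𝓝 (0 * (‖p‖ / d * ∫ x, ‖u x‖ ∂ν))) := by
    refine (tendsto_pow_atTop_nhds_zero_of_lt_one (by positivity) ?_).mul_const _
    rw [div_lt_one ((norm_nonneg f).trans_lt hw)]; exact hw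
  rw [zero_mul] at hlim
  exact norm_le_zero_iff.1 (ge_of_tendsto' hlim hbd)

/-- determinant of a tuple -/
def DD (ν : Measure X) (f : C(X, ℂ)) {n : ℕ} (p : Fin n → C(X, ℂ)) (u : Fin n → X → ℂ) (w : ℂ) : ℂ :=
  (Matrix.of fun i j => KK ν f (p i) (u j) w).det

def Zr (ν : Measure X) (A : Subalgebra ℂ C(X, ℂ)) (f : C(X, ℂ)) (m : ℕ) (w : ℂ) : Prop :=
  ∀ (p : Fin (m+1) → C(X, ℂ)) (u : Fin (m+1) → X → ℂ), (∀ i, p i ∈ A) → (∀ i, u i ∈ Un ν A) → DD ν f p u w = 0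

def Fi (ν : Measure X) (A : Subalgebra ℂ C(X, ℂ)) (f : C(X, ℂ)) (m : ℕ) : Set ℂ := {w | ∀ᶠ w' in 𝓝 w, Zr ν A f m w'}

def NF (ν : Measure X) (A : Subalgebra ℂ C(X, ℂ)) (f : C(X, ℂ)) : Set ℂ := {w | 0 < w.im ∧ w ∉ range f ∧ ∀ m, w ∉ Fi ν A f m}

variable {ν : Measure X} {A : Subalgebra ℂ C(X, ℂ)} {f : C(X, ℂ)}

theorem DD_diff {n : ℕ} {p : Fin n → C(X, ℂ)} {u : Fin n → X → ℂ} (hu : ∀ i, u i ∈ Un ν A) {w : ℂ} (hw : w ∉ range f) :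
    DifferentiableAt ℂ (DD ν f p u) w := by
  unfold DD
  simp only [Matrix.det_apply, Matrix.of_apply]
  refine DifferentiableAt.fun_sum fun σ _ => ?_
  refine DifferentiableAt.const_smul (DifferentiableAt.fun_finsetProd fun i _ => KK_diff f _ (hu _).1 hw) _

theorem Fi_conn {W : Set ℂ} (hWo : IsOpen W) (hWc : IsPreconnected W) (hW : ∀ w ∈ W, w ∉ range f) {m : ℕ} {w0 : ℂ}
    (h0 : w0 ∈ W) (hF : w0 ∈ Fi ν A f m) : W ⊆ Fi ν A f m := by
  have : ∀ w ∈ W, Zr ν A f m w := by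
    intro w hw p u hp hu
    have han : AnalyticOnNhd ℂ (DD ν f p u) W := DifferentiableOn.analyticOnNhd
      (fun w hw => (DD_diff hu (hW w hw)).differentiableWithinAt) hWo
    refine han.eqOn_zero_of_preconnected_of_eventuallyEq_zero hWc h0 ?_ hw
    filter_upwards [hF] with w' hw' using hw' p u hp hu
  intro w hw
  filter_upwards [hWo.mem_nhds hw] with w' hw' using this w' hw'

theorem isClosed_range_f : IsClosed (range f) := (isCompact_range f.continuous).isClosed

theorem NF_conn {W : Set ℂ} (hWo : IsOpen W) (hWc : IsPreconnected W) (hW : ∀ w ∈ W, w ∉ range f) (hWi : ∀ w ∈ W, 0 < w.im) {w0 : ℂ}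
    (h0 : w0 ∈ W) (hF : w0 ∈ NF ν A f) : W ⊆ NF ν A f := by
  intro w hw
  refine ⟨hWi w hw, hW w hw, fun m hm => hF.2.2 m (Fi_conn hWo hWc hW hw hm h0)⟩

theorem NF_open : IsOpen (NF ν A f) := by
  rw [isOpen_iff_mem_nhds]
  intro w hw
  have h1 : IsOpen ((range f)ᶜ ∩ {w : ℂ | 0 < w.im}) := isClosed_range_f.isOpen_compl.inter 
    (isOpen_lt continuous_const Complex.continuous_im)
  obtain ⟨ε, hε, hb⟩ := Metric.isOpen_iff.1 h1 w ⟨hw.2.1, hw.1⟩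
  exact mem_of_superset (Metric.ball_mem_nhds w hε) (NF_conn Metric.isOpen_ball (convex_ball w ε).isPreconnected 
    (fun w h => (hb h).1) (fun w h => (hb h).2) (Metric.mem_ball_self hε) hw)

theorem Fi_far [IsFiniteMeasure ν] (hf : f ∈ A) {w : ℂ} (hw : ‖f‖ < w.im) : w ∈ Fi ν A f 0 := by
  have ho : IsOpen {w : ℂ | ‖f‖ < w.im} := isOpen_lt continuous_const Complex.continuous_im
  filter_upwards [ho.mem_nhds hw] with w' hw'
  intro p u hp hu
  unfold DD
  rw [Matrix.det_fin_one, Matrix.of_apply]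
  exact KK_far hf (hp 0) (hu 0) (lt_of_lt_of_le hw' (Complex.im_le_norm w'))

/-- rank bound of any matrix where Zr holds -/
theorem Zr.rank {m : ℕ} {w : ℂ} (h : Zr ν A f m w) {n : ℕ} {p : Fin n → C(X, ℂ)} {u : Fin n → X → ℂ} (hp : ∀ i, p i ∈ A)
    (hu : ∀ i, u i ∈ Un ν A) : (Matrix.of fun i j => KK ν f (p i) (u j) w).rank ≤ m := by
  by_contra hc
  push Not at hc
  obtain ⟨e, e', hne⟩ := exists_minor _ hc
  exact hne (h (p ∘ e) (u ∘ e') (fun i => hp _) (fun i => hu _))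

end SA
end
end

section
open Set Topology MeasureTheory Filter
noncomputable section
namespace SA

theorem lip_null {ρ : ℝ → ℝ} {L : NNReal} (h : LipschitzWith L ρ) {N : Set ℝ} (hN : volume N = 0) : volume (ρ '' N) = 0 := by
  have := (h.lipschitzOnWith (s := N)).hausdorffMeasure_image_le (d := 1) (by norm_num)
  rw [hausdorffMeasure_real, hN, mul_zero] at this
  exact le_antisymm this bot_le

theorem reg_ae {c : ℝ → ℂ} {L : NNReal} (hc : LipschitzWith L c) :
    ∀ᵐ s : ℝ, ∀ t, (c t).re = s → DifferentiableAt ℝ c t ∧ (deriv c t).re ≠ 0 := by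
  have hρ : LipschitzWith L (fun t => (c t).re) := by
    apply LipschitzWith.of_dist_le_mul
    intro x y
    refine le_trans ?_ (hc.dist_le_mul x y)
    rw [Real.dist_eq, ← Complex.sub_re, dist_eq_norm]
    exact Complex.abs_re_le_norm _
  set N1 : Set ℝ := {t | ¬ DifferentiableAt ℝ c t}
  set N2 : Set ℝ := {t | DifferentiableAt ℝ c t ∧ (deriv c t).re = 0}
  have h1 : volume ((fun t => (c t).re) '' N1) = 0 := lip_null hρ hc.ae_differentiableAt
  have h2 : volume ((fun t => (c t).re) '' N2) = 0 := by
    refine addHaar_image_eq_zero_of_det_fderivWithin_eq_zero volume (f' := fun _ => 0) ?_ ?_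
    · intro t ht
      have : HasDerivAt (fun t => (c t).re) (deriv c t).re t :=
        Complex.reCLM.hasFDerivAt.comp_hasDerivAt t ht.1.hasDerivAt
      rw [ht.2] at this
      have h := this.hasFDerivAt
      have e : (ContinuousLinearMap.toSpanSingleton ℝ (0:ℝ) : ℝ →L[ℝ] ℝ) = 0 := by ext; simp
      rw [e] at h
      exact h.hasFDerivWithinAt
    · intro t ht
      simp [ContinuousLinearMap.det]
  have h3 : volume ((fun t => (c t).re) '' N1 ∪ (fun t => (c t).re) '' N2) = 0 := by
    rw [measure_union_null_iff]; exact ⟨h1, h2⟩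
  filter_upwards [compl_mem_ae_iff.2 h3] with s hs t ht
  by_contra hcon
  apply hs
  by_cases hd : DifferentiableAt ℝ c t
  · exact Or.inr ⟨t, ⟨hd, by_contra fun h => hcon ⟨hd, h⟩⟩, ht⟩
  · exact Or.inl ⟨t, hd, ht⟩

theorem par_ae (c : ℝ → ℂ) :
    ∀ᵐ s : ℝ, ∀ t t', (c t).re = s → c t = c t' → DifferentiableAt ℝ c t → DifferentiableAt ℝ c t' → 
      (deriv c t * star (deriv c t')).im = 0 := by
  set T : Set (ℝ × ℝ) := {a | c a.1 = c a.2 ∧ DifferentiableAt ℝ c a.1 ∧ DifferentiableAt ℝ c a.2 ∧ 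
      (deriv c a.1 * star (deriv c a.2)).im ≠ 0} with hT
  have hdisc : DiscreteTopology T := by
    rw [discreteTopology_subtype_iff]
    rintro ⟨t, t'⟩ ⟨h1, h2, h3, h4⟩
    simp only at h1 h2 h3 h4
    have hd : HasFDerivAt (fun a : ℝ × ℝ => c a.1 - c a.2) 
      ((ContinuousLinearMap.toSpanSingleton ℝ (deriv c t)).comp (ContinuousLinearMap.fst ℝ ℝ ℝ) - 
        (ContinuousLinearMap.toSpanSingleton ℝ (deriv c t')).comp (ContinuousLinearMap.snd ℝ ℝ ℝ)) (t, t') := by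
      refine HasFDerivAt.sub ?_ ?_
      · exact HasFDerivAt.comp (t, t') (f := Prod.fst) (g := c) h2.hasDerivAt.hasFDerivAt hasFDerivAt_fst
      · exact HasFDerivAt.comp (t, t') (f := Prod.snd) (g := c) h3.hasDerivAt.hasFDerivAt hasFDerivAt_snd
    have hinj : ∃ C, AntilipschitzWith C ((ContinuousLinearMap.toSpanSingleton ℝ (deriv c t)).comp (ContinuousLinearMap.fst ℝ ℝ ℝ) - 
        (ContinuousLinearMap.toSpanSingleton ℝ (deriv c t')).comp (ContinuousLinearMap.snd ℝ ℝ ℝ)) := by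
      have hker := LinearMap.exists_antilipschitzWith ((ContinuousLinearMap.toSpanSingleton ℝ (deriv c t)).comp (ContinuousLinearMap.fst ℝ ℝ ℝ) - 
        (ContinuousLinearMap.toSpanSingleton ℝ (deriv c t')).comp (ContinuousLinearMap.snd ℝ ℝ ℝ) : ℝ × ℝ →L[ℝ] ℂ).toLinearMap (by
          rw [LinearMap.ker_eq_bot']
          rintro ⟨a, b⟩ hab
          have hab : a * deriv c t - b * deriv c t' = 0 := by simpa using hab
          have e1 : (a * deriv c t - b * deriv c t') * star (deriv c t') = 0 := by rw [hab, zero_mul]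
          have e2 : (a * deriv c t - b * deriv c t') * star (deriv c t) = 0 := by rw [hab, zero_mul]
          have f1 := congrArg Complex.im e1
          have f2 := congrArg Complex.im e2
          simp [Complex.mul_im] at f1 f2 h4
          set x := (deriv c t).re
          set y := (deriv c t).im
          set x' := (deriv c t').re
          set y' := (deriv c t').im
          have g1 : a * (y * x' - x * y') = 0 := by linarith
          have g2 : b * (y * x' - x * y') = 0 := by linarith
          have hh : y * x' - x * y' ≠ 0 := by intro h; apply h4; linarith
          have ha : a = 0 := (mul_eq_zero.1 g1).resolve_right hh
          have hb : b = 0 := (mul_eq_zero.1 g2).resolve_right hh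
          rw [ha, hb]; rfl)
      obtain ⟨K, -, hK⟩ := hker
      exact ⟨K, hK⟩
    have hev := hd.eventually_ne (c := 0) hinj
    rw [← disjoint_iff, Filter.disjoint_principal_right]
    filter_upwards [hev] with a ha haT
    exact ha (sub_eq_zero.2 haT.1)
  have hcount : T.Countable := by
    have : Countable T := TopologicalSpace.separableSpace_iff_countable.1 inferInstance
    exact this
  have hnull : volume ((fun a : ℝ × ℝ => (c a.1).re) '' T) = 0 := (hcount.image _).measure_zero _
  filter_upwards [compl_mem_ae_iff.2 hnull] with s hs t t' hts htt h1 h2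
  by_contra hcon
  exact hs ⟨(t, t'), ⟨htt, h1, h2, hcon⟩, hts⟩

end SA
end
end

section
open Set Topology MeasureTheory Filter
noncomputable section
namespace SA
set_option linter.unusedSectionVars false

variable {X : Type*} [MetricSpace X] [CompactSpace X]

theorem deriv_lower {c : ℝ → ℂ} {t : ℝ} (hd : DifferentiableAt ℝ c t) {ε : ℝ} (hε : 0 < ε) :
    ∀ᶠ t' in 𝓝 t, ‖c t' - c t - (t' - t : ℝ) • deriv c t‖ ≤ ε * |t' - t| := by
  have := (hasDerivAt_iff_isLittleO.1 hd.hasDerivAt).def hε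
  simpa [Real.norm_eq_abs] using this

theorem deriv_lower2 {c : ℝ → ℂ} {t : ℝ} (hd : DifferentiableAt ℝ c t) (h0 : deriv c t ≠ 0) :
    ∀ᶠ t' in 𝓝 t, ‖deriv c t‖ / 2 * |t' - t| ≤ ‖c t' - c t‖ := by
  have hp : 0 < ‖deriv c t‖ := norm_pos_iff.2 h0
  filter_upwards [deriv_lower hd (half_pos hp)] with t' ht'
  have h1 : ‖(t' - t : ℝ) • deriv c t‖ = |t' - t| * ‖deriv c t‖ := by rw [norm_smul, Real.norm_eq_abs]
  have h2 := norm_sub_norm_le ((t' - t : ℝ) • deriv c t) ((t' - t : ℝ) • deriv c t - (c t' - c t))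
  rw [sub_sub_cancel, norm_sub_rev ((t' - t : ℝ) • deriv c t) (c t' - c t)] at h2
  nlinarith

theorem geo1 {f : C(X, ℂ)} {γ : ℝ → X} {Λ : NNReal} (hγ : LipschitzWith Λ γ)
    (hcov : ∀ x, 0 < (f x).im → ∃ t ∈ Icc (0:ℝ) 1, γ t = x) {q : ℂ} (hq : 0 < q.im)
    (hreg : ∀ t, f (γ t) = q → DifferentiableAt ℝ (fun t => f (γ t)) t ∧ deriv (fun t => f (γ t)) t ≠ 0) :
    ∃ (k : ℕ) (z : ℕ → X) (C : ℝ), 0 < C ∧ ∀ x, ∃ l < k, dist x (z l) ≤ C * ‖f x - q‖ := by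
  classical
  set c : ℝ → ℂ := fun t => f (γ t) with hc
  have hcc : Continuous c := f.continuous.comp hγ.continuous
  set d := Metric.diam (univ : Set X) with hd
  have hdd : ∀ x y : X, dist x y ≤ d := fun x y => Metric.dist_le_diam_of_mem isCompact_univ.isBounded trivial trivial
  have hd0 : 0 ≤ d := Metric.diam_nonneg
  have key : ∃ F : Finset X, ∃ C > 0, ∀ t' ∈ Icc (0:ℝ) 1, ∃ z ∈ F, dist (γ t') z ≤ C * ‖c t' - q‖ := by
    refine isCompact_Icc.induction_on (p := fun S => ∃ F : Finset X, ∃ C > 0, ∀ t' ∈ S, ∃ z ∈ F, dist (γ t') z ≤ C * ‖c t' - q‖) ?_ ?_ ?_ ?_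
    · exact ⟨∅, 1, one_pos, by simp⟩
    · rintro S T hST ⟨F, C, hC, h⟩
      exact ⟨F, C, hC, fun t ht => h t (hST ht)⟩
    · rintro S T ⟨F, C, hC, h⟩ ⟨F', C', hC', h'⟩
      refine ⟨F ∪ F', C + C', by positivity, ?_⟩
      rintro t (ht | ht)
      · obtain ⟨z, hz, hh⟩ := h t ht
        exact ⟨z, Finset.mem_union_left _ hz, hh.trans (by gcongr; linarith)⟩
      · obtain ⟨z, hz, hh⟩ := h' t ht
        exact ⟨z, Finset.mem_union_right _ hz, hh.trans (by gcongr; linarith)⟩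
    · intro t _
      by_cases htq : c t = q
      · obtain ⟨h1, h2⟩ := hreg t htq
        have hp : 0 < ‖deriv c t‖ := norm_pos_iff.2 h2
        refine ⟨_, mem_nhdsWithin_of_mem_nhds (deriv_lower2 h1 h2), {γ t}, 2 * Λ / ‖deriv c t‖ + 1, by positivity, ?_⟩
        intro t' ht'
        have ht' : ‖deriv c t‖ / 2 * |t' - t| ≤ ‖c t' - c t‖ := ht'
        refine ⟨γ t, by simp, (hγ.dist_le_mul t' t).trans ?_⟩
        rw [Real.dist_eq, ← htq]
        calc (Λ:ℝ) * |t' - t| = 2 * Λ / ‖deriv c t‖ * (‖deriv c t‖ / 2 * |t' - t|) := by field_simp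
          _ ≤ 2 * Λ / ‖deriv c t‖ * ‖c t' - c t‖ := by gcongr
          _ ≤ _ := by gcongr; linarith
      · have hp : 0 < ‖c t - q‖ := norm_pos_iff.2 (sub_ne_zero.2 htq)
        have : ∀ᶠ t' in 𝓝 t, ‖c t - q‖ / 2 < ‖c t' - q‖ := 
          continuousAt_const.eventually_lt (by fun_prop) (by linarith)
        refine ⟨_, mem_nhdsWithin_of_mem_nhds this, {γ t}, 2 * d / ‖c t - q‖ + 1, by positivity, ?_⟩
        intro t' ht'
        have ht' : ‖c t - q‖ / 2 < ‖c t' - q‖ := ht'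
        refine ⟨γ t, by simp, (hdd _ _).trans ?_⟩
        calc d = 2 * d / ‖c t - q‖ * (‖c t - q‖ / 2) := by field_simp
          _ ≤ (2 * d / ‖c t - q‖ + 1) * ‖c t' - q‖ := by gcongr; linarith
  obtain ⟨F, C, hC, hF⟩ := key
  let Z := F.toList ++ [γ 0]
  refine ⟨Z.length, fun l => Z.getD l (γ 0), C + d / q.im, by positivity, ?_⟩
  suffices ∀ x, ∃ z ∈ Z, dist x z ≤ (C + d / q.im) * ‖f x - q‖ by
    intro x
    obtain ⟨z, hz, h⟩ := this x
    obtain ⟨l, hl, rfl⟩ := List.getElem_of_mem hz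
    refine ⟨l, hl, ?_⟩
    change dist x (Z.getD l (γ 0)) ≤ _
    rw [List.getD_eq_getElem _ _ hl]
    exact h
  intro x
  by_cases hx : 0 < (f x).im
  · obtain ⟨t, ht, rfl⟩ := hcov x hx
    obtain ⟨z, hz, h⟩ := hF t ht
    refine ⟨z, by simp [Z, hz], h.trans ?_⟩
    have : 0 ≤ d / q.im := by positivity
    gcongr
    linarith
  · refine ⟨γ 0, by simp [Z], (hdd _ _).trans ?_⟩
    have h1 : q.im ≤ ‖f x - q‖ := by
      rw [norm_sub_rev]
      refine le_trans ?_ (Complex.im_le_norm _)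
      simp; linarith
    calc d = d / q.im * q.im := by field_simp
      _ ≤ (C + d / q.im) * ‖f x - q‖ := by gcongr; linarith

theorem geo2 {f : C(X, ℂ)} {γ : ℝ → X} (hγ : Continuous γ)
    (hcov : ∀ x, 0 < (f x).im → ∃ t ∈ Icc (0:ℝ) 1, γ t = x) {q τ : ℂ} (hq : 0 < q.im)
    (hreg : ∀ t, f (γ t) = q → DifferentiableAt ℝ (fun t => f (γ t)) t ∧ deriv (fun t => f (γ t)) t ≠ 0)
    (hpar : ∀ t, f (γ t) = q → (deriv (fun t => f (γ t)) t * star τ).im = 0) {η : ℝ} (hη : 0 < η) :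
    ∃ R > 0, ∀ x, ‖f x - q‖ < R → |((f x - q) * star τ).im| ≤ η * ‖f x - q‖ := by
  set c : ℝ → ℂ := fun t => f (γ t) with hc
  have hcc : Continuous c := f.continuous.comp hγ
  have key : ∃ R > 0, ∀ t' ∈ Icc (0:ℝ) 1, ‖c t' - q‖ < R → |((c t' - q) * star τ).im| ≤ η * ‖c t' - q‖ := by
    refine isCompact_Icc.induction_on (p := fun S => ∃ R > 0, ∀ t' ∈ S, ‖c t' - q‖ < R → |((c t' - q) * star τ).im| ≤ η * ‖c t' - q‖) ?_ ?_ ?_ ?_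
    · exact ⟨1, one_pos, by simp⟩
    · rintro S T hST ⟨R, hR, h⟩
      exact ⟨R, hR, fun t ht => h t (hST ht)⟩
    · rintro S T ⟨R, hR, h⟩ ⟨R', hR', h'⟩
      refine ⟨min R R', lt_min hR hR', ?_⟩
      rintro t (ht | ht) hlt
      · exact h t ht (hlt.trans_le (min_le_left _ _))
      · exact h' t ht (hlt.trans_le (min_le_right _ _))
    · intro t _
      by_cases htq : c t = q
      · obtain ⟨h1, h2⟩ := hreg t htq
        have hp : 0 < ‖deriv c t‖ := norm_pos_iff.2 h2
        set ε := η * (‖deriv c t‖ / 2) / (‖τ‖ + 1) with hε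
        have hε0 : 0 < ε := by positivity
        refine ⟨_, mem_nhdsWithin_of_mem_nhds ((deriv_lower2 h1 h2).and (deriv_lower h1 hε0)), 1, one_pos, ?_⟩
        rintro t' ⟨ha, hb⟩ -
        have ha : ‖deriv c t‖ / 2 * |t' - t| ≤ ‖c t' - c t‖ := ha
        have hb : ‖c t' - c t - (t' - t : ℝ) • deriv c t‖ ≤ ε * |t' - t| := hb
        rw [← htq]
        have e : ((c t' - c t) * star τ).im = ((c t' - c t - (t' - t : ℝ) • deriv c t) * star τ).im := by
          have : ((t' - t : ℝ) • deriv c t * star τ).im = (t' - t) * (deriv c t * star τ).im := by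
            rw [smul_mul_assoc, Complex.smul_im, smul_eq_mul]
          rw [sub_mul (c t' - c t) ((t'-t:ℝ) • deriv c t) (star τ), Complex.sub_im, this, hpar t htq, mul_zero, sub_zero]
        rw [e]
        refine (Complex.abs_im_le_norm _).trans ?_
        rw [norm_mul, norm_star]
        calc _ ≤ ε * |t' - t| * (‖τ‖ + 1) := by gcongr; linarith
          _ = η * (‖deriv c t‖ / 2 * |t' - t|) := by rw [hε]; field_simp
          _ ≤ _ := by gcongr
      · have hp : 0 < ‖c t - q‖ := norm_pos_iff.2 (sub_ne_zero.2 htq)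
        have : ∀ᶠ t' in 𝓝 t, ‖c t - q‖ / 2 < ‖c t' - q‖ := 
          continuousAt_const.eventually_lt (by fun_prop) (by linarith)
        refine ⟨_, mem_nhdsWithin_of_mem_nhds this, ‖c t - q‖ / 2, by positivity, ?_⟩
        intro t' ht' hlt
        have ht' : ‖c t - q‖ / 2 < ‖c t' - q‖ := ht'
        linarith
  obtain ⟨R, hR, h⟩ := key
  refine ⟨min R q.im, lt_min hR hq, fun x hx => ?_⟩
  have him : 0 < (f x).im := by
    have h1 : (q - f x).im ≤ ‖f x - q‖ := by rw [norm_sub_rev]; exact Complex.im_le_norm _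
    have h2 := hx.trans_le (min_le_right _ _)
    simp at h1
    linarith
  obtain ⟨t, ht, rfl⟩ := hcov x him
  exact h t ht (hx.trans_le (min_le_left _ _))

end SA
end
end

section
open Set Topology MeasureTheory Filter
noncomputable section
namespace SA
set_option linter.unusedSectionVars false

variable {X : Type*} [MetricSpace X] [CompactSpace X] [MeasurableSpace X] [BorelSpace X]
variable {ν : Measure X} {A : Subalgebra ℂ C(X, ℂ)} {f : C(X, ℂ)}

theorem exists_index {k : ℕ} {z : ℕ → X} {C2 : ℝ} {q : ℂ}
    (h : ∀ x, ∃ l < k, dist x (z l) ≤ C2 * ‖f x - q‖) :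
    ∃ l : X → Fin k, Measurable l ∧ ∀ x, dist x (z (l x)) ≤ C2 * ‖f x - q‖ := by
  classical
  have h' : ∀ x, ∃ l, dist x (z l) ≤ C2 * ‖f x - q‖ := fun x => let ⟨l, _, h⟩ := h x; ⟨l, h⟩
  have hlt : ∀ x, Nat.find (h' x) < k := fun x => by
    obtain ⟨l, hl, hx⟩ := h x
    exact (Nat.find_min' (h' x) hx).trans_lt hl
  refine ⟨fun x => ⟨Nat.find (h' x), hlt x⟩, ?_, fun x => Nat.find_spec (h' x)⟩
  have hm : Measurable fun x => Nat.find (h' x) := by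
    refine measurable_find h' fun l => ?_
    exact (isClosed_le (f := fun x => dist x (z l)) (g := fun x => C2 * ‖f x - q‖) (by fun_prop) (by fun_prop)).measurableSet
  refine measurable_to_countable' fun i => ?_
  have : (fun x => (⟨Nat.find (h' x), hlt x⟩ : Fin k)) ⁻¹' {i} = (fun x => Nat.find (h' x)) ⁻¹' {(i : ℕ)} := by
    ext x; simp [Fin.ext_iff]
  rw [this]
  exact hm (measurableSet_singleton _)

theorem decay {n m k : ℕ} (hn : m + k < n) {z : ℕ → X} {C1 C2 I P R a : ℝ} {q : ℂ} (hC1 : 0 ≤ C1) (hC2 : 0 ≤ C2) (hI : 0 ≤ I)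
    (hP : 0 ≤ P) (hR : 0 ≤ R)
    (hz : ∀ x, ∃ l < k, dist x (z l) ≤ C2 * ‖f x - q‖)
    {p : Fin n → C(X, ℂ)} {u : Fin n → X → ℂ} (hp : ∀ i, p i ∈ A) (hu : ∀ i, u i ∈ Un ν A)
    (hpP : ∀ i, ‖p i‖ ≤ P) (hpL : ∀ i x y, ‖p i x - p i y‖ ≤ P * dist x y)
    (hui : ∀ j, ∀ δ > 0, ∫ x, ‖u j x‖ / (δ + ‖f x - q‖) ∂ν ≤ δ ^ (-a) * I) :
    ∃ C > 0, ∀ w w' : ℂ, 0 < ‖w - q‖ → ‖w - q‖ ≤ R → ‖w' - q‖ = ‖w - q‖ → 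
      (∀ x, ‖w - q‖ + ‖f x - q‖ ≤ C1 * ‖f x - w‖) → (∀ x, ‖w - q‖ + ‖f x - q‖ ≤ C1 * ‖f x - w'‖) →
      Zr ν A f m w' → ‖DD ν f p u w‖ ≤ C * (‖w - q‖ ^ (-a)) ^ (n - 1) * (‖w - q‖ * ‖w - q‖ ^ (-a)) := by
  obtain ⟨Cd, hCd, hdet⟩ := det_sub_le n
  obtain ⟨l, hlm, hl⟩ := exists_index hz
  set Ce := 2 * P * C2 * C1 ^ 2 * I with hCe
  have hCe0 : 0 ≤ Ce := by positivity
  refine ⟨Cd * (P * C1 * I + Ce * R) ^ (n - 1) * Ce + 1, by positivity, ?_⟩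
  intro w w' hδ hδR hww hb hb' hZ
  set δ := ‖w - q‖ with hδd
  have hfw : ∀ {w : ℂ}, (∀ x, δ + ‖f x - q‖ ≤ C1 * ‖f x - w‖) → w ∉ range f := by
    rintro w h ⟨x, rfl⟩
    have := h x
    simp at this
    linarith [norm_nonneg (f x - q)]
  have hw := hfw hb
  have hw' := hfw hb'
  have hne : ∀ x, f x - w ≠ 0 := fun x h => hw ⟨x, sub_eq_zero.1 h⟩
  have hne' : ∀ x, f x - w' ≠ 0 := fun x h => hw' ⟨x, sub_eq_zero.1 h⟩
  have inv : ∀ {w : ℂ}, (∀ x, δ + ‖f x - q‖ ≤ C1 * ‖f x - w‖) → ∀ x, ‖f x - w‖⁻¹ ≤ C1 * (δ + ‖f x - q‖)⁻¹ := by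
    intro w h x
    have h0 : 0 < δ + ‖f x - q‖ := by positivity
    have h1 : 0 < ‖f x - w‖ := norm_pos_iff.2 fun h' => hfw h ⟨x, sub_eq_zero.1 h'⟩
    rw [← div_eq_mul_inv, inv_le_comm₀ h1 (by have := h x; apply div_pos _ h0; by_contra hc; push Not at hc; nlinarith), inv_div]
    have hC : 0 < C1 := by by_contra hc; push Not at hc; nlinarith [h x]
    rw [div_le_iff₀ hC]; linarith [h x]
  set φ : C(X, ℂ) := ⟨fun x => (w - w') / ((f x - w) * (f x - w')), 
    continuous_const.div (by fun_prop) (fun x => mul_ne_zero (hne x) (hne' x))⟩ with hφ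
  have hφb : ∀ x, ‖φ x‖ ≤ 2 * δ * C1 ^ 2 * (δ + ‖f x - q‖)⁻¹ ^ 2 := by
    intro x
    simp only [hφ, ContinuousMap.coe_mk]
    rw [norm_div, norm_mul, div_eq_mul_inv, mul_inv]
    have h1 := inv hb x
    have h2 := inv hb' x
    have h3 : ‖w - w'‖ ≤ 2 * δ := by
      have : w - w' = (w - q) - (w' - q) := by ring
      rw [this]; refine (norm_sub_le _ _).trans ?_; rw [hww]; linarith
    have h0 : 0 ≤ (δ + ‖f x - q‖)⁻¹ := by positivity
    calc _ ≤ (2 * δ) * ((C1 * (δ + ‖f x - q‖)⁻¹) * (C1 * (δ + ‖f x - q‖)⁻¹)) := by gcongr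
      _ = _ := by ring
  have hψ : ∀ j, Integrable (fun x => φ x * u j x) ν := fun j => (hu j).1.bdd_mul φ.continuous.aestronglyMeasurable (c := ‖φ‖) (Eventually.of_forall fun x => φ.norm_coe_le_norm x)
  have hs : ∀ i, Measurable fun x => p i (z (l x)) := fun i => (measurable_from_top (f := fun l : Fin k => p i (z l))).comp hlm
  have hsψ : ∀ i j, Integrable (fun x => p i (z (l x)) * (φ x * u j x)) ν := fun i j => 
    (hψ j).bdd_mul (hs i).aestronglyMeasurable (c := P) (Eventually.of_forall fun x => ((p i).norm_coe_le_norm _).trans (hpP i))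
  have hpψ : ∀ i j, Integrable (fun x => p i x * (φ x * u j x)) ν := fun i j => 
    (hψ j).bdd_mul (p i).continuous.aestronglyMeasurable (c := P) (Eventually.of_forall fun x => ((p i).norm_coe_le_norm _).trans (hpP i))
  have hdd : ∀ j, Integrable (fun x => ‖u j x‖ / (δ + ‖f x - q‖)) ν := by
    intro j
    have hc : Continuous fun x => (δ + ‖f x - q‖)⁻¹ := by
      refine Continuous.inv₀ (by fun_prop) fun x => ?_
      positivity
    have : (fun x => ‖u j x‖ / (δ + ‖f x - q‖)) = fun x => (δ + ‖f x - q‖)⁻¹ * ‖u j x‖ := by ext x; ring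
    rw [this]
    refine (hu j).1.norm.bdd_mul hc.aestronglyMeasurable (c := δ⁻¹) (Eventually.of_forall fun x => ?_)
    rw [Real.norm_eq_abs, abs_of_nonneg (by positivity)]
    gcongr; linarith [norm_nonneg (f x - q)]
  set M : Matrix (Fin n) (Fin n) ℂ := Matrix.of fun i j => KK ν f (p i) (u j) w with hM
  set M' : Matrix (Fin n) (Fin n) ℂ := Matrix.of fun i j => KK ν f (p i) (u j) w' with hM'
  set Q : Matrix (Fin n) (Fin n) ℂ := Matrix.of fun i j => ∫ x, p i (z (l x)) * (φ x * u j x) ∂ν with hQ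
  have hQr : Q.rank ≤ k := by
    classical
    have : Q = (Matrix.of fun (i : Fin n) (c : Fin k) => p i (z c)) * 
        (Matrix.of fun (c : Fin k) (j : Fin n) => ∫ x, (if l x = c then φ x * u j x else 0) ∂ν) := by
      ext i j
      rw [Matrix.mul_apply]
      simp only [hQ, Matrix.of_apply]
      simp_rw [← integral_const_mul]
      rw [← integral_finsetSum]
      · congr 1; ext x
        simp
      · intro c _
        refine Integrable.const_mul ?_ _
        have : (fun x => if l x = c then φ x * u j x else 0) = (l ⁻¹' {c}).indicator fun x => φ x * u j x := by
          ext x; simp [indicator]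
        rw [this]
        exact (hψ j).indicator (hlm (measurableSet_singleton c))
    rw [this]
    refine (Matrix.rank_mul_le_left _ _).trans ?_
    simpa using Matrix.rank_le_card_width (Matrix.of fun (i : Fin n) (c : Fin k) => p i (z c))
  have hM'r : M'.rank ≤ m := hZ.rank hp hu
  have hdet0 : (M' + Q).det = 0 := det_eq_zero_of_rank _ (by have := rank_add_le' M' Q; omega)
  have hJ0 : ∀ j, 0 ≤ ∫ x, ‖u j x‖ / (δ + ‖f x - q‖) ∂ν := fun j => integral_nonneg fun x => by positivity
  have hent : ∀ i j, ‖M i j‖ ≤ P * C1 * I * δ ^ (-a) := by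
    intro i j
    simp only [hM, Matrix.of_apply, KK]
    calc _ ≤ ∫ x, P * C1 * (‖u j x‖ / (δ + ‖f x - q‖)) ∂ν := by
          refine norm_integral_le_of_norm_le ((hdd j).const_mul _) (Eventually.of_forall fun x => ?_)
          rw [norm_div, norm_mul, div_eq_mul_inv]
          have h1 := inv hb x
          have h2 := ((p i).norm_coe_le_norm x).trans (hpP i)
          calc _ ≤ P * ‖u j x‖ * (C1 * (δ + ‖f x - q‖)⁻¹) := by gcongr
            _ = _ := by ring
      _ = P * C1 * ∫ x, (‖u j x‖ / (δ + ‖f x - q‖)) ∂ν := integral_const_mul _ _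
      _ ≤ P * C1 * (δ ^ (-a) * I) := by gcongr; exact hui j δ hδ
      _ = _ := by ring
  have herr : ∀ i j, ‖M i j - (M' + Q) i j‖ ≤ Ce * (δ * δ ^ (-a)) := by
    intro i j
    have e : M i j - (M' + Q) i j = ∫ x, (p i x - p i (z (l x))) * (φ x * u j x) ∂ν := by
      have e1 : M i j - M' i j = ∫ x, p i x * (φ x * u j x) ∂ν := by
        simp only [hM, hM', Matrix.of_apply, KK]
        rw [← integral_sub (KK_integrable f (p i) (hu j).1 hw) (KK_integrable f (p i) (hu j).1 hw')]
        congr 1; ext x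
        simp only [hφ, ContinuousMap.coe_mk]
        have := hne x; have := hne' x
        field_simp
        ring
      rw [Matrix.add_apply, ← sub_sub, e1]
      simp only [hQ, Matrix.of_apply]
      rw [← integral_sub (hpψ i j) (hsψ i j)]
      congr 1; ext x; ring
    rw [e]
    calc _ ≤ ∫ x, 2 * P * C2 * C1 ^ 2 * δ * (‖u j x‖ / (δ + ‖f x - q‖)) ∂ν := by
          refine norm_integral_le_of_norm_le ((hdd j).const_mul _) (Eventually.of_forall fun x => ?_)
          rw [norm_mul, norm_mul]
          have h1 := hφb x
          have h2 := hpL i x (z (l x))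
          have h3 := hl x
          have h4 : 0 < δ + ‖f x - q‖ := by positivity
          have h5 : ‖f x - q‖ ≤ δ + ‖f x - q‖ := by linarith
          calc _ ≤ (P * (C2 * (δ + ‖f x - q‖))) * ((2 * δ * C1 ^ 2 * (δ + ‖f x - q‖)⁻¹ ^ 2) * ‖u j x‖) := by
                gcongr
                exact h2.trans (by gcongr; exact h3.trans (by gcongr))
            _ = _ := by field_simp
      _ = 2 * P * C2 * C1 ^ 2 * δ * ∫ x, (‖u j x‖ / (δ + ‖f x - q‖)) ∂ν := integral_const_mul _ _
      _ ≤ 2 * P * C2 * C1 ^ 2 * δ * (δ ^ (-a) * I) := by gcongr; exact hui j δ hδ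
      _ = _ := by rw [hCe]; ring
  have hda : 0 < δ ^ (-a) := Real.rpow_pos_of_pos hδ _
  have hfin := hdet M (M' + Q) ((P * C1 * I + Ce * R) * δ ^ (-a)) (Ce * (δ * δ ^ (-a))) ?_ ?_ herr (by positivity) (by positivity)
  · rw [hdet0, sub_zero] at hfin
    change ‖M.det‖ ≤ _
    refine hfin.trans ?_
    rw [mul_pow]
    have : 0 ≤ (δ ^ (-a)) ^ (n - 1) * (δ * δ ^ (-a)) := by positivity
    nlinarith
  · intro i j
    refine (hent i j).trans ?_
    gcongr
    have : 0 ≤ Ce * R := by positivity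
    linarith
  · intro i j
    have h1 := norm_sub_le (M i j) (M i j - (M' + Q) i j)
    rw [sub_sub_cancel] at h1
    refine h1.trans ?_
    calc _ ≤ P * C1 * I * δ ^ (-a) + Ce * (R * δ ^ (-a)) := by
          refine add_le_add (hent i j) ((herr i j).trans ?_)
          gcongr
      _ = _ := by ring

end SA
end
end

section
open Set Topology MeasureTheory Filter
noncomputable section
namespace SA
set_option linter.unusedSectionVars false

variable {X : Type*} [MetricSpace X] [CompactSpace X] [MeasurableSpace X] [BorelSpace X]
variable {ν : Measure X} {A : Subalgebra ℂ C(X, ℂ)} {f : C(X, ℂ)}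

def kr (a : ℝ) (r : ℝ) : ENNReal := (ENNReal.ofReal |r|) ^ (a - 1)

theorem kr_meas (a : ℝ) : Measurable (kr a) := by
  unfold kr
  fun_prop

theorem kr_int {a : ℝ} (ha : 0 < a) {M : ℝ} (hM : 0 ≤ M) : ∫⁻ r in Icc (-M) M, kr a r ≠ ⊤ := by
  have h1 : ∫⁻ r in Ioc 0 M, kr a r ≠ ⊤ := by
    have hi : IntegrableOn (fun x : ℝ => x ^ (a - 1)) (Ioc 0 M) volume :=
      (intervalIntegrable_iff_integrableOn_Ioc_of_le hM).1 (intervalIntegral.intervalIntegrable_rpow' (by linarith))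
    have := hi.2
    have h2 : ∫⁻ r in Ioc 0 M, kr a r = ∫⁻ r in Ioc 0 M, ‖r ^ (a - 1)‖ₑ := by
      refine setLIntegral_congr_fun measurableSet_Ioc fun r hr => ?_
      unfold kr
      have h0 : 0 ≤ r ^ (a - 1) := Real.rpow_nonneg hr.1.le _
      change _ = ‖r ^ (a - 1)‖ₑ
      rw [abs_of_pos hr.1, ENNReal.ofReal_rpow_of_pos hr.1, Real.enorm_of_nonneg h0]
    rw [h2]
    exact this.ne
  have h2 : ∫⁻ r in Ico (-M) 0, kr a r = ∫⁻ r in Ioc 0 M, kr a r := by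
    rw [← lintegral_indicator measurableSet_Ico, ← lintegral_indicator measurableSet_Ioc, ← lintegral_neg_eq_self]
    congr 1; ext r
    simp only [indicator, mem_Ico, mem_Ioc, kr, abs_neg]
    congr 1
    apply propext
    constructor <;> rintro ⟨h1, h2⟩ <;> constructor <;> linarith
  have h3 : Icc (-M) M ⊆ (Ico (-M) 0 ∪ Ioc 0 M) ∪ {0} := by
    intro r hr
    rcases lt_trichotomy r 0 with h | h | h
    · exact Or.inl (Or.inl ⟨hr.1, h⟩)
    · exact Or.inr h
    · exact Or.inl (Or.inr ⟨h, hr.2⟩)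
  refine ne_top_of_le_ne_top ?_ (lintegral_mono_set h3)
  refine ne_top_of_le_ne_top ?_ (lintegral_union_le _ _ _)
  refine ENNReal.add_ne_top.2 ⟨ne_top_of_le_ne_top ?_ (lintegral_union_le _ _ _), by simp⟩
  exact ENNReal.add_ne_top.2 ⟨h2 ▸ h1, h1⟩

theorem kr_pt {a δ t r y : ℝ} (ha : 0 < a) (ha1 : a < 1) (hδ : 0 < δ) (hy : 0 ≤ y) (hr : |r| ≤ t) : 
    ENNReal.ofReal (y / (δ + t)) ≤ ENNReal.ofReal (δ ^ (-a)) * (ENNReal.ofReal y * kr a r) := by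
  rcases hy.eq_or_lt with rfl | hy
  · simp
  by_cases h0 : r = 0
  · have : kr a r = ⊤ := by
      unfold kr
      rw [h0, abs_zero, ENNReal.ofReal_zero, ENNReal.zero_rpow_of_neg (by linarith)]
    rw [this, ENNReal.mul_top (by simpa using hy), ENNReal.mul_top (by simpa using Real.rpow_pos_of_pos hδ _)]
    exact le_top
  · have h1 : 0 < |r| := abs_pos.2 h0
    unfold kr
    rw [ENNReal.ofReal_rpow_of_pos h1, ← ENNReal.ofReal_mul hy.le, ← ENNReal.ofReal_mul (Real.rpow_nonneg hδ.le _)]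
    refine ENNReal.ofReal_le_ofReal ?_
    have h2 : (δ + t)⁻¹ ≤ δ ^ (-a) * |r| ^ (a - 1) := by
      have h3 : (δ + t)⁻¹ = (δ + t) ^ (-a) * (δ + t) ^ (a - 1) := by
        rw [← Real.rpow_add (by linarith), ← Real.rpow_neg_one]; congr 1; ring
      rw [h3]
      have hδt : 0 < δ + t := by linarith
      refine mul_le_mul ?_ ?_ (Real.rpow_nonneg hδt.le _) (Real.rpow_nonneg hδ.le _)
      · exact Real.rpow_le_rpow_of_nonpos hδ (by linarith) (by linarith)
      · exact Real.rpow_le_rpow_of_nonpos h1 (by linarith) (by linarith)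
    calc y / (δ + t) = y * (δ + t)⁻¹ := rfl
      _ ≤ y * (δ ^ (-a) * |r| ^ (a - 1)) := by gcongr
      _ = _ := by ring

theorem tonelli [IsFiniteMeasure ν] {u : X → ℂ} (hu : Integrable u ν) {a : ℝ} (ha : 0 < a) (ha1 : a < 1) :
    ∀ᵐ s : ℝ, ∃ I, 0 ≤ I ∧ ∀ q : ℂ, q.re = s → ∀ δ > 0, ∫ x, ‖u x‖ / (δ + ‖f x - q‖) ∂ν ≤ δ ^ (-a) * I := by
  let v := hu.1.mk u
  have hv : StronglyMeasurable v := hu.1.stronglyMeasurable_mk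
  have hvi : Integrable v ν := hu.congr hu.1.ae_eq_mk
  have hfr : Measurable fun x => (f x).re := (Complex.continuous_re.comp f.continuous).measurable
  let G : ℝ → ENNReal := fun s => ∫⁻ x, ‖v x‖ₑ * kr a ((f x).re - s) ∂ν
  have hmeas : Measurable (Function.uncurry fun (s : ℝ) (x : X) => ‖v x‖ₑ * kr a ((f x).re - s)) := by
    refine Measurable.mul ?_ ((kr_meas a).comp ((hfr.comp measurable_snd).sub measurable_fst))
    exact hv.enorm.comp measurable_snd
  have key : ∀ N : ℕ, ∀ᵐ s : ℝ, s ∈ Icc (-(N:ℝ)) N → G s < ⊤ := by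
    intro N
    rw [← ae_restrict_iff' measurableSet_Icc]
    refine ae_lt_top hmeas.lintegral_prod_right' ?_
    change ∫⁻ s in Icc (-(N:ℝ)) N, ∫⁻ x, ‖v x‖ₑ * kr a ((f x).re - s) ∂ν ≠ ⊤
    rw [lintegral_lintegral_swap hmeas.aemeasurable]
    set M := (N:ℝ) + ‖f‖
    have hM : 0 ≤ M := by positivity
    have : ∀ x, ∫⁻ s in Icc (-(N:ℝ)) N, ‖v x‖ₑ * kr a ((f x).re - s) ≤ ‖v x‖ₑ * ∫⁻ r in Icc (-M) M, kr a r := by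
      intro x
      have hmm : Measurable fun s => kr a ((f x).re - s) := (kr_meas a).comp (measurable_const.sub measurable_id)
      rw [lintegral_const_mul _ hmm]
      refine mul_le_mul_right ?_ _
      rw [← lintegral_indicator measurableSet_Icc, ← lintegral_indicator measurableSet_Icc, ← lintegral_sub_left_eq_self ((Icc (-M) M).indicator (kr a)) (f x).re]
      refine lintegral_mono fun s => ?_
      by_cases hs : s ∈ Icc (-(N:ℝ)) N
      · have h1 := abs_le.1 ((Complex.abs_re_le_norm _).trans (f.norm_coe_le_norm x))
        have : (f x).re - s ∈ Icc (-M) M := ⟨by linarith [hs.2], by linarith [hs.1]⟩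
        rw [indicator_of_mem hs, indicator_of_mem this]
      · rw [indicator_of_notMem hs]; exact zero_le
    refine ne_top_of_le_ne_top ?_ (lintegral_mono this)
    rw [lintegral_mul_const _ hv.enorm]
    exact ENNReal.mul_ne_top hvi.2.ne (kr_int ha hM)
  filter_upwards [ae_all_iff.2 key] with s hs
  obtain ⟨N, hN⟩ := exists_nat_ge |s|
  have hG := hs N (abs_le.1 hN)
  refine ⟨(G s).toReal, ENNReal.toReal_nonneg, ?_⟩
  rintro q rfl δ hδ
  have e : ∫ x, ‖u x‖ / (δ + ‖f x - q‖) ∂ν = ∫ x, ‖v x‖ / (δ + ‖f x - q‖) ∂ν := by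
    refine integral_congr_ae ?_
    filter_upwards [hu.1.ae_eq_mk] with x hx
    rw [hx]
  have hc : Continuous fun x => δ + ‖f x - q‖ := by fun_prop
  have hmd : Measurable fun x => ‖v x‖ / (δ + ‖f x - q‖) := hv.norm.measurable.div hc.measurable
  rw [e, integral_eq_lintegral_of_nonneg_ae (Eventually.of_forall fun x => by positivity) 
    hmd.aestronglyMeasurable]
  have h1 : ∫⁻ x, ENNReal.ofReal (‖v x‖ / (δ + ‖f x - q‖)) ∂ν ≤ ENNReal.ofReal (δ ^ (-a)) * G q.re := by
    rw [← lintegral_const_mul _ (hmeas.of_uncurry_left)]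
    refine lintegral_mono fun x => ?_
    have := kr_pt (y := ‖v x‖) ha ha1 hδ (norm_nonneg _) (Complex.abs_re_le_norm (f x - q))
    rw [ofReal_norm] at this
    exact this
  have h2 := ENNReal.toReal_mono (ENNReal.mul_ne_top ENNReal.ofReal_ne_top hG.ne) h1
  rwa [ENNReal.toReal_mul, ENNReal.toReal_ofReal (Real.rpow_nonneg hδ.le _)] at h2

end SA
end
end

section
open Set Topology MeasureTheory Filter
noncomputable section
namespace SA
set_option linter.unusedSectionVars false

variable {X : Type*} [MetricSpace X] [CompactSpace X] [MeasurableSpace X] [BorelSpace X]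
variable {ν : Measure X} {A : Subalgebra ℂ C(X, ℂ)} {f : C(X, ℂ)}

/-- rotated cone -/
def Lt (τ : ℂ) (κ R : ℝ) (q : ℂ) : Set ℂ := {w | ‖w - q‖ < R ∧ κ * ‖w - q‖ < ((q - w) * star τ).im}

theorem Lt_iff {τ : ℂ} (hτ : ‖τ‖ = 1) {κ R : ℝ} {q w : ℂ} : w ∈ Lt τ κ R q ↔ w * star τ ∈ Lc κ R (q * star τ) := by
  have : ‖w * star τ - q * star τ‖ = ‖w - q‖ := by rw [← sub_mul, norm_mul, norm_star, hτ, mul_one]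
  simp only [Lt, Lc, mem_ofPred_eq, this]
  rw [← sub_mul]

theorem Lt_open {τ : ℂ} (hτ : ‖τ‖ = 1) {κ R : ℝ} {q : ℂ} : IsOpen (Lt τ κ R q) := by
  have : Lt τ κ R q = (fun w => w * star τ) ⁻¹' Lc κ R (q * star τ) := by ext w; exact Lt_iff hτ
  rw [this]
  exact (Lc_open _).preimage (by fun_prop)

theorem Lt_convex {τ : ℂ} (hτ : ‖τ‖ = 1) {κ R : ℝ} (hκ : 0 ≤ κ) {q : ℂ} : Convex ℝ (Lt τ κ R q) := by
  have : Lt τ κ R q = (LinearMap.mulRight ℝ (star τ)) ⁻¹' Lc κ R (q * star τ) := by ext w; exact Lt_iff hτ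
  rw [this]
  exact (Lc_convex hκ _).linear_preimage _

theorem Lt_vert {τ : ℂ} {κ R ε : ℝ} {q : ℂ} (h : κ < τ.re) (h0 : 0 < ε) (hε : ε < R) : q - ε * Complex.I ∈ Lt τ κ R q := by
  have e : ‖q - ε * Complex.I - q‖ = ε := by
    rw [sub_sub_cancel_left, norm_neg, norm_mul, Complex.norm_I, mul_one, Complex.norm_real, Real.norm_eq_abs, abs_of_pos h0]
  refine ⟨by rw [e]; exact hε, ?_⟩
  rw [e, sub_sub_cancel]
  simp
  nlinarith

theorem Lt_neg_vert {τ : ℂ} {κ R ε : ℝ} {q : ℂ} (h : κ < τ.re) (h0 : 0 < ε) (hε : ε < R) : q + ε * Complex.I ∈ Lt (-τ) κ R q := by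
  have e : ‖q + ε * Complex.I - q‖ = ε := by
    rw [add_sub_cancel_left, norm_mul, Complex.norm_I, mul_one, Complex.norm_real, Real.norm_eq_abs, abs_of_pos h0]
  refine ⟨by rw [e]; exact hε, ?_⟩
  rw [e, sub_add_cancel_left]
  simp
  nlinarith

theorem Lt_refl {τ : ℂ} {κ R : ℝ} {q w : ℂ} (h : w ∈ Lt τ κ R q) : 2 * q - w ∈ Lt (-τ) κ R q := by
  have e : ‖2 * q - w - q‖ = ‖w - q‖ := by rw [norm_sub_rev w q]; congr 1; ring
  have e2 : (q - (2 * q - w)) * star (-τ) = (q - w) * star τ := by rw [star_neg]; ring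
  unfold Lt at *
  rw [mem_ofPred_eq] at *
  rw [e, e2]; exact h

theorem Lt_lower {τ : ℂ} (hτ : ‖τ‖ = 1) {κ R : ℝ} (hκ : 0 < κ) (hκ1 : κ ≤ 1/1000) {q y w : ℂ} 
    (hy : ‖y - q‖ < 2 * R → |((y - q) * star τ).im| ≤ κ / 2 * ‖y - q‖) (hw : w ∈ Lt τ κ R q) :
    ‖w - q‖ + ‖y - q‖ ≤ (1 + 8 / κ) * ‖y - w‖ := by
  have hk : 8000 ≤ 8 / κ := by rw [le_div_iff₀ hκ]; linarith
  have h3 : ‖y - q‖ ≤ ‖y - w‖ + ‖w - q‖ := by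
    have : y - q = (y - w) + (w - q) := by ring
    rw [this]; exact norm_add_le _ _
  have h0 := norm_nonneg (y - w)
  by_cases h : ‖y - q‖ < 2 * R
  · have hm : ∀ a b : ℂ, ‖a * star τ - b * star τ‖ = ‖a - b‖ := by
      intro a b; rw [← sub_mul, norm_mul, norm_star, hτ, mul_one]
    have h1 := pair_aux hκ hκ1 (q := y * star τ) (q' := q * star τ) (w := w * star τ) 
      (by rw [hm, ← sub_mul]; exact hy h) (((Lt_iff hτ).1 hw).2)
    rw [hm, hm, norm_sub_rev w y] at h1
    have : 4 / κ = (8 / κ) / 2 := by ring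
    rw [this] at h1
    nlinarith
  · have := hw.1
    nlinarith

theorem Lt_off {τ : ℂ} (hτ : ‖τ‖ = 1) {κ R : ℝ} (hκ : 0 < κ) (hκ1 : κ ≤ 1/1000) {q w : ℂ} 
    (hy : ∀ x, ‖f x - q‖ < 2 * R → |((f x - q) * star τ).im| ≤ κ / 2 * ‖f x - q‖) (hw : w ∈ Lt τ κ R q) :
    w ∉ range f := by
  rintro ⟨x, rfl⟩
  have := Lt_lower hτ hκ hκ1 (hy x) hw
  simp at this
  have h2 := hw.2
  rw [sub_eq_zero.1 this] at h2
  simp at h2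

def ta (i : ℕ) : ℂ := (TopologicalSpace.denseSeq Circle i : ℂ)
def ka (k : ℕ) : ℝ := 1 / (k + 1000)
def ra (N : ℕ) : ℝ := 1 / (N + 1)

theorem ta_norm (i : ℕ) : ‖ta i‖ = 1 := Circle.norm_coe _
theorem ka_pos (k : ℕ) : 0 < ka k := by unfold ka; positivity
theorem ra_pos (k : ℕ) : 0 < ra k := by unfold ra; positivity
theorem ka_le (k : ℕ) : ka k ≤ 1 / 1000 := by
  unfold ka; exact one_div_le_one_div_of_le (by norm_num) (by have : (0:ℝ) ≤ k := by positivity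
                                                              linarith)
theorem exists_ka {ε : ℝ} (hε : 0 < ε) : ∃ k, ka k < ε := by
  obtain ⟨k, hk⟩ := exists_nat_one_div_lt hε
  refine ⟨k, lt_of_le_of_lt ?_ hk⟩
  unfold ka
  exact one_div_le_one_div_of_le (by positivity) (by linarith)
theorem exists_ra {ε : ℝ} (hε : 0 < ε) : ∃ k, ra k < ε := exists_nat_one_div_lt hε

theorem exists_ta {τ : ℂ} (hτ : ‖τ‖ = 1) {ε : ℝ} (hε : 0 < ε) : ∃ i, ‖ta i - τ‖ < ε := by
  have hd := (TopologicalSpace.denseRange_denseSeq Circle)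
  obtain ⟨σ, rfl⟩ : ∃ σ : Circle, (σ : ℂ) = τ := ⟨⟨τ, mem_sphere_zero_iff_norm.2 hτ⟩, rfl⟩
  obtain ⟨i, hi⟩ := hd.exists_dist_lt σ hε
  refine ⟨i, ?_⟩
  rw [dist_comm] at hi
  rw [← dist_eq_norm]
  exact hi

theorem dir_aux {γ : ℝ → X} (hγ : Continuous γ)
    (hcov : ∀ x, 0 < (f x).im → ∃ t ∈ Icc (0:ℝ) 1, γ t = x) {q : ℂ} (hq : 0 < q.im)
    (hreg : ∀ t, f (γ t) = q → DifferentiableAt ℝ (fun t => f (γ t)) t ∧ (deriv (fun t => f (γ t)) t).re ≠ 0)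
    (hpar : ∀ t t', f (γ t) = q → f (γ t') = q → (deriv (fun t => f (γ t)) t * star (deriv (fun t => f (γ t)) t')).im = 0)
    (hqr : q ∈ range f) :
    ∃ i k N, ka k < (ta i).re ∧ ra N < q.im ∧ 
      ∀ x, ‖f x - q‖ < 2 * ra N → |((f x - q) * star (ta i)).im| ≤ ka k / 2 * ‖f x - q‖ := by
  obtain ⟨x, rfl⟩ := hqr
  obtain ⟨t, ht, rfl⟩ := hcov x hq
  set c : ℝ → ℂ := fun t => f (γ t) with hc
  obtain ⟨-, hre⟩ := hreg t rfl
  set d := deriv c t with hd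
  have hd0 : d ≠ 0 := fun h => hre (by rw [h]; simp)
  have hdn : 0 < ‖d‖ := norm_pos_iff.2 hd0
  obtain ⟨σ, hσ0, hσ⟩ : ∃ σ : ℝ, 0 < σ * d.re ∧ |σ| = ‖d‖⁻¹ := by
    rcases lt_or_gt_of_ne hre with h | h
    · exact ⟨-‖d‖⁻¹, by have : 0 < ‖d‖⁻¹ := by positivity
                        nlinarith, by rw [abs_neg, abs_of_pos]; positivity⟩
    · exact ⟨‖d‖⁻¹, by positivity, by rw [abs_of_pos]; positivity⟩
  set τ0 : ℂ := σ * d with hτ0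
  have hτn : ‖τ0‖ = 1 := by
    rw [hτ0, norm_mul, Complex.norm_real, Real.norm_eq_abs, hσ]; field_simp
  have hτr : τ0.re = σ * d.re := by rw [hτ0, Complex.re_ofReal_mul]
  obtain ⟨k, hk⟩ := exists_ka (ε := τ0.re / 2) (by linarith)
  have hkp := ka_pos k
  obtain ⟨R, hR, hthin⟩ := geo2 hγ hcov hq (fun t' ht' => ⟨(hreg t' ht').1, fun h => (hreg t' ht').2 (by rw [h]; simp)⟩) 
    (τ := τ0) (fun t' ht' => by
      rw [hτ0, star_mul', ← mul_assoc, mul_comm _ (star (σ:ℂ)), mul_assoc]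
      have : star (σ:ℂ) = σ := Complex.conj_ofReal σ
      rw [this, Complex.im_ofReal_mul, hpar t' t ht' rfl, mul_zero]) (η := ka k / 4) (by positivity)
  obtain ⟨i, hi⟩ := exists_ta hτn (ε := ka k / 4) (by positivity)
  obtain ⟨N, hN⟩ := exists_ra (ε := min (c t).im (R / 2)) (lt_min hq (by positivity))
  refine ⟨i, k, N, ?_, hN.trans_le (min_le_left _ _), ?_⟩
  · have := (abs_le.1 ((Complex.abs_re_le_norm _).trans hi.le)).1
    rw [Complex.sub_re] at this
    linarith
  · intro x hx
    have h1 := hthin x (hx.trans (by have := hN.trans_le (min_le_right _ _); linarith))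
    have e : (f x - c t) * star (ta i) = (f x - c t) * star τ0 + (f x - c t) * star (ta i - τ0) := by
      rw [star_sub]; ring
    change |((f x - c t) * star (ta i)).im| ≤ ka k / 2 * ‖f x - c t‖
    rw [e, Complex.add_im]
    have h2 : |((f x - c t) * star (ta i - τ0)).im| ≤ ‖f x - c t‖ * (ka k / 4) := by
      refine (Complex.abs_im_le_norm _).trans ?_
      rw [norm_mul, norm_star]; gcongr
    have := abs_add_le ((f x - c t) * star τ0).im ((f x - c t) * star (ta i - τ0)).im
    change |((f x - c t) * star τ0).im| ≤ ka k / 4 * ‖f x - c t‖ at h1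
    linarith

end SA
end
end

section
open Set Topology MeasureTheory Filter
noncomputable section
namespace SA
set_option linter.unusedSectionVars false

variable {X : Type*} [MetricSpace X] [CompactSpace X] [MeasurableSpace X] [BorelSpace X]
variable {ν : Measure X} {A : Subalgebra ℂ C(X, ℂ)} {f : C(X, ℂ)}

theorem Fi_open (m : ℕ) : IsOpen (Fi ν A f m) := by
  rw [isOpen_iff_mem_nhds]
  intro w hw
  exact eventually_eventually_nhds.2 hw

/-- top point of NF over s -/
theorem top_pt [IsFiniteMeasure ν] (hf : f ∈ A) {s y0 : ℝ} (h0 : (⟨s, y0⟩ : ℂ) ∈ NF ν A f) :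
    ∃ q : ℂ, q.re = s ∧ 0 < q.im ∧ q ∈ range f ∧ (∀ ε > 0, q + (ε : ℝ) * Complex.I ∉ NF ν A f) ∧ 
      ∀ R > 0, ∃ ε : ℝ, 0 < ε ∧ ε < R ∧ q - ε * Complex.I ∈ NF ν A f := by
  set S : Set ℝ := {y | (⟨s, y⟩ : ℂ) ∈ NF ν A f} with hS
  have hbd : BddAbove S := by
    refine ⟨‖f‖, fun y hy => ?_⟩
    by_contra hc
    push Not at hc
    exact hy.2.2 0 (Fi_far hf hc)
  set T := sSup S with hT
  have hne : S.Nonempty := ⟨y0, h0⟩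
  have hcont : Continuous fun y : ℝ => (⟨s, y⟩ : ℂ) := by
    have : (fun y : ℝ => (⟨s, y⟩ : ℂ)) = fun y : ℝ => (s : ℂ) + y * Complex.I := by
      ext y; apply Complex.ext <;> simp
    rw [this]; fun_prop
  have hSo : IsOpen S := NF_open.preimage hcont
  have hTS : T ∉ S := by
    intro h
    obtain ⟨ε, hε, hb⟩ := Metric.isOpen_iff.1 hSo T h
    have : T + ε / 2 ∈ S := hb (by rw [Metric.mem_ball, Real.dist_eq, add_sub_cancel_left, abs_of_pos] <;> linarith)
    have := le_csSup hbd this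
    linarith
  have hT0 : y0 < T := lt_of_le_of_ne (le_csSup hbd h0) (fun h => hTS (h ▸ h0))
  have happ : ∀ R > 0, ∃ ε : ℝ, 0 < ε ∧ ε < R ∧ T - ε ∈ S := by
    intro R hR
    obtain ⟨y, hy, hlt⟩ := exists_lt_of_lt_csSup hne (show T - R < T by linarith)
    have h1 : y < T := lt_of_le_of_ne (le_csSup hbd hy) (fun h => hTS (h ▸ hy))
    exact ⟨T - y, by linarith, by linarith, by rw [sub_sub_cancel]; exact hy⟩
  have hq0 : 0 < T := h0.1.trans hT0
  have hvert : ∀ ε : ℝ, (⟨s, T⟩ : ℂ) - ε * Complex.I = ⟨s, T - ε⟩ := by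
    intro ε; apply Complex.ext <;> simp
  refine ⟨⟨s, T⟩, rfl, hq0, ?_, ?_, ?_⟩
  · by_contra hr
    refine hTS ⟨hq0, hr, fun m hm => ?_⟩
    obtain ⟨ε, hε, hb⟩ := Metric.isOpen_iff.1 ((Fi_open m).preimage hcont) T hm
    obtain ⟨e, he, heR, h⟩ := happ ε hε
    exact h.2.2 m (hb (by rw [Metric.mem_ball, Real.dist_eq, sub_sub_cancel_left, abs_neg, abs_of_pos] <;> linarith))
  · intro ε hε h
    have e : (⟨s, T⟩ : ℂ) + ε * Complex.I = ⟨s, T + ε⟩ := by apply Complex.ext <;> simp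
    rw [e] at h
    have := le_csSup hbd (show T + ε ∈ S from h)
    linarith
  · intro R hR
    obtain ⟨ε, h1, h2, h3⟩ := happ R hR
    exact ⟨ε, h1, h2, by rw [hvert]; exact h3⟩

def bs (b : ℕ) : ℂ := TopologicalSpace.denseSeq ℂ b

theorem sel [IsFiniteMeasure ν] (hf : f ∈ A) (hA : ∀ p ∈ A, ∃ K : ℝ, ∀ x y, ‖p x - p y‖ ≤ K * dist x y) 
    {γ : ℝ → X} {Λ : NNReal} (hγ : LipschitzWith Λ γ)
    (hcov : ∀ x, 0 < (f x).im → ∃ t ∈ Icc (0:ℝ) 1, γ t = x) {s y0 : ℝ} (h0 : (⟨s, y0⟩ : ℂ) ∈ NF ν A f)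
    (hreg : ∀ t, (f (γ t)).re = s → DifferentiableAt ℝ (fun t => f (γ t)) t ∧ (deriv (fun t => f (γ t)) t).re ≠ 0)
    (hpar : ∀ t t', (f (γ t)).re = s → f (γ t) = f (γ t') → DifferentiableAt ℝ (fun t => f (γ t)) t → 
      DifferentiableAt ℝ (fun t => f (γ t)) t' → (deriv (fun t => f (γ t)) t * star (deriv (fun t => f (γ t)) t')).im = 0)
    (tp : ℕ → ∀ n, Fin n → C(X, ℂ)) (tu : ℕ → ∀ n, Fin n → X → ℂ) (htp : ∀ b n i, tp b n i ∈ A) (htu : ∀ b n i, tu b n i ∈ Un ν A)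
    (hton : ∀ b n, ∀ j : Fin (n + 1), ∃ I, 0 ≤ I ∧ ∀ q : ℂ, q.re = s → ∀ δ > 0, 
      ∫ x, ‖tu b (n + 1) j x‖ / (δ + ‖f x - q‖) ∂ν ≤ δ ^ (-(1 / (2 * ((n:ℝ) + 1)))) * I) :
    ∃ (q : ℂ) (i k N b n C : ℕ), q.re = s ∧ q ∈ range f ∧ ra N < q.im ∧ 
      (∀ x, ‖f x - q‖ < 2 * ra N → |((f x - q) * star (ta i)).im| ≤ ka k / 2 * ‖f x - q‖) ∧ 
      bs b ∈ Lt (ta i) (ka k) (ra N) q ∧ bs b ∈ NF ν A f ∧ 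
      ∀ w ∈ Lt (ta i) (ka k) (ra N) q, ‖DD ν f (tp b (n + 1)) (tu b (n + 1)) w‖ ≤ C * √‖w - q‖ := by
  obtain ⟨q, rfl, hqi, hqr, hup, hlow⟩ := top_pt hf h0
  have hreg' : ∀ t, f (γ t) = q → DifferentiableAt ℝ (fun t => f (γ t)) t ∧ (deriv (fun t => f (γ t)) t).re ≠ 0 := 
    fun t ht => hreg t (by rw [ht])
  obtain ⟨i, k, N, hki, hN, hthin⟩ := dir_aux hγ.continuous hcov hqi hreg' 
    (fun t t' h h' => hpar t t' (by rw [h]) (h.trans h'.symm) (hreg' t h).1 (hreg' t' h').1) hqr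
  obtain ⟨k', z, C2, hC2, hz⟩ := geo1 hγ hcov hqi (fun t h => ⟨(hreg' t h).1, fun hd => (hreg' t h).2 (by rw [hd]; simp)⟩)
  have hτ := ta_norm i
  have hτ' : ‖-ta i‖ = 1 := by rw [norm_neg, hτ]
  have hκ := ka_pos k
  have hκ1 := ka_le k
  have hR := ra_pos N
  have hthin' : ∀ x, ‖f x - q‖ < 2 * ra N → |((f x - q) * star (-ta i)).im| ≤ ka k / 2 * ‖f x - q‖ := by
    intro x hx
    rw [star_neg, mul_neg, Complex.neg_im, abs_neg]; exact hthin x hx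
  have him : ∀ w : ℂ, ‖w - q‖ < ra N → 0 < w.im := by
    intro w hw
    have := (abs_le.1 ((Complex.abs_im_le_norm _).trans hw.le)).1
    rw [Complex.sub_im] at this; linarith
  -- lower cone in NF
  have hL : Lt (ta i) (ka k) (ra N) q ⊆ NF ν A f := by
    obtain ⟨ε, h1, h2, h3⟩ := hlow _ hR
    exact NF_conn (Lt_open hτ) (Lt_convex hτ hκ.le).isPreconnected (fun w hw => Lt_off hτ hκ hκ1 hthin hw)
      (fun w hw => him w hw.1) (Lt_vert hki h1 h2) h3
  obtain ⟨m, hU⟩ : ∃ m, Lt (-ta i) (ka k) (ra N) q ⊆ Fi ν A f m := by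
    have hmem := Lt_neg_vert (q := q) hki (half_pos hR) (half_lt_self hR)
    have h1 := hup _ (half_pos hR)
    have : ∃ m, q + ((ra N / 2 : ℝ) : ℂ) * Complex.I ∈ Fi ν A f m := by
      by_contra hc
      push Not at hc
      exact h1 ⟨him _ hmem.1, Lt_off hτ' hκ hκ1 hthin' hmem, hc⟩
    obtain ⟨m, hm⟩ := this
    exact ⟨m, Fi_conn (Lt_open hτ') (Lt_convex hτ' hκ.le).isPreconnected (fun w hw => Lt_off hτ' hκ hκ1 hthin' hw) hmem hm⟩
  obtain ⟨b, hb⟩ : ∃ b, bs b ∈ Lt (ta i) (ka k) (ra N) q := 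
    (TopologicalSpace.denseRange_denseSeq ℂ).exists_mem_open (Lt_open hτ) ⟨_, Lt_vert hki (half_pos hR) (half_lt_self hR)⟩
  set n := m + k' with hn
  choose K hK using fun j => hA (tp b (n + 1) j) (htp b _ j)
  choose I hI0 hI using hton b n
  set P := ∑ j, (‖tp b (n + 1) j‖ + |K j|) with hP
  have hPj : ∀ j, ‖tp b (n + 1) j‖ + |K j| ≤ P := fun j => 
    Finset.single_le_sum (f := fun j => ‖tp b (n + 1) j‖ + |K j|) (fun j _ => by positivity) (Finset.mem_univ j)
  have hIj : ∀ j, I j ≤ ∑ j, I j := fun j => Finset.single_le_sum (f := I) (fun j _ => hI0 j) (Finset.mem_univ j)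
  have hP0 : 0 ≤ P := Finset.sum_nonneg fun j _ => by positivity
  have hIs : 0 ≤ ∑ j, I j := Finset.sum_nonneg fun j _ => hI0 j
  obtain ⟨C, hC, hdec⟩ := decay (ν := ν) (A := A) (f := f) (n := n + 1) (m := m) (k := k') (z := z) (C1 := 1 + 8 / ka k) (C2 := C2) (I := ∑ j, I j)
    (P := P) (R := ra N) (a := 1 / (2 * ((n:ℝ) + 1))) (q := q) (by omega) (by positivity) hC2.le hIs hP0 hR.le hz 
    (fun j => htp b _ j) (fun j => htu b _ j) (fun j => by linarith [hPj j, abs_nonneg (K j)]) 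
    (fun j x y => (hK j x y).trans (by
      gcongr
      linarith [hPj j, le_abs_self (K j), norm_nonneg (tp b (n + 1) j)])) 
    (fun j δ hδ => (hI j q rfl δ hδ).trans (by gcongr; exact hIj j))
  obtain ⟨C', hC'⟩ := exists_nat_ge C
  refine ⟨q, i, k, N, b, n, C', rfl, hqr, hN, hthin, hb, hL hb, fun w hw => ?_⟩
  have hw0 : 0 < ‖w - q‖ := by
    rw [norm_pos_iff, sub_ne_zero]
    rintro rfl
    have := hw.2
    simp at this
  have hr := Lt_refl hw
  have e : ‖2 * q - w - q‖ = ‖w - q‖ := by rw [norm_sub_rev w q]; congr 1; ring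
  have := hdec w (2 * q - w) hw0 hw.1.le e (fun x => Lt_lower hτ hκ hκ1 (hthin x) hw) 
    (fun x => by have := Lt_lower hτ' hκ hκ1 (hthin' x) hr; rwa [e] at this) (hU hr).self_of_nhds
  refine this.trans ?_
  have e2 : (‖w - q‖ ^ (-(1 / (2 * ((n:ℝ) + 1))))) ^ (n + 1 - 1) * (‖w - q‖ * ‖w - q‖ ^ (-(1 / (2 * ((n:ℝ) + 1))))) = √‖w - q‖ := by
    rw [Real.sqrt_eq_rpow, ← Real.rpow_natCast, ← Real.rpow_mul hw0.le]
    nth_rewrite 2 [← Real.rpow_one ‖w - q‖]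
    rw [← Real.rpow_add hw0, ← Real.rpow_add hw0]
    congr 1
    rw [Nat.add_sub_cancel]
    field_simp
    ring
  rw [mul_assoc, e2]
  gcongr

end SA
end
end

section
open Set Topology MeasureTheory Filter
noncomputable section
namespace SA
set_option linter.unusedSectionVars false

variable {X : Type*} [MetricSpace X] [CompactSpace X] [MeasurableSpace X] [BorelSpace X]
variable {ν : Measure X} {A : Subalgebra ℂ C(X, ℂ)} {f : C(X, ℂ)}

theorem vol_aux {κ : ℝ} (hκ : 0 < κ) (hκ1 : κ ≤ 1/1000) {τ : ℂ} (hτ : ‖τ‖ = 1) {E : Set ℂ}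
    (hp : ∀ q ∈ E, ∀ q' ∈ E, |((q - q') * star τ).im| ≤ κ / 2 * ‖q - q'‖)
    (hE : volume (Complex.re '' E) ≠ 0) : 0 < volume (Complex.re '' ((fun z => z * star τ) '' E)) := by
  rw [pos_iff_ne_zero]
  intro h0
  apply hE
  set S := Complex.re '' ((fun z => z * star τ) '' E) with hS
  have hex : ∀ r ∈ S, ∃ q ∈ E, (q * star τ).re = r := by
    rintro r ⟨_, ⟨q, hq, rfl⟩, rfl⟩; exact ⟨q, hq, rfl⟩
  choose! g hg hgr using hex
  have hlow : ∀ q ∈ E, ∀ q' ∈ E, ‖q - q'‖ ≤ 2 * |(q * star τ).re - (q' * star τ).re| := by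
    intro q hq q' hq'
    have h1 := hp q hq q' hq'
    have h2 := Complex.norm_le_abs_re_add_abs_im ((q - q') * star τ)
    rw [norm_mul, norm_star, hτ, mul_one] at h2
    rw [← Complex.sub_re, ← sub_mul]
    nlinarith [norm_nonneg (q - q')]
  have hL : LipschitzOnWith 2 (fun r => (g r).re) S := by
    refine LipschitzOnWith.of_dist_le_mul fun r hr r' hr' => ?_
    rw [Real.dist_eq, Real.dist_eq, ← Complex.sub_re]
    refine (Complex.abs_re_le_norm _).trans ?_
    have := hlow _ (hg r hr) _ (hg r' hr')
    rw [hgr r hr, hgr r' hr'] at this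
    exact this
  have hsub : Complex.re '' E ⊆ (fun r => (g r).re) '' S := by
    rintro _ ⟨q, hq, rfl⟩
    have hr : (q * star τ).re ∈ S := ⟨_, ⟨q, hq, rfl⟩, rfl⟩
    refine ⟨_, hr, ?_⟩
    have := hlow _ (hg _ hr) _ hq
    rw [hgr _ hr, sub_self, abs_zero, mul_zero] at this
    change (g _).re = _
    rw [sub_eq_zero.1 (norm_le_zero_iff.1 this)]
  refine measure_mono_null hsub ?_
  have := hL.hausdorffMeasure_image_le (d := 1) (by norm_num)
  rw [hausdorffMeasure_real, h0, mul_zero] at this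
  exact le_antisymm this bot_le

theorem contr {D : ℂ → ℂ} (hD : ∀ w, w ∉ range f → DifferentiableAt ℂ D w) {κ R C : ℝ} {τ b : ℂ} (hτ : ‖τ‖ = 1) 
    (hκ : 0 < κ) (hκ1 : κ ≤ 1/1000) (hR : 0 < R) {E0 : Set ℂ} (hr : ∀ q ∈ E0, q ∈ range f)
    (hthin : ∀ q ∈ E0, ∀ x, ‖f x - q‖ < 2 * R → |((f x - q) * star τ).im| ≤ κ / 2 * ‖f x - q‖)
    (hb : ∀ q ∈ E0, b ∈ Lt τ κ R q) (hbd : ∀ q ∈ E0, ∀ w ∈ Lt τ κ R q, ‖D w‖ ≤ C * √‖w - q‖)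
    (hvol : volume (Complex.re '' E0) ≠ 0) : ∀ᶠ w in 𝓝 b, D w = 0 := by
  set T : ℂ → ℂ := fun z => z * star τ with hT
  have hTc : Continuous T := by fun_prop
  have hττ : star τ * τ = 1 := by
    have := Complex.conj_mul' τ
    rw [hτ] at this; simpa using this
  have hTm : ∀ a b : ℂ, ‖T a - T b‖ = ‖a - b‖ := by
    intro a b; simp only [hT]; rw [← sub_mul, norm_mul, norm_star, hτ, mul_one]
  have hp0 : ∀ q ∈ E0, ∀ q' ∈ E0, |((q - q') * star τ).im| ≤ κ / 2 * ‖q - q'‖ := by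
    intro q hq q' hq'
    obtain ⟨x, rfl⟩ := hr q hq
    refine hthin q' hq' x ?_
    have h1 := (hb _ hq).1
    have h2 := (hb _ hq').1
    have : f x - q' = (b - q') - (b - f x) := by ring
    rw [this]
    exact (norm_sub_le _ _).trans_lt (by linarith)
  have hpE : ∀ q ∈ closure E0, ∀ q' ∈ closure E0, |((q - q') * star τ).im| ≤ κ / 2 * ‖q - q'‖ := by
    have hc1 : Continuous fun p : ℂ × ℂ => |((p.1 - p.2) * star τ).im| := 
      continuous_abs.comp (Complex.continuous_im.comp (by fun_prop))
    have hcl : IsClosed {p : ℂ × ℂ | |((p.1 - p.2) * star τ).im| ≤ κ / 2 * ‖p.1 - p.2‖} :=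
      isClosed_le hc1 (by fun_prop)
    have : closure E0 ×ˢ closure E0 ⊆ {p : ℂ × ℂ | |((p.1 - p.2) * star τ).im| ≤ κ / 2 * ‖p.1 - p.2‖} := by
      rw [← closure_prod_eq]
      refine closure_minimal ?_ hcl
      rintro ⟨q, q'⟩ ⟨h, h'⟩
      exact hp0 q h q' h'
    intro q hq q' hq'
    exact this (mk_mem_prod hq hq')
  have hEc : IsCompact (closure E0) := by
    refine Metric.isCompact_of_isClosed_isBounded isClosed_closure (Bornology.IsBounded.closure ?_)
    refine (isCompact_range f.continuous).isBounded.subset fun q hq => hr q hq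
  -- nearby points
  have hnear : ∀ q ∈ closure E0, ∀ w ∈ Lt τ κ R q, ∃ᶠ q' in 𝓝 q, q' ∈ E0 ∧ w ∈ Lt τ κ R q' := by
    intro q hq w hw
    have h1 : Continuous fun q' : ℂ => ‖w - q'‖ := by fun_prop
    have h2 : Continuous fun q' : ℂ => ((q' - w) * star τ).im := Complex.continuous_im.comp (by fun_prop)
    have : IsOpen {q' : ℂ | w ∈ Lt τ κ R q'} := IsOpen.inter (isOpen_lt h1 continuous_const) (isOpen_lt (continuous_const.mul h1) h2)
    exact (mem_closure_iff_frequently.1 hq).and_eventually (this.mem_nhds hw)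
  have hoff : ∀ q ∈ closure E0, ∀ w ∈ Lt τ κ R q, w ∉ range f := by
    intro q hq w hw
    obtain ⟨q', hq', hw'⟩ := (hnear q hq w hw).exists
    exact Lt_off hτ hκ hκ1 (hthin q' hq') hw'
  have hbdE : ∀ q ∈ closure E0, ∀ w ∈ Lt τ κ R q, ‖D w‖ ≤ C * √‖w - q‖ := by
    intro q hq w hw
    have hc : Continuous fun q' : ℂ => C * √‖w - q'‖ := by fun_prop
    have hcl : IsClosed {q' : ℂ | ‖D w‖ ≤ C * √‖w - q'‖} := isClosed_le continuous_const hc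
    have : q ∈ closure {q' : ℂ | ‖D w‖ ≤ C * √‖w - q'‖} := by
      rw [mem_closure_iff_frequently]
      exact (hnear q hq w hw).mono fun q' h => hbd q' h.1 w h.2
    rwa [hcl.closure_eq] at this
  set D' : ℂ → ℂ := fun w => D (w * τ) with hD'
  have hTinv : ∀ w, T (w * τ) = w := by
    intro w; simp only [hT]; rw [mul_assoc, mul_comm τ, hττ, mul_one]
  have hLiff : ∀ q w, w ∈ Lc κ R (T q) ↔ w * τ ∈ Lt τ κ R q := by
    intro q w
    rw [Lt_iff hτ]
    change _ ↔ T (w * τ) ∈ Lc κ R (T q)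
    rw [hTinv]
  have hmain := lemQ hκ hκ1 hR (E := T '' closure E0) (D := D') (C := C) (hEc.image hTc) ?_ ?_ ?_ ?_
  · obtain ⟨_, ⟨q, hq, rfl⟩, hz⟩ := hmain
    have hz' : ∀ w ∈ Lt τ κ R q, D w = 0 := by
      intro w hw
      have := hz (T w) ((Lt_iff hτ).1 hw)
      simp only [hD', hT] at this
      rwa [mul_assoc, hττ, mul_one] at this
    have hne : (Lt τ κ R q).Nonempty := by
      have : - ((R / 2 : ℝ) : ℂ) * Complex.I + T q ∈ Lc κ R (T q) := by
        have e : ‖- ((R / 2 : ℝ) : ℂ) * Complex.I + T q - T q‖ = R / 2 := by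
          rw [add_sub_cancel_right, norm_mul, norm_neg, Complex.norm_I, mul_one, Complex.norm_real, Real.norm_eq_abs, abs_of_pos (half_pos hR)]
        refine ⟨by rw [e]; linarith, ?_⟩
        rw [e]
        simp
        nlinarith
      exact ⟨_, (hLiff q _).1 this⟩
    obtain ⟨w0, hw0⟩ := hne
    obtain ⟨q', hq', hw'⟩ := (hnear q hq w0 hw0).exists
    have han : AnalyticOnNhd ℂ D (Lt τ κ R q') := DifferentiableOn.analyticOnNhd
      (fun w hw => (hD w (hoff q' (subset_closure hq') w hw)).differentiableWithinAt) (Lt_open hτ)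
    have := han.eqOn_zero_of_preconnected_of_eventuallyEq_zero (Lt_convex hτ hκ.le).isPreconnected hw' ?_
    · filter_upwards [(Lt_open hτ).mem_nhds (hb q' hq')] with w hw using this hw
    · filter_upwards [(Lt_open hτ).mem_nhds hw0] with w hw using hz' w hw
  · rintro _ ⟨q, hq, rfl⟩ _ ⟨q', hq', rfl⟩
    rw [hTm]
    simp only [hT]
    rw [← sub_mul]
    exact hpE q hq q' hq'
  · refine vol_aux hκ hκ1 hτ hpE fun h => hvol (measure_mono_null (image_mono subset_closure) h)
  · rintro _ ⟨q, hq, rfl⟩ w hw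
    have h1 := hD _ (hoff q hq _ ((hLiff q w).1 hw))
    exact DifferentiableAt.comp w h1 (by fun_prop)
  · rintro _ ⟨q, hq, rfl⟩ w hw
    have := hbdE q hq _ ((hLiff q w).1 hw)
    rw [← hTm, hTinv] at this
    exact this

theorem exists_tuple {b : ℂ} (hb : b ∈ NF ν A f) (n : ℕ) : ∃ (p : Fin (n + 1) → C(X, ℂ)) (u : Fin (n + 1) → X → ℂ), 
    (∀ i, p i ∈ A) ∧ (∀ i, u i ∈ Un ν A) ∧ ¬ ∀ᶠ w in 𝓝 b, DD ν f p u w = 0 := by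
  by_contra hc
  push Not at hc
  apply hb.2.2 n
  obtain ⟨ε, hε, hball⟩ := Metric.isOpen_iff.1 isClosed_range_f.isOpen_compl b hb.2.1
  filter_upwards [Metric.ball_mem_nhds b hε] with w hw p u hp hu
  have han : AnalyticOnNhd ℂ (DD ν f p u) (Metric.ball b ε) := DifferentiableOn.analyticOnNhd
      (fun w hw => (DD_diff hu (hball hw)).differentiableWithinAt) Metric.isOpen_ball
  exact han.eqOn_zero_of_preconnected_of_eventuallyEq_zero (convex_ball b ε).isPreconnected 
    (Metric.mem_ball_self hε) (hc p u hp hu) hw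

theorem lemF [IsFiniteMeasure ν] (hf : f ∈ A) (hA : ∀ p ∈ A, ∃ K : ℝ, ∀ x y, ‖p x - p y‖ ≤ K * dist x y) 
    {γ : ℝ → X} {Λ L : NNReal} (hγ : LipschitzWith Λ γ) (hc : LipschitzWith L (fun t => f (γ t)))
    (hcov : ∀ x, 0 < (f x).im → ∃ t ∈ Icc (0:ℝ) 1, γ t = x) : NF ν A f = ∅ := by
  classical
  by_contra hne
  obtain ⟨zs, hzs⟩ := nonempty_iff_ne_empty.2 hne
  have htup : ∀ b n : ℕ, ∃ (pu : (Fin n → C(X, ℂ)) × (Fin n → X → ℂ)), (∀ i, pu.1 i ∈ A) ∧ (∀ i, pu.2 i ∈ Un ν A) ∧ 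
      ((∃ n', n = n' + 1) → bs b ∈ NF ν A f → ¬ ∀ᶠ w in 𝓝 (bs b), DD ν f pu.1 pu.2 w = 0) := by
    intro b n
    by_cases h : (∃ n', n = n' + 1) ∧ bs b ∈ NF ν A f
    · obtain ⟨⟨n', rfl⟩, hb⟩ := h
      obtain ⟨p, u, hp, hu, h⟩ := exists_tuple hb n'
      exact ⟨(p, u), hp, hu, fun _ _ => h⟩
    · exact ⟨(0, 0), fun i => A.zero_mem, fun i => ⟨integrable_zero _ _ _, fun p _ => by simp⟩, fun h1 h2 => absurd ⟨h1, h2⟩ h⟩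
  choose T hT1 hT2 hT3 using htup
  have hton : ∀ᵐ s : ℝ, ∀ b n, ∀ j : Fin (n + 1), ∃ I, 0 ≤ I ∧ ∀ q : ℂ, q.re = s → ∀ δ > 0, 
      ∫ x, ‖(T b (n + 1)).2 j x‖ / (δ + ‖f x - q‖) ∂ν ≤ δ ^ (-(1 / (2 * ((n:ℝ) + 1)))) * I := by
    rw [ae_all_iff]; intro b
    rw [ae_all_iff]; intro n
    rw [ae_all_iff]; intro j
    have hn : (0:ℝ) ≤ n := by positivity
    refine tonelli (hT2 b (n + 1) j).1 (by positivity) ?_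
    rw [div_lt_one (by positivity)]; linarith
  let E : ℕ × ℕ × ℕ × ℕ × ℕ × ℕ → Set ℂ := fun ⟨i, k, N, b, n, C⟩ => {q | q ∈ range f ∧ ra N < q.im ∧ 
      (∀ x, ‖f x - q‖ < 2 * ra N → |((f x - q) * star (ta i)).im| ≤ ka k / 2 * ‖f x - q‖) ∧ 
      bs b ∈ Lt (ta i) (ka k) (ra N) q ∧ bs b ∈ NF ν A f ∧ 
      ∀ w ∈ Lt (ta i) (ka k) (ra N) q, ‖DD ν f (T b (n + 1)).1 (T b (n + 1)).2 w‖ ≤ C * √‖w - q‖}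
  have hcov2 : ∀ᵐ s : ℝ, (⟨s, zs.im⟩ : ℂ) ∈ NF ν A f → s ∈ ⋃ π, Complex.re '' E π := by
    filter_upwards [hton, reg_ae hc, par_ae (fun t => f (γ t))] with s h1 h2 h3 h0
    obtain ⟨q, i, k, N, b, n, C, hq, h⟩ := sel hf hA hγ hcov h0 h2 h3 (fun b n => (T b n).1) (fun b n => (T b n).2) hT1 hT2 h1
    exact mem_iUnion.2 ⟨(i, k, N, b, n, C), q, h, hq⟩
  have hzero : ∀ π, volume (Complex.re '' E π) = 0 := by
    rintro ⟨i, k, N, b, n, C⟩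
    by_contra hvol
    have hEne : (E ⟨i, k, N, b, n, C⟩).Nonempty := by
      by_contra hem
      rw [not_nonempty_iff_eq_empty] at hem
      rw [hem] at hvol; simp at hvol
    obtain ⟨q0, hq0⟩ := hEne
    refine hT3 b (n + 1) ⟨n, rfl⟩ hq0.2.2.2.2.1 ?_
    exact contr (f := f) (fun w hw => DD_diff (hT2 b (n + 1)) hw) (ta_norm i) (ka_pos k) (ka_le k) (ra_pos N) 
      (E0 := E ⟨i, k, N, b, n, C⟩) (fun q h => h.1) (fun q h => h.2.2.1) (fun q h => h.2.2.2.1) (fun q h => h.2.2.2.2.2) hvol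
  have hnull : volume (⋃ π, Complex.re '' E π) = 0 := measure_iUnion_null hzero
  have hopen : IsOpen {s : ℝ | (⟨s, zs.im⟩ : ℂ) ∈ NF ν A f} := by
    refine NF_open.preimage ?_
    have : (fun y : ℝ => (⟨y, zs.im⟩ : ℂ)) = fun y : ℝ => (y : ℂ) + zs.im * Complex.I := by
      ext y; apply Complex.ext <;> simp
    rw [this]; fun_prop
  have hpos := hopen.measure_pos volume ⟨zs.re, hzs⟩
  have : volume {s : ℝ | (⟨s, zs.im⟩ : ℂ) ∈ NF ν A f} = 0 := by
    have h2 : ∀ᵐ s : ℝ, s ∉ ⋃ π, Complex.re '' E π := measure_eq_zero_iff_ae_notMem.1 hnull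
    rw [measure_eq_zero_iff_ae_notMem]
    filter_upwards [hcov2, h2] with s h1 h2 h3 using h2 (h1 h3)
  exact hpos.ne' this

end SA
end
end

section
open Set Topology MeasureTheory Filter
noncomputable section
namespace SA
set_option linter.unusedSectionVars false

section abs
variable {B H : Type*} [NormedRing B] [NormedAlgebra ℂ B] [NormedAddCommGroup H] [NormedSpace ℂ H] [CompleteSpace H]

def Cpt (T : H →L[ℂ] H) : Prop := IsCompactOperator T

theorem cpt_mul_right {S T : H →L[ℂ] H} (h : Cpt S) : Cpt (S * T) := h.comp_clm T
theorem cpt_mul_left {S T : H →L[ℂ] H} (h : Cpt S) : Cpt (T * S) := h.clm_comp T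
theorem cpt_add {S T : H →L[ℂ] H} (h : Cpt S) (h' : Cpt T) : Cpt (S + T) := h.add h'
theorem cpt_zero : Cpt (0 : H →L[ℂ] H) := isCompactOperator_zero

/-- symbols with compact Hankel operator -/
def CC (ρ : B →ₐ[ℂ] (H →L[ℂ] H)) (P : H →L[ℂ] H) (hP : P * P = P) : Subalgebra ℂ B where
  carrier := {φ | Cpt ((1 - P) * ρ φ * P)}
  mul_mem' := by
    intro φ ψ h1 h2
    have e : (1 - P) * ρ (φ * ψ) * P = ((1 - P) * ρ φ * P) * (ρ ψ * P) + ((1 - P) * ρ φ) * ((1 - P) * ρ ψ * P) := by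
      rw [map_mul]; noncomm_ring
    change Cpt _
    rw [e]
    exact cpt_add (cpt_mul_right h1) (cpt_mul_left h2)
  add_mem' := by
    intro φ ψ h1 h2
    have e : (1 - P) * ρ (φ + ψ) * P = ((1 - P) * ρ φ * P)  + ((1 - P) * ρ ψ * P) := by
      rw [map_add]; noncomm_ring
    change Cpt _
    rw [e]
    exact cpt_add h1 h2
  algebraMap_mem' := by
    intro r
    change Cpt _
    have e : (1 - P) * ρ (algebraMap ℂ B r) * P = 0 := by
      rw [AlgHom.commutes, Algebra.algebraMap_eq_smul_one]
      simp [sub_mul, hP]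
    rw [e]
    exact cpt_zero

theorem mem_CC {ρ : B →ₐ[ℂ] (H →L[ℂ] H)} {P : H →L[ℂ] H} {hP : P * P = P} {φ : B} :
  φ ∈ CC ρ P hP ↔ Cpt ((1 - P) * ρ φ * P) := Iff.rfl

theorem CC_closed {ρ : B →ₐ[ℂ] (H →L[ℂ] H)} (hρ : Continuous ρ) {P : H →L[ℂ] H} {hP : P * P = P} :
    IsClosed (CC ρ P hP : Set B) := by
  have hc : Continuous fun φ => (1 - P) * ρ φ * P := (continuous_const.mul hρ).mul continuous_const
  have := (isClosed_setOfPred_isCompactOperator (𝕜₁ := ℂ) (𝕜₂ := ℂ) (σ₁₂ := RingHom.id ℂ) (M₁ := H) (M₂ := H)).preimage hc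
  exact this

theorem CC_inv {ρ : B →ₐ[ℂ] (H →L[ℂ] H)} {P : H →L[ℂ] H} {hP : P * P = P} {φ : B} (h : ∀ x, P x = x → P (ρ φ x) = ρ φ x) :
    φ ∈ CC ρ P hP := by
  rw [mem_CC]
  have e : (1 - P) * ρ φ * P = 0 := by
    ext x
    have := h (P x) (by rw [← mul_apply_eq_comp, hP])
    simp [this]
  rw [e]; exact cpt_zero

theorem finrank_cpt {T : H →L[ℂ] H} (V : Submodule ℂ H) [FiniteDimensional ℂ V] (h : ∀ x, T x ∈ V) : Cpt T := by
  have e : T = V.subtypeL ∘L (T.codRestrict V h) := by ext; rfl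
  have : ProperSpace V := FiniteDimensional.proper ℂ V
  have : LocallyCompactSpace V := inferInstance
  have h2 : IsCompactOperator (V.subtypeL ∘L (T.codRestrict V h)) := (isCompactOperator_of_locallyCompactSpace_dom (T.codRestrict V h)).clm_comp V.subtypeL
  rw [Cpt, e]
  exact h2

end abs

variable {X : Type*} [MetricSpace X] [CompactSpace X] [MeasurableSpace X] [BorelSpace X]

theorem mulLp_mem (ν : Measure X) (φ : C(X, ℂ)) (g : Lp ℂ 2 ν) : MemLp (fun x => φ x * g x) 2 ν :=
  (Lp.memLp g).of_le_mul (c := ‖φ‖) (φ.continuous.aestronglyMeasurable.mul (Lp.aestronglyMeasurable g))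
    (Eventually.of_forall fun x => by rw [norm_mul]; gcongr; exact φ.norm_coe_le_norm x)

def mulLp (ν : Measure X) (φ : C(X, ℂ)) (g : Lp ℂ 2 ν) : Lp ℂ 2 ν := (mulLp_mem ν φ g).toLp _

theorem mulLp_coe (ν : Measure X) (φ : C(X, ℂ)) (g : Lp ℂ 2 ν) : mulLp ν φ g =ᵐ[ν] fun x => φ x * g x :=
  (mulLp_mem ν φ g).coeFn_toLp

theorem mulLp_norm (ν : Measure X) (φ : C(X, ℂ)) (g : Lp ℂ 2 ν) : ‖mulLp ν φ g‖ ≤ ‖φ‖ * ‖g‖ := by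
  apply Lp.norm_le_mul_norm_of_ae_le_mul
  filter_upwards [mulLp_coe ν φ g] with x hx
  rw [hx, norm_mul]; gcongr; exact φ.norm_coe_le_norm x

def mulCLM (ν : Measure X) (φ : C(X, ℂ)) : Lp ℂ 2 ν →L[ℂ] Lp ℂ 2 ν :=
  LinearMap.mkContinuous
    { toFun := mulLp ν φ
      map_add' := by
        intro g h
        ext1
        filter_upwards [mulLp_coe ν φ g, mulLp_coe ν φ h, mulLp_coe ν φ (g + h), Lp.coeFn_add g h, Lp.coeFn_add (mulLp ν φ g) (mulLp ν φ h)] with x h1 h2 h3 h4 h5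
        rw [h3, h4, h5, Pi.add_apply, Pi.add_apply, h1, h2, mul_add]
      map_smul' := by
        intro c g
        ext1
        filter_upwards [mulLp_coe ν φ g, mulLp_coe ν φ (c • g), Lp.coeFn_smul c g, Lp.coeFn_smul c (mulLp ν φ g)] with x h1 h3 h4 h5
        rw [RingHom.id_apply, h3, h4, h5, Pi.smul_apply, Pi.smul_apply, h1, smul_eq_mul, smul_eq_mul]; ring } ‖φ‖ (mulLp_norm ν φ)

theorem mulCLM_coe (ν : Measure X) (φ : C(X, ℂ)) (g : Lp ℂ 2 ν) : mulCLM ν φ g =ᵐ[ν] fun x => φ x * g x := mulLp_coe ν φ g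

def mulRep (ν : Measure X) : C(X, ℂ) →ₐ[ℂ] (Lp ℂ 2 ν →L[ℂ] Lp ℂ 2 ν) :=
  AlgHom.ofLinearMap
    { toFun := mulCLM ν
      map_add' := by
        intro φ ψ
        ext1 g; ext1
        filter_upwards [mulCLM_coe ν φ g, mulCLM_coe ν ψ g, mulCLM_coe ν (φ + ψ) g, Lp.coeFn_add (mulCLM ν φ g) (mulCLM ν ψ g)] with x h1 h2 h3 h5
        rw [h3]; change _ = (mulCLM ν φ g + mulCLM ν ψ g) x
        rw [h5, Pi.add_apply, h1, h2, ContinuousMap.add_apply, add_mul]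
      map_smul' := by
        intro c φ
        ext1 g; ext1
        filter_upwards [mulCLM_coe ν φ g, mulCLM_coe ν (c • φ) g, Lp.coeFn_smul c (mulCLM ν φ g)] with x h1 h3 h5
        rw [RingHom.id_apply, h3]; change _ = (c • mulCLM ν φ g) x
        rw [h5, Pi.smul_apply, h1, ContinuousMap.smul_apply, smul_eq_mul, smul_eq_mul]; ring }
    (by
      ext1 g; ext1
      filter_upwards [mulCLM_coe ν 1 g] with x h1
      change mulCLM ν 1 g x = _
      rw [h1]; simp)
    (by
      intro φ ψ
      ext1 g; ext1
      filter_upwards [mulCLM_coe ν (φ * ψ) g, mulCLM_coe ν ψ g, mulCLM_coe ν φ (mulCLM ν ψ g)] with x h1 h2 h3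
      change mulCLM ν (φ * ψ) g x = mulCLM ν φ (mulCLM ν ψ g) x
      rw [h1, h3, h2]; simp [mul_assoc])

theorem mulRep_coe (ν : Measure X) (φ : C(X, ℂ)) (g : Lp ℂ 2 ν) : mulRep ν φ g =ᵐ[ν] fun x => φ x * g x := mulLp_coe ν φ g

theorem mulRep_norm (ν : Measure X) (φ : C(X, ℂ)) : ‖mulRep ν φ‖ ≤ ‖φ‖ :=
  ContinuousLinearMap.opNorm_le_bound _ (norm_nonneg _) (mulLp_norm ν φ)

theorem mulRep_cont (ν : Measure X) : Continuous (mulRep ν) :=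
  AddMonoidHomClass.continuous_of_bound (mulRep ν) 1 (fun φ => by simpa using mulRep_norm ν φ)

variable (ν : Measure X) [IsFiniteMeasure ν] (A : Subalgebra ℂ C(X, ℂ)) (f : C(X, ℂ))

def iot : C(X, ℂ) →L[ℂ] Lp ℂ 2 ν := ContinuousMap.toLp 2 ν ℂ

theorem iot_coe (φ : C(X, ℂ)) : iot ν φ =ᵐ[ν] φ := ContinuousMap.coeFn_toLp ν φ

theorem mulRep_iot (φ ψ : C(X, ℂ)) : mulRep ν φ (iot ν ψ) = iot ν (φ * ψ) := by
  ext1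
  filter_upwards [mulRep_coe ν φ (iot ν ψ), iot_coe ν ψ, iot_coe ν (φ * ψ)] with x h1 h2 h3
  rw [h1, h2, h3]; rfl

def MM : Submodule ℂ (Lp ℂ 2 ν) := ((Subalgebra.toSubmodule A).map (iot ν).toLinearMap).topologicalClosure

instance : CompleteSpace (MM ν A) := (Submodule.isClosed_topologicalClosure _).completeSpace_coe

theorem iot_mem {p : C(X, ℂ)} (hp : p ∈ A) : iot ν p ∈ MM ν A := 
  Submodule.le_topologicalClosure _ ⟨p, hp, rfl⟩

/-- closed conditions extend from `A` to `MM` -/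
theorem MM_ind {S : Set (Lp ℂ 2 ν)} (hS : IsClosed S) (h : ∀ p ∈ A, iot ν p ∈ S) {x : Lp ℂ 2 ν} (hx : x ∈ MM ν A) : x ∈ S := by
  refine closure_minimal ?_ hS hx
  rintro _ ⟨p, hp, rfl⟩
  exact h p hp

theorem MM_inv {p : C(X, ℂ)} (hp : p ∈ A) {x : Lp ℂ 2 ν} (hx : x ∈ MM ν A) : mulRep ν p x ∈ MM ν A := by
  refine MM_ind ν A (S := (mulRep ν p) ⁻¹' (MM ν A : Set _)) ((Submodule.isClosed_topologicalClosure _).preimage (mulRep ν p).continuous) ?_ hx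
  intro q hq
  change mulRep ν p (iot ν q) ∈ MM ν A
  rw [mulRep_iot]
  exact iot_mem ν A (A.mul_mem hp hq)

def PP : Lp ℂ 2 ν →L[ℂ] Lp ℂ 2 ν := (MM ν A).starProjection

theorem PP_idem : PP ν A * PP ν A = PP ν A := (MM ν A).isIdempotentElem_starProjection

theorem PP_iff {x : Lp ℂ 2 ν} : PP ν A x = x ↔ x ∈ MM ν A := Submodule.starProjection_eq_self_iff

def CA : Subalgebra ℂ C(X, ℂ) := CC (mulRep ν) (PP ν A) (PP_idem ν A)

theorem CA_closed : IsClosed (CA ν A : Set C(X, ℂ)) := CC_closed (mulRep_cont ν)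

theorem A_le_CA : A ≤ CA ν A := fun p hp => CC_inv (fun x hx => by
  rw [PP_iff] at *; exact MM_inv ν A hp hx)

theorem inner_iot (g : Lp ℂ 2 ν) (φ : C(X, ℂ)) : inner ℂ g (iot ν φ) = ∫ x, φ x * (starRingEnd ℂ) (g x) ∂ν := by
  rw [L2.inner_def]
  apply integral_congr_ae
  filter_upwards [iot_coe ν φ] with x hx
  rw [hx]; simp

theorem conj_mem_Un {g : Lp ℂ 2 ν} (hg : g ∈ (MM ν A)ᗮ) : (fun x => (starRingEnd ℂ) (g x)) ∈ Un ν A := by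
  constructor
  · have : Integrable g ν := (Lp.memLp g).integrable (by norm_num)
    have := (Complex.conjCLE : ℂ ≃L[ℝ] ℂ).toContinuousLinearMap.integrable_comp this
    exact this
  · intro p hp
    rw [← inner_iot]
    rw [Submodule.mem_orthogonal'] at hg
    exact hg _ (iot_mem ν A hp)

theorem hankel_fin {f : C(X, ℂ)} {w : ℂ} (hw : w ∉ range f) {m : ℕ} (hZ : Zr ν A f m w) {φ : C(X, ℂ)} (hφ : ∀ x, φ x = 1 / (f x - w)) :
    φ ∈ CA ν A := by
  change Cpt _
  set T : Lp ℂ 2 ν →L[ℂ] Lp ℂ 2 ν := (1 - PP ν A) * mulRep ν φ * PP ν A with hT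
  have hTp : ∀ p ∈ A, T (iot ν p) = iot ν (φ * p) - PP ν A (iot ν (φ * p)) := by
    intro p hp
    have : PP ν A (iot ν p) = iot ν p := (PP_iff ν A).2 (iot_mem ν A hp)
    rw [hT, mul_apply_eq_comp, this, mul_apply_eq_comp, mulRep_iot]
    simp
  have hperp : ∀ p ∈ A, T (iot ν p) ∈ (MM ν A)ᗮ := by
    intro p hp
    rw [hTp p hp]
    exact Submodule.sub_starProjection_mem_orthogonal _
  have hin : ∀ p ∈ A, ∀ g ∈ (MM ν A)ᗮ, inner ℂ g (T (iot ν p)) = KK ν f p (fun x => (starRingEnd ℂ) (g x)) w := by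
    intro p hp g hg
    have h0 : inner ℂ g (PP ν A (iot ν (φ * p))) = 0 :=
      (Submodule.mem_orthogonal' _ _).1 hg _ (Submodule.starProjection_apply_mem _ _)
    rw [hTp p hp, inner_sub_right, h0, sub_zero, inner_iot]
    unfold KK
    congr 1; ext x
    simp only [ContinuousMap.mul_apply, hφ]; ring
  let V : Submodule ℂ (Lp ℂ 2 ν) := (Subalgebra.toSubmodule A).map (T.comp (iot ν)).toLinearMap
  have hrank : Module.rank ℂ V ≤ m := by
    apply rank_le
    intro s hs
    by_contra hlt
    push Not at hlt
    obtain ⟨t, hts, htc⟩ := Finset.exists_subset_card_eq (n := m + 1) hlt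
    let e : Fin (m + 1) ≃ t := (Finset.equivFinOfCardEq htc).symm
    have hli : LinearIndependent ℂ (fun i : Fin (m + 1) => ((e i : V) : Lp ℂ 2 ν)) := by
      have h1 : LinearIndependent ℂ (fun i : Fin (m + 1) => (e i : V)) :=
        hs.comp (fun i => (⟨e i, hts (e i).2⟩ : s)) (by
          intro i j hij
          have := congrArg (fun z : s => (z : V)) hij
          exact e.injective (Subtype.ext this))
      exact h1.map' V.subtype (by simp)
    have hex : ∀ i, ∃ p ∈ A, T (iot ν p) = ((e i : V) : Lp ℂ 2 ν) := by
      intro i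
      obtain ⟨p, hp, hp'⟩ := (e i : V).2
      exact ⟨p, hp, hp'⟩
    choose p hpA hp using hex
    refine (Matrix.det_gram_ne_zero_iff_linearIndependent (𝕜 := ℂ)).2 hli ?_
    rw [← Matrix.det_transpose]
    have := hZ p (fun j => fun x => (starRingEnd ℂ) (T (iot ν (p j)) x)) hpA (fun j => conj_mem_Un ν A (hperp _ (hpA j)))
    rw [DD] at this
    rw [← this]
    congr 1
    ext i j
    rw [Matrix.transpose_apply, Matrix.gram_apply, Matrix.of_apply, ← hp, ← hp, hin _ (hpA i) _ (hperp _ (hpA j))]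
  have : FiniteDimensional ℂ V := Module.rank_lt_aleph0_iff.1 (hrank.trans_lt (Cardinal.natCast_lt_aleph0))
  refine finrank_cpt V fun x => ?_
  have hx : T x = T (PP ν A x) := by
    have h1 : T * PP ν A = T := by rw [hT, mul_assoc, PP_idem]
    rw [← mul_apply_eq_comp, h1]
  rw [hx]
  refine MM_ind ν A (S := T ⁻¹' (V : Set _)) (V.closed_of_finiteDimensional.preimage T.continuous) ?_ (Submodule.starProjection_apply_mem _ x : PP ν A x ∈ MM ν A)
  intro p hp
  exact ⟨p, hp, rfl⟩

end SA
end
end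

section
open Set Topology MeasureTheory Filter
noncomputable section
namespace SA
set_option linter.unusedSectionVars false

theorem polar_li {r : ℝ} (hr : 0 < r) : ∫⁻ w in Metric.ball (0:ℂ) r, ‖w‖ₑ⁻¹ ≤ ENNReal.ofReal (2 * Real.pi * r) := by
  rw [← lintegral_indicator measurableSet_ball, ← Complex.lintegral_comp_polarCoord_symm]
  calc _ ≤ ∫⁻ p in Complex.polarCoord.target, (Ioo (0:ℝ) r ×ˢ Ioo (-Real.pi) Real.pi).indicator 1 p := by
        apply setLIntegral_mono
        · exact (measurable_const.indicator (measurableSet_Ioo.prod measurableSet_Ioo))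
        · intro p hp
          obtain ⟨h1, h2⟩ := hp
          have h1 : 0 < p.1 := h1
          by_cases hb : Complex.polarCoord.symm p ∈ Metric.ball (0:ℂ) r
          · rw [indicator_of_mem hb]
            have hn : ‖Complex.polarCoord.symm p‖ₑ = ENNReal.ofReal p.1 := by
              rw [← ofReal_norm, Complex.norm_polarCoord_symm, abs_of_pos h1]
            have hlt : p.1 < r := by
              rw [mem_ball_zero_iff, Complex.norm_polarCoord_symm, abs_of_pos h1] at hb; exact hb
            rw [hn, indicator_of_mem (s := Ioo (0:ℝ) r ×ˢ Ioo (-Real.pi) Real.pi) ⟨⟨h1, hlt⟩, h2⟩, smul_eq_mul,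
              ENNReal.mul_inv_cancel (by simpa using h1) ENNReal.ofReal_ne_top]
            exact le_rfl
          · rw [indicator_of_notMem hb]; simp
    _ ≤ ∫⁻ p, (Ioo (0:ℝ) r ×ˢ Ioo (-Real.pi) Real.pi).indicator 1 p := setLIntegral_le_lintegral _ _
    _ = volume (Ioo (0:ℝ) r ×ˢ Ioo (-Real.pi) Real.pi) := lintegral_indicator_one (measurableSet_Ioo.prod measurableSet_Ioo)
    _ ≤ _ := by
      rw [Measure.volume_eq_prod, Measure.prod_prod, Real.volume_Ioo, Real.volume_Ioo, ← ENNReal.ofReal_mul (by linarith)]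
      apply le_of_eq; congr 1; ring

theorem cauchy_li (z : ℂ) {r : ℝ} (hr : 0 < r) {S : Set ℂ} (hS : MeasurableSet S) :
    ∫⁻ w in S, ‖z - w‖ₑ⁻¹ ≤ ENNReal.ofReal (2 * Real.pi * r) + volume S / ENNReal.ofReal r := by
  rw [← lintegral_inter_add_sdiff _ _ (measurableSet_ball : MeasurableSet (Metric.ball z r))]
  apply add_le_add
  · calc _ ≤ ∫⁻ w in Metric.ball z r, ‖z - w‖ₑ⁻¹ := lintegral_mono_set inter_subset_right
      _ = ∫⁻ w, (Metric.ball (0:ℂ) r).indicator (fun w => ‖w‖ₑ⁻¹) (z - w) := by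
        rw [← lintegral_indicator measurableSet_ball]
        congr 1; ext w
        by_cases h : w ∈ Metric.ball z r
        · rw [indicator_of_mem h, indicator_of_mem]
          rwa [mem_ball_zero_iff, ← dist_eq_norm, dist_comm]
        · rw [indicator_of_notMem h, indicator_of_notMem]
          rwa [mem_ball_zero_iff, ← dist_eq_norm, dist_comm]
      _ = ∫⁻ w, (Metric.ball (0:ℂ) r).indicator (fun w => ‖w‖ₑ⁻¹) w := lintegral_sub_left_eq_self _ z
      _ ≤ _ := by rw [lintegral_indicator measurableSet_ball]; exact polar_li hr
  · calc _ ≤ ∫⁻ w in S \ Metric.ball z r, (ENNReal.ofReal r)⁻¹ := by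
          apply setLIntegral_mono measurable_const
          intro w hw
          have : r ≤ ‖z - w‖ := by
            have := hw.2
            rw [Metric.mem_ball, dist_comm, dist_eq_norm] at this; linarith
          rw [← ofReal_norm]
          exact ENNReal.inv_le_inv.2 (ENNReal.ofReal_le_ofReal this)
      _ = (ENNReal.ofReal r)⁻¹ * volume (S \ Metric.ball z r) := by rw [setLIntegral_const]
      _ ≤ _ := by rw [mul_comm, ENNReal.div_eq_inv_mul, mul_comm]; gcongr; exact sdiff_subset

theorem cauchy_intg (z : ℂ) {S : Set ℂ} (hS : MeasurableSet S) (hfin : volume S ≠ ⊤) : IntegrableOn (fun w => (z - w)⁻¹) S := by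
  refine ⟨((measurable_const.sub measurable_id).inv).aestronglyMeasurable, ?_⟩
  rw [HasFiniteIntegral]
  calc ∫⁻ w in S, ‖(z - w)⁻¹‖ₑ ≤ ∫⁻ w in S, ‖z - w‖ₑ⁻¹ := by
        apply lintegral_mono; intro w
        by_cases h : z - w = 0
        · simp [h]
        · change ‖(z - w)⁻¹‖ₑ ≤ ‖z - w‖ₑ⁻¹; rw [enorm_inv h]
    _ ≤ _ := cauchy_li z one_pos hS
    _ < ⊤ := by
      simp only [ENNReal.ofReal_one, div_one]
      exact ENNReal.add_lt_top.2 ⟨ENNReal.ofReal_lt_top, hfin.lt_top⟩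

theorem circ_avg {ζ : ℂ} (hζ : ζ ≠ 0) {r : ℝ} (hr : 0 < r) (hne : r ≠ ‖ζ‖) :
    ∫ θ in Ioo (-Real.pi) Real.pi, (ζ - r * (Real.cos θ + Real.sin θ * Complex.I))⁻¹ = if r < ‖ζ‖ then 2 * Real.pi / ζ else 0 := by
  have e1 : ∫ θ in Ioo (-Real.pi) Real.pi, (ζ - r * (Real.cos θ + Real.sin θ * Complex.I))⁻¹
      = (2 * Real.pi) • Real.circleAverage (fun w => (ζ - w)⁻¹) 0 r := by
    rw [Real.circleAverage_eq_integral_add (-Real.pi), intervalIntegral.integral_comp_add_right (fun θ ↦ (ζ - circleMap 0 r θ)⁻¹),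
      smul_smul, mul_inv_cancel₀ Real.two_pi_pos.ne', one_smul, ← integral_Ioc_eq_integral_Ioo, ← intervalIntegral.integral_of_le (by linarith [Real.pi_pos])]
    have : 2 * Real.pi + -Real.pi = Real.pi := by ring
    rw [this, zero_add]
    congr 1; ext θ
    rw [circleMap, Complex.exp_mul_I]; simp
  rw [e1]
  split_ifs with h
  · have : Real.circleAverage (fun w => (ζ - w)⁻¹) 0 r = (ζ - 0)⁻¹ := by
      apply DiffContOnCl.circleAverage (f := fun w => (ζ - w)⁻¹)
      apply DifferentiableOn.diffContOnCl
      rw [abs_of_pos hr, closure_ball _ hr.ne']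
      intro w hw
      have : ζ - w ≠ 0 := by
        intro h0
        rw [mem_closedBall_zero_iff, ← sub_eq_zero.1 h0] at hw; linarith
      exact ((differentiableAt_const ζ).sub differentiableAt_id).inv this |>.differentiableWithinAt
    rw [this, sub_zero]
    simp [div_eq_mul_inv]
  · have hlt : ‖ζ‖ < r := lt_of_le_of_ne (not_lt.1 h) hne.symm
    have hz : ∀ w ∈ Metric.sphere (0:ℂ) |r|, w - ζ ≠ 0 := by
      intro w hw h0
      rw [mem_sphere_zero_iff_norm, sub_eq_zero.1 h0, abs_of_pos hr] at hw; linarith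
    have h1 : Real.circleAverage (fun w => ((w - 0) / (w - ζ)) • (1:ℂ)) 0 r = 1 := by
      apply DiffContOnCl.circleAverage_smul_div (f := fun _ => (1:ℂ)) diffContOnCl_const
      rw [mem_ball_zero_iff, abs_of_pos hr]; exact hlt
    have h2 : Real.circleAverage (fun w => (ζ - w)⁻¹) 0 r = Real.circleAverage (fun w => (-ζ⁻¹) • (((w - 0) / (w - ζ)) • (1:ℂ) - 1)) 0 r := by
      apply Real.circleAverage_congr_sphere
      intro w hw
      have h3 := hz w hw
      have h4 : ζ - w ≠ 0 := by rw [← neg_sub]; exact neg_ne_zero.2 h3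
      simp only [sub_zero, smul_eq_mul, mul_one]
      field_simp; ring
    rw [h2, Real.circleAverage_fun_smul, Real.circleAverage_fun_sub, h1, Real.circleAverage_const]
    · simp
    · apply ContinuousOn.circleIntegrable'
      simp only [sub_zero, smul_eq_mul, mul_one]
      exact continuousOn_id.div (by fun_prop) hz
    · exact circleIntegrable_const _ _ _

theorem disc_pot {ζ : ℂ} {ρ : ℝ} (hρ : 0 < ρ) : ζ * ∫ w in Metric.closedBall (0:ℂ) ρ, (ζ - w)⁻¹ = Real.pi * (min (‖ζ‖ ^ 2) (ρ ^ 2) : ℝ) := by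
  by_cases hζ : ζ = 0
  · simp [hζ]; positivity
  set F : ℂ → ℂ := (Metric.closedBall (0:ℂ) ρ).indicator fun w => (ζ - w)⁻¹ with hF
  have hFm : Measurable F := ((measurable_const.sub measurable_id).inv).indicator Metric.isClosed_closedBall.measurableSet
  have hFi : Integrable F := by
    rw [hF, integrable_indicator_iff Metric.isClosed_closedBall.measurableSet]
    exact cauchy_intg ζ Metric.isClosed_closedBall.measurableSet measure_closedBall_lt_top.ne
  have hcs : Continuous fun p : ℝ × ℝ => (p.1 : ℂ) * (Real.cos p.2 + Real.sin p.2 * Complex.I) := by fun_prop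
  have hps : ∀ p : ℝ × ℝ, Complex.polarCoord.symm p = (p.1 : ℂ) * (Real.cos p.2 + Real.sin p.2 * Complex.I) := fun p => Complex.polarCoord_symm_apply p
  have hGm : Measurable fun p : ℝ × ℝ => p.1 • F (Complex.polarCoord.symm p) := by
    simp_rw [hps]
    exact measurable_fst.smul (hFm.comp hcs.measurable)
  have hGi : IntegrableOn (fun p : ℝ × ℝ => p.1 • F (Complex.polarCoord.symm p)) (Ioi (0:ℝ) ×ˢ Ioo (-Real.pi) Real.pi) := by
    refine ⟨hGm.aestronglyMeasurable, ?_⟩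
    rw [HasFiniteIntegral]
    have := Complex.lintegral_comp_polarCoord_symm (fun w => ‖F w‖ₑ)
    have h2 : ∫⁻ p in (Ioi (0:ℝ) ×ˢ Ioo (-Real.pi) Real.pi), ‖p.1 • F (Complex.polarCoord.symm p)‖ₑ = ∫⁻ w, ‖F w‖ₑ := by
      rw [← this]
      apply setLIntegral_congr_fun (measurableSet_Ioi.prod measurableSet_Ioo)
      intro p hp
      change ‖p.1 • F (Complex.polarCoord.symm p)‖ₑ = ENNReal.ofReal p.1 • ‖F (Complex.polarCoord.symm p)‖ₑ
      have hp1 : 0 < p.1 := hp.1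
      rw [enorm_smul, smul_eq_mul, ← ofReal_norm p.1, Real.norm_of_nonneg hp1.le]
    rw [h2]
    exact hFi.2
  have e1 : ∫ w in Metric.closedBall (0:ℂ) ρ, (ζ - w)⁻¹ = ∫ w, F w := (integral_indicator Metric.isClosed_closedBall.measurableSet).symm
  rw [e1, ← Complex.integral_comp_polarCoord_symm, show polarCoord.target = Ioi (0:ℝ) ×ˢ Ioo (-Real.pi) Real.pi from rfl, Measure.volume_eq_prod, setIntegral_prod _ hGi]
  have e2 : ∫ r in Ioi (0:ℝ), ∫ θ in Ioo (-Real.pi) Real.pi, r • F (Complex.polarCoord.symm (r, θ)) = 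
      ∫ r in Ioi (0:ℝ), (Ioc 0 (min ‖ζ‖ ρ)).indicator (fun r => (r:ℂ) * (2 * Real.pi / ζ)) r := by
    apply setIntegral_congr_ae measurableSet_Ioi
    have : ∀ᵐ r : ℝ, r ≠ ‖ζ‖ := by
      rw [ae_iff]; simp
    filter_upwards [this] with r hr hr0
    have hr0 : 0 < r := hr0
    rw [integral_smul]
    by_cases hrρ : r ≤ ρ
    · have : ∀ θ, F (Complex.polarCoord.symm (r, θ)) = (ζ - r * (Real.cos θ + Real.sin θ * Complex.I))⁻¹ := by
        intro θ
        rw [hF, indicator_of_mem, hps]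
        rw [mem_closedBall_zero_iff, Complex.norm_polarCoord_symm, abs_of_pos hr0]; exact hrρ
      simp_rw [this]
      rw [circ_avg hζ hr0 hr]
      split_ifs with h
      · rw [indicator_of_mem (s := Ioc 0 (min ‖ζ‖ ρ)) ⟨hr0, le_min h.le hrρ⟩]; simp
      · rw [indicator_of_notMem]
        · simp
        · intro h'
          exact h (lt_of_le_of_ne (h'.2.trans (min_le_left _ _)) hr)
    · have : ∀ θ, F (Complex.polarCoord.symm (r, θ)) = 0 := by
        intro θ
        rw [hF, indicator_of_notMem]
        rw [mem_closedBall_zero_iff, Complex.norm_polarCoord_symm, abs_of_pos hr0]; exact hrρ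
      simp_rw [this]
      rw [indicator_of_notMem]
      · simp
      · intro h'
        exact hrρ (h'.2.trans (min_le_right _ _))
  have hm : 0 ≤ min ‖ζ‖ ρ := le_min (norm_nonneg _) hρ.le
  rw [e2, setIntegral_indicator measurableSet_Ioc, inter_eq_right.2 (Ioc_subset_Ioi_self), integral_mul_const, integral_complex_ofReal,
    ← intervalIntegral.integral_of_le hm, integral_id]
  have h3 : min (‖ζ‖ ^ 2) (ρ ^ 2) = (min ‖ζ‖ ρ) ^ 2 := by
    rcases le_total ‖ζ‖ ρ with h | h
    · rw [min_eq_left h, min_eq_left (by gcongr)]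
    · rw [min_eq_right h, min_eq_right (by gcongr)]
  rw [h3]
  push_cast
  field_simp
  simp


variable {X : Type*} [MetricSpace X] [CompactSpace X]

theorem int_mem_closed {E : Type*} [NormedAddCommGroup E] [NormedSpace ℝ E] [CompleteSpace E] (C : Submodule ℝ E) (hC : IsClosed (C : Set E)) {K : Set ℂ}
    (hK : volume K ≠ ⊤) (hKm : MeasurableSet K) {F : ℂ → E} (hF : IntegrableOn F K) (h : ∀ w ∈ K, F w ∈ C) : ∫ w in K, F w ∈ C := by
  by_cases h0 : volume K = 0
  · rw [Measure.restrict_eq_zero.2 h0, integral_zero_measure]; exact C.zero_mem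
  have := (Submodule.convex C : Convex ℝ (C : Set E)).set_average_mem hC h0 hK ((ae_restrict_mem hKm).mono fun w hw => h w hw) hF
  rw [setAverage_eq] at this
  have h2 := C.smul_mem (volume.real K) this
  rwa [smul_smul, mul_inv_cancel₀, one_smul] at h2
  rw [Measure.real, Ne, ENNReal.toReal_eq_zero_iff]
  tauto

theorem bump_mem {S : Subalgebra ℂ C(X, ℂ)} (hS : IsClosed (S : Set C(X, ℂ))) {f : C(X, ℂ)} (hf : f ∈ S) {ρ : ℝ} (hρ : 0 < ρ)
    (hnull : volume (Metric.closedBall (0:ℂ) ρ ∩ range f) = 0)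
    (hinv : ∀ w ∈ Metric.closedBall (0:ℂ) ρ, w ∉ range f → ∀ φ : C(X, ℂ), (∀ x, φ x = 1 / (f x - w)) → φ ∈ S)
    {g : C(X, ℂ)} (hg : ∀ x, g x = (min (‖f x‖ ^ 2) (ρ ^ 2) : ℝ)) : g ∈ S := by
  have hpi : (Real.pi : ℂ) ≠ 0 := by exact_mod_cast Real.pi_pos.ne'
  suffices h : (Real.pi : ℂ) • g ∈ S by
    have := S.smul_mem h (Real.pi : ℂ)⁻¹
    rwa [smul_smul, inv_mul_cancel₀ hpi, one_smul] at this
  change _ ∈ (S : Set C(X, ℂ))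
  rw [← hS.closure_eq, Metric.mem_closure_iff]
  intro ε hε
  obtain ⟨δ, hδ, hδε⟩ : ∃ δ > 0, ‖f‖ * δ < ε := ⟨ε / (‖f‖ + 1), by positivity, by
    rw [mul_div_assoc', div_lt_iff₀ (by positivity)]; nlinarith [norm_nonneg f]⟩
  obtain ⟨r, hr, hrδ⟩ : ∃ r > 0, 2 * Real.pi * r < δ / 2 := ⟨δ / (8 * Real.pi), by positivity, by
    have := Real.pi_pos; field_simp; norm_num⟩
  set D := Metric.closedBall (0:ℂ) ρ with hD
  have hDm : MeasurableSet D := Metric.isClosed_closedBall.measurableSet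
  have hDt : volume D < ⊤ := measure_closedBall_lt_top
  have hcl : IsClosed (range f) := (isCompact_range f.continuous).isClosed
  have hfm : IsFiniteMeasure (volume.restrict D) := ⟨by simpa using hDt⟩
  have hlim := tendsto_measure_thickening_of_isClosed (μ := volume.restrict D) (s := range f) ⟨1, one_pos, measure_ne_top _ _⟩ hcl
  rw [Measure.restrict_apply hcl.measurableSet, inter_comm, hnull] at hlim
  have hev : ∀ᶠ η in 𝓝[>] (0:ℝ), volume.restrict D (Metric.thickening η (range f)) < ENNReal.ofReal (δ / 2 * r) :=
    hlim.eventually (gt_mem_nhds (by simp; positivity))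
  obtain ⟨η, hη1, hη0⟩ := (hev.and self_mem_nhdsWithin).exists
  have hη0 : 0 < η := hη0
  set T := Metric.thickening η (range f) with hT
  have hTm : MeasurableSet T := Metric.isOpen_thickening.measurableSet
  rw [Measure.restrict_apply hTm] at hη1
  set K := D \ T with hK
  have hKm : MeasurableSet K := hDm.diff hTm
  have hKc : IsCompact K := (isCompact_closedBall 0 ρ).diff Metric.isOpen_thickening
  have hKr : ∀ w ∈ K, w ∉ range f := fun w hw hwr => hw.2 (Metric.self_subset_thickening hη0 _ hwr)
  let U : ℂ → C(X, ℂ) := fun w => f - algebraMap ℂ C(X, ℂ) w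
  have hUx : ∀ w x, U w x = f x - w := fun w x => by simp [U]
  have hUu : ∀ w ∈ K, IsUnit (U w) := by
    intro w hw
    rw [ContinuousMap.isUnit_iff_forall_ne_zero]
    intro x h0
    rw [hUx] at h0
    exact hKr w hw ⟨x, sub_eq_zero.1 h0⟩
  have hUc : Continuous U := continuous_const.sub (continuous_algebraMap ℂ C(X, ℂ))
  let F : ℂ → C(X, ℂ) := fun w => Ring.inverse (U w)
  have hFx : ∀ w ∈ K, ∀ x, F w x = 1 / (f x - w) := by
    intro w hw x
    have h1 := congrArg (fun φ : C(X, ℂ) => φ x) (Ring.inverse_mul_cancel (U w) (hUu w hw))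
    simp only [ContinuousMap.mul_apply, ContinuousMap.one_apply, hUx] at h1
    have h2 : f x - w ≠ 0 := fun h => by rw [h] at h1; simp at h1
    rw [eq_div_iff h2]; exact h1
  have hFc : ContinuousOn F K := by
    intro w hw
    obtain ⟨u, hu⟩ := hUu w hw
    have h1 : ContinuousAt Ring.inverse (U w) := hu ▸ NormedRing.inverse_continuousAt u
    exact (ContinuousAt.comp h1 hUc.continuousAt).continuousWithinAt
  have hFi : IntegrableOn F K := hFc.integrableOn_compact hKc
  have hKt : volume K ≠ ⊤ := hKc.measure_lt_top.ne
  have hmem : ∫ w in K, F w ∈ S := 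
    int_mem_closed ((Subalgebra.toSubmodule S).restrictScalars ℝ) hS hKt hKm hFi fun w hw => hinv w hw.1 (hKr w hw) _ (hFx w hw)
  refine ⟨f * ∫ w in K, F w, S.mul_mem hf hmem, ?_⟩
  rw [dist_eq_norm]
  refine lt_of_le_of_lt ?_ hδε
  rw [ContinuousMap.norm_le _ (by positivity)]
  intro x
  have hev : (∫ w in K, F w) x = ∫ w in K, (f x - w)⁻¹ := by
    have h1 := (ContinuousMap.evalCLM ℂ x).integral_comp_comm hFi
    have h2 : (∫ w in K, F w) x = ∫ w in K, F w x := h1.symm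
    rw [h2]
    apply setIntegral_congr_fun hKm
    intro w hw
    change F w x = _
    rw [hFx w hw, one_div]
  have hsplit : ∫ w in D, (f x - w)⁻¹ = (∫ w in D ∩ T, (f x - w)⁻¹) + ∫ w in K, (f x - w)⁻¹ := by
    rw [hK, ← setIntegral_union (disjoint_sdiff_right.mono_left inter_subset_right) hKm, inter_union_sdiff]
    · exact (cauchy_intg _ hDm hDt.ne).mono_set inter_subset_left
    · exact (cauchy_intg _ hDm hDt.ne).mono_set sdiff_subset
  have hbd : ‖∫ w in D ∩ T, (f x - w)⁻¹‖ ≤ δ := by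
    have h1 : ENNReal.ofReal ‖∫ w in D ∩ T, (f x - w)⁻¹‖ ≤ ENNReal.ofReal δ := by
      rw [ofReal_norm]
      calc _ ≤ ∫⁻ w in D ∩ T, ‖(f x - w)⁻¹‖ₑ := enorm_integral_le_lintegral_enorm _
        _ ≤ ∫⁻ w in D ∩ T, ‖f x - w‖ₑ⁻¹ := by
          apply lintegral_mono; intro w
          by_cases h : f x - w = 0
          · simp [h]
          · change ‖(f x - w)⁻¹‖ₑ ≤ ‖f x - w‖ₑ⁻¹; rw [enorm_inv h]
        _ ≤ _ := cauchy_li (f x) hr (hDm.inter hTm)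
        _ ≤ ENNReal.ofReal (δ / 2) + ENNReal.ofReal (δ / 2 * r) / ENNReal.ofReal r := by
          rw [inter_comm] at hη1
          gcongr
        _ = _ := by
          rw [← ENNReal.ofReal_div_of_pos hr, mul_div_cancel_right₀ _ hr.ne', ← ENNReal.ofReal_add (by positivity) (by positivity), add_halves]
    exact (ENNReal.ofReal_le_ofReal_iff hδ.le).1 h1
  have : ((Real.pi : ℂ) • g - f * ∫ w in K, F w) x = f x * ∫ w in D ∩ T, (f x - w)⁻¹ := by
    rw [ContinuousMap.sub_apply, ContinuousMap.smul_apply, ContinuousMap.mul_apply, hev, hg, smul_eq_mul, ← disc_pot hρ, ← hD, hsplit]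
    ring
  rw [this, norm_mul]
  gcongr
  exact f.norm_coe_le_norm x

end SA
end
end

section
open Set Topology MeasureTheory Filter
noncomputable section
namespace SA
set_option linter.unusedSectionVars false

theorem curve_null {c : ℝ → ℂ} {L : NNReal} (hc : LipschitzWith L c) : volume (range c) = 0 := by
  have hd : dimH (range c) ≤ 1 := by
    have := hc.dimH_range_le
    rwa [Real.dimH_univ] at this
  obtain ⟨K, hK⟩ : ∃ K : NNReal, LipschitzWith K (fun z : ℂ => (![z.re, z.im] : Fin 2 → ℝ)) := by
    refine ⟨1, LipschitzWith.of_dist_le_mul fun a b => ?_⟩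
    rw [dist_pi_le_iff (by positivity)]
    intro i
    rw [NNReal.coe_one, one_mul, Complex.dist_eq]
    fin_cases i
    · simpa [Real.dist_eq] using Complex.abs_re_le_norm (a - b)
    · simpa [Real.dist_eq] using Complex.abs_im_le_norm (a - b)
  have h2 : dimH ((fun z : ℂ => (![z.re, z.im] : Fin 2 → ℝ)) '' range c) ≤ 1 := (hK.dimH_image_le _).trans hd
  have h3 : volume ((fun z : ℂ => (![z.re, z.im] : Fin 2 → ℝ)) '' range c) = 0 := by
    rw [← hausdorffMeasure_pi_real]
    have := hausdorffMeasure_of_dimH_lt (s := (fun z : ℂ => (![z.re, z.im] : Fin 2 → ℝ)) '' range c) (d := 2) (lt_of_le_of_lt h2 (by norm_num))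
    simpa using this
  have h4 : range c ⊆ Complex.measurableEquivPi ⁻¹' ((fun z : ℂ => (![z.re, z.im] : Fin 2 → ℝ)) '' range c) := by
    intro z hz
    exact ⟨z, hz, by simp [Complex.measurableEquivPi_apply]⟩
  refine measure_mono_null h4 ?_
  rw [Complex.volume_preserving_equiv_pi.measure_preimage_equiv]
  exact h3

theorem sw_quot {X : Type*} [TopologicalSpace X] [CompactSpace X] {S : Subalgebra ℝ C(X, ℝ)} (hS : IsClosed (S : Set C(X, ℝ)))
    {h : C(X, ℝ)} (hh : ∀ x y, (∀ g ∈ S, g x = g y) → h x = h y) : h ∈ S := by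
  let e0 : X → (S → ℝ) := fun x g => g.1 x
  have he0 : Continuous e0 := continuous_pi fun g => g.1.continuous
  let e : C(X, range e0) := ⟨fun x => ⟨e0 x, x, rfl⟩, by fun_prop⟩
  have hs : Function.Surjective e := by rintro ⟨_, x, rfl⟩; exact ⟨x, rfl⟩
  have : CompactSpace (range e0) := isCompact_iff_compactSpace.1 (isCompact_range he0)
  have hq : IsQuotientMap e := IsQuotientMap.of_surjective_continuous hs e.continuous
  have key : ∀ h : C(X, ℝ), (∀ x y, (∀ g ∈ S, g x = g y) → h x = h y) → ∃ h' : C(range e0, ℝ), h'.comp e = h := by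
    intro h hh
    refine ⟨hq.lift h ?_, hq.lift_comp h _⟩
    intro x y hxy
    refine hh x y fun g hg => ?_
    exact congrFun (congrArg Subtype.val hxy) ⟨g, hg⟩
  let S' : Subalgebra ℝ C(range e0, ℝ) := S.comap (ContinuousMap.compRightAlgHom ℝ ℝ e)
  have hsep : S'.SeparatesPoints := by
    intro a b hab
    have : ∃ g : S, a.1 g ≠ b.1 g := by
      by_contra hcon
      push Not at hcon
      exact hab (Subtype.ext (funext hcon))
    obtain ⟨g, hg⟩ := this
    obtain ⟨g', hg'⟩ := key g.1 (fun x y hxy => hxy g.1 g.2)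
    refine ⟨g', ⟨g', ?_, rfl⟩, ?_⟩
    · change g'.comp e ∈ S
      rw [hg']; exact g.2
    · obtain ⟨x, rfl⟩ := hs a
      obtain ⟨y, rfl⟩ := hs b
      have h1 : ∀ x, g' (e x) = g.1 x := fun x => DFunLike.congr_fun hg' x
      rw [h1, h1]; exact hg
  obtain ⟨h', hh'⟩ := key h hh
  have hcl : h' ∈ S'.topologicalClosure := ContinuousMap.continuousMap_mem_subalgebra_closure_of_separatesPoints S' hsep h'
  have hS' : IsClosed (S' : Set C(range e0, ℝ)) := by
    have hc : Continuous (fun k : C(range e0, ℝ) => k.comp e) := ContinuousMap.continuous_precomp e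
    exact hS.preimage hc
  have : h' ∈ S' := by
    have h2 : h' ∈ closure (S' : Set C(range e0, ℝ)) := hcl
    rwa [hS'.closure_eq] at h2
  change h'.comp e ∈ S at this
  rwa [hh'] at this

section
variable {X : Type*} [MetricSpace X] [CompactSpace X] [MeasurableSpace X] [BorelSpace X]
variable {ν : Measure X} [IsFiniteMeasure ν] {A : Subalgebra ℂ C(X, ℂ)} 

theorem bump_CA (hA : ∀ p ∈ A, ∃ K : ℝ, ∀ x y, ‖p x - p y‖ ≤ K * dist x y)
    {γ : ℝ → X} {Λ : NNReal} (hγ : LipschitzWith Λ γ) {Y : Set X} (hcov : ∀ x, x ∉ Y → ∃ t ∈ Icc (0:ℝ) 1, γ t = x)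
    {f : C(X, ℂ)} (hf : f ∈ A) (hY : ∀ y ∈ Y, (f y).im ≤ 0) {c : ℂ} {ρ : ℝ} (hρ : 0 < ρ) (hρc : ρ < c.im)
    {g : C(X, ℂ)} (hg : ∀ x, g x = (min (‖f x - c‖ ^ 2) (ρ ^ 2) : ℝ)) : g ∈ CA ν A := by
  have hcov' : ∀ x, 0 < (f x).im → ∃ t ∈ Icc (0:ℝ) 1, γ t = x := fun x hx => hcov x fun h => by
    have := hY x h; linarith
  obtain ⟨K, hK⟩ := hA f hf
  have hc : LipschitzWith (K.toNNReal * Λ) (fun t => f (γ t)) := by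
    have : LipschitzWith K.toNNReal f := LipschitzWith.of_dist_le_mul fun x y => by
      rw [dist_eq_norm]
      refine (hK x y).trans ?_
      gcongr
      exact Real.le_coe_toNNReal K
    exact this.comp hγ
  have hNF := lemF (ν := ν) hf hA hγ hc hcov'
  have him : ∀ w ∈ Metric.closedBall (0:ℂ) ρ, 0 < (w + c).im := by
    intro w hw
    rw [mem_closedBall_zero_iff] at hw
    have := (abs_le.1 (Complex.abs_im_le_norm w)).1
    rw [Complex.add_im]; linarith
  refine bump_mem (f := f - algebraMap ℂ _ c) (CA_closed ν A) (A_le_CA ν A (A.sub_mem hf (A.algebraMap_mem c))) hρ ?_ ?_ hg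
  · have hsub : Metric.closedBall (0:ℂ) ρ ∩ range (f - algebraMap ℂ C(X, ℂ) c) ⊆ range (fun t => f (γ t) - c) := by
      rintro w ⟨hw, x, rfl⟩
      have h1 := him _ hw
      have h2 : (f - algebraMap ℂ C(X, ℂ) c) x = f x - c := rfl
      rw [h2, sub_add_cancel] at h1
      obtain ⟨t, -, rfl⟩ := hcov' x h1
      exact ⟨t, rfl⟩
    refine measure_mono_null hsub (curve_null (L := K.toNNReal * Λ) ?_)
    refine LipschitzWith.of_dist_le_mul fun s t => ?_
    rw [dist_sub_right]
    exact hc.dist_le_mul s t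
  · intro w hw hwr φ hφ
    have h1 : w + c ∉ range f := by
      rintro ⟨x, hx⟩
      exact hwr ⟨x, by change f x - c = w; rw [hx]; ring⟩
    have h2 : ∃ m, w + c ∈ Fi ν A f m := by
      by_contra hcon
      push Not at hcon
      have : w + c ∈ NF ν A f := ⟨him w hw, h1, hcon⟩
      rw [hNF] at this; exact this
    obtain ⟨m, hm⟩ := h2
    have h3 : Zr ν A f m (w + c) := Filter.Eventually.self_of_nhds hm
    refine hankel_fin ν A h1 h3 fun x => ?_
    rw [hφ]; change 1 / (f x - c - w) = _; congr 1; ring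

theorem vanish_CA (hA : ∀ p ∈ A, ∃ K : ℝ, ∀ x y, ‖p x - p y‖ ≤ K * dist x y)
    {γ : ℝ → X} {Λ : NNReal} (hγ : LipschitzWith Λ γ) {Y : Set X} (hcov : ∀ x, x ∉ Y → ∃ t ∈ Icc (0:ℝ) 1, γ t = x)
    (hsep : ∀ x, x ∉ Y → ∀ y, y ≠ x → ∃ f ∈ A, (∀ y ∈ Y, (f y).im ≤ 0) ∧ 0 < (f x).im ∧ f y ≠ f x)
    {h : C(X, ℂ)} (hh : ∀ y ∈ Y, h y = 0) : h ∈ CA ν A := by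
  let J : C(X, ℝ) →ₐ[ℝ] C(X, ℂ) := AlgHom.compLeftContinuous ℝ Complex.ofRealAm Complex.continuous_ofReal
  have hJ : ∀ g x, J g x = (g x : ℂ) := fun g x => rfl
  let S : Subalgebra ℝ C(X, ℝ) := ((CA ν A).restrictScalars ℝ).comap J
  have hmS : ∀ g, g ∈ S ↔ J g ∈ CA ν A := fun g => Iff.rfl
  have hJc : Continuous J := ContinuousMap.continuous_postcomp (⟨_, Complex.continuous_ofReal⟩ : C(ℝ, ℂ))
  have hS : IsClosed (S : Set C(X, ℝ)) := (CA_closed ν A).preimage hJc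
  have main : ∀ x y, x ∉ Y → (∀ g ∈ S, g x = g y) → x = y := by
    intro x y hx hg
    by_contra hne
    obtain ⟨f, hf, hfY, hfx, hfy⟩ := hsep x hx y (Ne.symm hne)
    have hd : 0 < ‖f y - f x‖ := norm_pos_iff.2 (sub_ne_zero.2 hfy)
    obtain ⟨ρ, hρ0, hρ⟩ := exists_between (lt_min hfx hd)
    obtain ⟨hρ1, hρ2⟩ := lt_min_iff.1 hρ
    let g : C(X, ℝ) := ⟨fun z => min (‖f z - f x‖ ^ 2) (ρ ^ 2), by fun_prop⟩
    have hgS : g ∈ S := (hmS g).2 (bump_CA hA hγ hcov hf hfY hρ0 hρ1 (c := f x) fun z => rfl)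
    have := hg g hgS
    change min (‖f x - f x‖ ^ 2) (ρ ^ 2) = min (‖f y - f x‖ ^ 2) (ρ ^ 2) at this
    rw [sub_self, norm_zero, min_eq_left (by simp; positivity), min_eq_right (by gcongr)] at this
    have : 0 < ρ ^ 2 := by positivity
    simp at *
    linarith
  have main2 : ∀ k : C(X, ℝ), (∀ y ∈ Y, k y = 0) → J k ∈ CA ν A := by
    intro k hk
    refine (hmS k).1 (sw_quot hS fun x y hxy => ?_)
    by_cases hx : x ∈ Y
    · by_cases hy : y ∈ Y
      · rw [hk x hx, hk y hy]
      · rw [main y x hy fun g hg => (hxy g hg).symm]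
    · rw [main x y hx hxy]
  have e : h = J ⟨fun x => (h x).re, by fun_prop⟩ + Complex.I • J ⟨fun x => (h x).im, by fun_prop⟩ := by
    ext x
    change h x = ((h x).re : ℂ) + Complex.I * ((h x).im : ℂ)
    rw [mul_comm, Complex.re_add_im]
  rw [e]
  refine (CA ν A).add_mem (main2 _ fun y hy => ?_) ((CA ν A).smul_mem (main2 _ fun y hy => ?_) _)
  · change (h y).re = 0; rw [hh y hy]; rfl
  · change (h y).im = 0; rw [hh y hy]; rfl
end
end SA
end
end

section
open Set Topology MeasureTheory Filter
noncomputable section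
namespace SA
set_option linter.unusedSectionVars false

section abs
variable {H : Type*} [NormedAddCommGroup H] [NormedSpace ℂ H] [CompleteSpace H]
  {B : Type*} [NormedCommRing B] [NormedAlgebra ℂ B]

/-- compressed multiplication operators -/
def tau (ρ : B →ₐ[ℂ] (H →L[ℂ] H)) (P : H →L[ℂ] H) (φ : B) : H →L[ℂ] H := P * ρ φ * P + (1 - P)

theorem tau_mul {ρ : B →ₐ[ℂ] (H →L[ℂ] H)} {P : H →L[ℂ] H} (hP : P * P = P) (φ ψ : B) :
    tau ρ P (φ * ψ) = tau ρ P φ * tau ρ P ψ + P * ρ φ * ((1 - P) * ρ ψ * P) := by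
  have h1 : ∀ S : H →L[ℂ] H, P * (P * S) = P * S := fun S => by rw [← mul_assoc, hP]
  simp only [tau, map_mul, mul_add, add_mul, mul_sub, sub_mul, mul_assoc, h1, hP, mul_one, one_mul]
  noncomm_ring

theorem tau_pow {ρ : B →ₐ[ℂ] (H →L[ℂ] H)} {P : H →L[ℂ] H} (hP : P * P = P) {v : B} (hv : v ∈ CC ρ P hP) (n : ℕ) :
    ∃ K, Cpt K ∧ tau ρ P (v ^ n) = tau ρ P v ^ n + K := by
  induction n with
  | zero => 
    refine ⟨0, cpt_zero, ?_⟩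
    simp [tau, hP]
  | succ n ih =>
    obtain ⟨K, hK, e⟩ := ih
    refine ⟨K * tau ρ P v + P * ρ (v ^ n) * ((1 - P) * ρ v * P), cpt_add (cpt_mul_right hK) (cpt_mul_left hv), ?_⟩
    rw [pow_succ, tau_mul hP, e, pow_succ]
    noncomm_ring

theorem unit_of_near {T : H →L[ℂ] H} (h : ‖T - 1‖ < 1) : IsUnit T := by
  have := (Units.oneSub (1 - T) (by rwa [norm_sub_rev])).isUnit
  simpa using this

/-- Fredholm alternative for unit + compact -/
theorem fred {W K : H →L[ℂ] H} (hW : IsUnit W) (hK : Cpt K) (hinj : ∀ x, (W + K) x = 0 → x = 0) : Function.Surjective (W + K) := by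
  obtain ⟨u, rfl⟩ := hW
  let T : H →L[ℂ] H := -((↑u⁻¹ : H →L[ℂ] H) * K)
  have hT : IsCompactOperator T := (cpt_mul_left (T := (↑u⁻¹ : H →L[ℂ] H)) hK).neg
  have e : (u : H →L[ℂ] H) + K = u * (1 - T) := by
    simp only [T, sub_neg_eq_add, mul_add, mul_one, Units.mul_inv_cancel_left]
  rcases hT.hasEigenvalue_or_mem_resolventSet (μ := (1:ℂ)) one_ne_zero with h | h
  · exfalso
    obtain ⟨x, hx⟩ := h.exists_hasEigenvector
    refine hx.2 (hinj x ?_)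
    have h1 : T x = x := by simpa using hx.apply_eq_smul
    rw [e, mul_apply_eq_comp]
    change (u : H →L[ℂ] H) (x - T x) = 0
    rw [h1, sub_self, map_zero]
  · rw [spectrum.mem_resolventSet_iff, map_one] at h
    obtain ⟨u2, hu2⟩ := h
    rw [e, ← hu2]
    intro y
    refine ⟨(↑(u * u2)⁻¹ : H →L[ℂ] H) y, ?_⟩
    rw [← Units.val_mul, ← mul_apply_eq_comp, Units.mul_inv]
    rfl

theorem toep_surj {ρ : B →ₐ[ℂ] (H →L[ℂ] H)} {P : H →L[ℂ] H} (hP : P * P = P) {v f0 φ k : B} {n : ℕ} (hv : v ∈ CC ρ P hP)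
    (hinv : ∀ x, P x = x → P (ρ f0 x) = ρ f0 x) (h1 : φ * f0 = v ^ n) (hk : k * f0 = 1)
    (hv1 : IsUnit (tau ρ P v)) (hφ : IsUnit (tau ρ P φ)) {y : H} (hy : P y = y) : ∃ x, P x = x ∧ ρ f0 x = y := by
  have hPP : ∀ x, P (P x) = P x := fun x => by rw [← mul_apply_eq_comp, hP]
  obtain ⟨K, hK, e⟩ := tau_pow hP hv n
  have hz : (1 - P) * ρ f0 * P = 0 := by
    ext x
    have := hinv (P x) (hPP x)
    simp [this]
  have e2 : tau ρ P φ * tau ρ P f0 = tau ρ P v ^ n + K := by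
    rw [← e, ← h1, tau_mul hP, hz, mul_zero, add_zero]
  have hap : ∀ x, tau ρ P f0 x = ρ f0 (P x) + (x - P x) := by
    intro x
    change P (ρ f0 (P x)) + (x - P x) = _
    rw [hinv _ (hPP x)]
  have hinj : ∀ x, (tau ρ P v ^ n + K) x = 0 → x = 0 := by
    intro x hx
    rw [← e2, mul_apply_eq_comp] at hx
    obtain ⟨u, hu⟩ := hφ
    have h3 : tau ρ P f0 x = 0 := by
      rw [← hu] at hx
      have := congrArg (↑u⁻¹ : H →L[ℂ] H) hx
      rw [← mul_apply_eq_comp, Units.inv_mul, map_zero] at this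
      exact this
    rw [hap] at h3
    have h4 : ρ f0 (P x) = 0 := by
      have := congrArg P h3
      rw [map_add, hinv _ (hPP x), map_sub, hPP, sub_self, add_zero, map_zero] at this
      exact this
    have h5 : P x = 0 := by
      have := congrArg (ρ k) h4
      rw [← mul_apply_eq_comp, ← map_mul, hk, map_one, map_zero] at this
      exact this
    rw [h5, map_zero, zero_add, sub_zero] at h3
    exact h3
  obtain ⟨x, hx⟩ := fred (hv1.pow n) hK hinj (tau ρ P φ y)
  rw [← e2, mul_apply_eq_comp] at hx
  have hx2 : tau ρ P f0 x = y := by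
    obtain ⟨u, hu⟩ := hφ
    rw [← hu] at hx
    have := congrArg (↑u⁻¹ : H →L[ℂ] H) hx
    rw [← mul_apply_eq_comp (↑u⁻¹ : H →L[ℂ] H), ← mul_apply_eq_comp (↑u⁻¹ : H →L[ℂ] H), Units.inv_mul] at this
    exact this
  refine ⟨P x, hPP x, ?_⟩
  rw [hap] at hx2
  have := congrArg P hx2
  rw [map_add, hinv _ (hPP x), map_sub, hPP, sub_self, add_zero, hy] at this
  exact this
end abs

section
variable {X : Type*} [MetricSpace X] [CompactSpace X] [MeasurableSpace X] [BorelSpace X]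
variable {B : Type*} [CommRing B] [Algebra ℂ B]

theorem rep_char [Nonempty X] (Φ : B →ₐ[ℂ] C(X, ℂ)) (ev : B →ₐ[ℂ] ℂ) (hev : ∀ b, ‖ev b‖ ≤ ‖Φ b‖) :
    ∃ ν : Measure X, IsFiniteMeasure ν ∧ ∀ b, ∫ x, Φ b x ∂ν = ev b := by
  let reC : C(X, ℂ) →ₗ[ℝ] C(X, ℝ) := 
    { toFun := fun p => ⟨fun x => (p x).re, by fun_prop⟩
      map_add' := fun p q => by ext x; simp
      map_smul' := fun c p => by ext x; simp }
  let R : Submodule ℝ (C(X, ℝ) × ℝ) := 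
    { carrier := {p | ∃ b : B, (reC (Φ b), (ev b).re) = p}
      add_mem' := by
        rintro _ _ ⟨b, rfl⟩ ⟨c, rfl⟩
        exact ⟨b + c, by simp⟩
      zero_mem' := ⟨0, by simp⟩
      smul_mem' := by
        rintro r _ ⟨b, rfl⟩
        refine ⟨(r : ℂ) • b, ?_⟩
        rw [map_smul Φ, map_smul ev]
        ext x
        · change ((r : ℂ) * Φ b x).re = r * (Φ b x).re
          simp
        · change ((r : ℂ) * ev b).re = r * (ev b).re
          simp }
  have hpos : ∀ p ∈ R, 0 ≤ p.1 → 0 ≤ p.2 := by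
    rintro _ ⟨b, rfl⟩ hb
    change 0 ≤ (ev b).re
    have hb : ∀ x, 0 ≤ (Φ b x).re := fun x => hb x
    by_contra hneg
    push Not at hneg
    set a := -(ev b).re with ha
    have ha0 : 0 < a := by linarith
    have key : ∀ r : ℝ, 0 < r → 2 * r * a ≤ ‖Φ b‖ ^ 2 := by
      intro r hr
      have h1 : ‖Φ (b - algebraMap ℂ B r)‖ ≤ √(‖Φ b‖ ^ 2 + r ^ 2) := by
        rw [ContinuousMap.norm_le _ (Real.sqrt_nonneg _)]
        intro x
        apply Real.le_sqrt_of_sq_le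
        have h2 : Φ (b - algebraMap ℂ B r) x = Φ b x - r := by
          rw [map_sub, AlgHom.commutes]; rfl
        have h3 : ‖Φ b x‖ ^ 2 ≤ ‖Φ b‖ ^ 2 := by gcongr; exact ContinuousMap.norm_coe_le_norm _ x
        rw [Complex.sq_norm, Complex.normSq_apply] at h3
        rw [h2, Complex.sq_norm, Complex.normSq_apply]
        simp only [Complex.sub_re, Complex.sub_im, Complex.ofReal_re, Complex.ofReal_im]
        nlinarith [mul_nonneg hr.le (hb x)]
      have h4 := (hev (b - algebraMap ℂ B r)).trans h1
      have h5 : ev (b - algebraMap ℂ B r) = ev b - r := by rw [map_sub, AlgHom.commutes]; rfl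
      have h6 : a + r ≤ ‖ev (b - algebraMap ℂ B r)‖ := by
        have := (abs_le.1 (Complex.abs_re_le_norm (ev (b - algebraMap ℂ B r)))).1
        rw [h5, Complex.sub_re, Complex.ofReal_re] at this
        rw [h5]; linarith
      have h7 : (a + r) ^ 2 ≤ ‖Φ b‖ ^ 2 + r ^ 2 := by
        rw [← Real.sq_sqrt (show 0 ≤ ‖Φ b‖ ^ 2 + r ^ 2 by positivity)]
        gcongr
        exact h6.trans h4
      nlinarith
    have h8 := key ((‖Φ b‖ ^ 2 + 1) / a) (by positivity)
    have : 2 * ((‖Φ b‖ ^ 2 + 1) / a) * a = 2 * (‖Φ b‖ ^ 2 + 1) := by field_simp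
    nlinarith [sq_nonneg ‖Φ b‖]
  obtain ⟨ν, hν, h, -⟩ := rep_measure R ⟨1, by rw [map_one Φ, map_one ev]; ext x <;> simp [reC]⟩ hpos 0 0 (fun p hp h => hpos p hp h)
  refine ⟨ν, hν, fun b => ?_⟩
  have h1 : ∀ b, ∫ x, (Φ b x).re ∂ν = (ev b).re := fun b => h _ ⟨b, rfl⟩
  have hintg : ∀ b, Integrable (Φ b) ν := fun b => (Φ b).continuous.integrable_of_hasCompactSupport (HasCompactSupport.of_compactSpace _)
  apply Complex.ext
  · rw [← h1]
    exact (integral_re (hintg b)).symm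
  · have h2 := h1 (-(Complex.I • b))
    have h3 : ∀ x, (Φ (-(Complex.I • b)) x).re = (Φ b x).im := by
      intro x
      rw [map_neg, map_smul]
      change (-(Complex.I * Φ b x)).re = _
      simp
    simp only [h3] at h2
    have h4 : (ev (-(Complex.I • b))).re = (ev b).im := by
      rw [map_neg, map_smul, smul_eq_mul]
      simp
    rw [h4] at h2
    rw [← h2]
    exact (integral_im (hintg b)).symm

theorem core [Nonempty X] (Φ : B →ₐ[ℂ] C(X, ℂ)) (ev : B →ₐ[ℂ] ℂ) (hev : ∀ b, ‖ev b‖ ≤ ‖Φ b‖) 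
    (hA : ∀ p ∈ Φ.range, ∃ K : ℝ, ∀ x y, ‖p x - p y‖ ≤ K * dist x y)
    {γ : ℝ → X} {Λ : NNReal} (hγ : LipschitzWith Λ γ) {Y : Set X} (hcov : ∀ x, x ∉ Y → ∃ t ∈ Icc (0:ℝ) 1, γ t = x)
    (hsep : ∀ x, x ∉ Y → ∀ y, y ≠ x → ∃ f ∈ Φ.range, (∀ y ∈ Y, (f y).im ≤ 0) ∧ 0 < (f x).im ∧ f y ≠ f x)
    {b0 : B} (hb0 : ev b0 = 0) (hne : ∀ x, Φ b0 x ≠ 0) {g : C(X, ℂ)} (hg : ∀ y ∈ Y, g y = 0)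
    (hgf : ∀ x, ‖Complex.exp (g x) / Φ b0 x - 1‖ < 1) : False := by
  obtain ⟨ν, hν, hrep⟩ := rep_char Φ ev hev
  set A := Φ.range with hAdef
  have hf0 : Φ b0 ∈ A := ⟨b0, rfl⟩
  set f0 := Φ b0 with hf0d
  have hP1 : ‖PP ν A‖ ≤ 1 := (MM ν A).starProjection_norm_le
  have htau : ∀ φ : C(X, ℂ), ‖φ - 1‖ < 1 → IsUnit (tau (mulRep ν) (PP ν A) φ) := by
    intro φ hφ
    apply unit_of_near
    have e : tau (mulRep ν) (PP ν A) φ - 1 = PP ν A * mulRep ν (φ - 1) * PP ν A := by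
      rw [tau, map_sub, map_one, mul_sub, sub_mul, mul_one, PP_idem]; abel
    rw [e]
    calc _ ≤ ‖PP ν A‖ * ‖mulRep ν (φ - 1)‖ * ‖PP ν A‖ := (norm_mul_le _ _).trans (by gcongr; exact norm_mul_le _ _)
      _ ≤ 1 * ‖φ - 1‖ * 1 := by gcongr; exact mulRep_norm ν _
      _ < 1 := by linarith
  -- root
  obtain ⟨n, hn0, hn⟩ : ∃ n : ℕ, 0 < n ∧ ∀ x, ‖Complex.exp (g x / n) - 1‖ < 1 := by
    obtain ⟨n, hn⟩ := exists_nat_gt (2 * ‖g‖ + 1)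
    have hn1 : (0:ℝ) < n := by have := norm_nonneg g; linarith
    refine ⟨n, by exact_mod_cast hn1, fun x => ?_⟩
    have h1 : ‖g x / n‖ < 1 / 2 := by
      rw [norm_div, Complex.norm_natCast, div_lt_iff₀ hn1]
      have := g.norm_coe_le_norm x
      linarith
    have := Complex.norm_exp_sub_one_le (x := g x / n) (by linarith)
    linarith
  let v : C(X, ℂ) := ⟨fun x => Complex.exp (g x / n), by fun_prop⟩
  let φ : C(X, ℂ) := ⟨fun x => Complex.exp (g x) / f0 x, Continuous.div (by fun_prop) (by fun_prop) hne⟩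
  let k : C(X, ℂ) := ⟨fun x => 1 / f0 x, Continuous.div (by fun_prop) (by fun_prop) hne⟩
  have hvCA : v ∈ CA ν A := by
    have h1 : v - 1 ∈ CA ν A := by
      refine vanish_CA hA hγ hcov hsep fun y hy => ?_
      change Complex.exp (g y / n) - 1 = 0
      rw [hg y hy]; simp
    have := (CA ν A).add_mem h1 (CA ν A).one_mem
    rwa [sub_add_cancel] at this
  have hinv : ∀ x, PP ν A x = x → PP ν A (mulRep ν f0 x) = mulRep ν f0 x := by
    intro x hx
    rw [PP_iff] at hx ⊢
    exact MM_inv ν A hf0 hx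
  have e1 : φ * f0 = v ^ n := by
    ext x
    change Complex.exp (g x) / f0 x * f0 x = Complex.exp (g x / n) ^ n
    rw [div_mul_cancel₀ _ (hne x), ← Complex.exp_nat_mul, mul_div_cancel₀]
    exact_mod_cast hn0.ne'
  have e2 : k * f0 = 1 := by
    ext x
    change 1 / f0 x * f0 x = 1
    rw [div_mul_cancel₀ _ (hne x)]
  have hlt : ∀ ψ : C(X, ℂ), (∀ x, ‖ψ x - 1‖ < 1) → ‖ψ - 1‖ < 1 := fun ψ h => (ContinuousMap.norm_lt_iff _ one_pos).2 h
  have hy : PP ν A (iot ν 1) = iot ν 1 := (PP_iff ν A).2 (iot_mem ν A A.one_mem)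
  obtain ⟨x, hx, hxy⟩ := toep_surj (PP_idem ν A) hvCA hinv e1 e2 (htau v (hlt v hn)) (htau φ (hlt φ hgf)) hy
  have hz : ∀ y ∈ MM ν A, inner ℂ (iot ν 1) (mulRep ν f0 y) = 0 := by
    intro y hy
    refine MM_ind ν A (S := {y | inner ℂ (iot ν 1) (mulRep ν f0 y) = 0}) ?_ ?_ hy
    · exact isClosed_eq (by fun_prop) continuous_const
    · rintro _ ⟨b, rfl⟩
      change inner ℂ (iot ν 1) (mulRep ν f0 (iot ν (Φ b))) = 0
      rw [mulRep_iot, inner_iot, hf0d, ← map_mul]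
      have : ∫ x, Φ (b0 * b) x * (starRingEnd ℂ) (iot ν 1 x) ∂ν = ∫ x, Φ (b0 * b) x ∂ν := by
        refine integral_congr_ae ?_
        filter_upwards [iot_coe ν 1] with x hx
        rw [hx]; simp
      rw [this, hrep, map_mul, hb0, zero_mul]
  have h1 := hz x ((PP_iff ν A).1 hx)
  rw [hxy, inner_iot] at h1
  have h2 : ∫ x, (1 : C(X, ℂ)) x * (starRingEnd ℂ) (iot ν 1 x) ∂ν = ∫ x, Φ 1 x ∂ν := by
    refine integral_congr_ae ?_
    filter_upwards [iot_coe ν 1] with x hx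
    rw [hx]; simp
  rw [h2, hrep, map_one] at h1
  exact one_ne_zero h1
end
end SA
end
end

section
open Set Topology MeasureTheory Filter
noncomputable section
namespace SA
set_option linter.unusedSectionVars false

theorem lip_param {E : Type*} [PseudoMetricSpace E] {γ : ℝ → E} (hcont : ContinuousOn γ (Icc 0 1)) (hBV : BoundedVariationOn γ (Icc 0 1)) :
    ∃ (β : ℝ → E) (Λ : NNReal), LipschitzWith Λ β ∧ (∀ s, β s ∈ γ '' Icc 0 1) ∧ ∀ x ∈ γ '' Icc 0 1, ∃ s ∈ Icc (0:ℝ) 1, β s = x := by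
  have h0 : (0:ℝ) ∈ Icc (0:ℝ) 1 := ⟨le_rfl, zero_le_one⟩
  have h1 : (1:ℝ) ∈ Icc (0:ℝ) 1 := ⟨zero_le_one, le_rfl⟩
  let σ : ℝ → ℝ := fun t => t + variationOnFromTo γ (Icc 0 1) 0 t
  have hσ0 : σ 0 = 0 := by simp [σ, variationOnFromTo.self]
  have hvd : ∀ t ∈ Icc (0:ℝ) 1, ∀ t' ∈ Icc (0:ℝ) 1, t ≤ t' → dist (γ t) (γ t') + (t' - t) ≤ σ t' - σ t := by
    intro t ht t' ht' htt
    have e : variationOnFromTo γ (Icc 0 1) 0 t + variationOnFromTo γ (Icc 0 1) t t' = variationOnFromTo γ (Icc 0 1) 0 t' :=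
      variationOnFromTo.add hBV.locallyBoundedVariationOn h0 ht ht'
    have h2 : dist (γ t) (γ t') ≤ variationOnFromTo γ (Icc 0 1) t t' := by
      rw [variationOnFromTo.eq_of_le _ _ htt, dist_edist]
      apply ENNReal.toReal_mono
      · exact hBV.locallyBoundedVariationOn t t' ht ht'
      · exact eVariationOn.edist_le _ ⟨ht, le_rfl, htt⟩ ⟨ht', htt, le_rfl⟩
    simp only [σ]
    linarith
  have hmono : ∀ t ∈ Icc (0:ℝ) 1, ∀ t' ∈ Icc (0:ℝ) 1, t ≤ t' → t' - t ≤ σ t' - σ t := by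
    intro t ht t' ht' htt
    have := hvd t ht t' ht' htt
    have := dist_nonneg (x := γ t) (y := γ t')
    linarith
  let S : ℝ → Set ℝ := fun s => {t | t ∈ Icc (0:ℝ) 1 ∧ σ t ≤ s}
  let θ : ℝ → ℝ := fun s => sSup (S s)
  have hbdd : ∀ s, BddAbove (S s) := fun s => ⟨1, fun t ht => ht.1.2⟩
  have hmem0 : ∀ s, 0 ≤ s → (0:ℝ) ∈ S s := fun s hs => ⟨h0, by rw [hσ0]; exact hs⟩
  have hθI : ∀ s, 0 ≤ s → θ s ∈ Icc (0:ℝ) 1 := fun s hs => 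
    ⟨le_csSup (hbdd s) (hmem0 s hs), csSup_le ⟨0, hmem0 s hs⟩ fun t ht => ht.1.2⟩
  have hθσ : ∀ t ∈ Icc (0:ℝ) 1, θ (σ t) = t := by
    intro t ht
    apply IsGreatest.csSup_eq
    refine ⟨⟨ht, le_rfl⟩, fun t' ht' => ?_⟩
    by_contra hlt
    push Not at hlt
    have := hmono t ht t' ht'.1 hlt.le
    have := ht'.2
    linarith
  have hlip : ∀ s s', 0 ≤ s → s ≤ s' → dist (γ (θ s)) (γ (θ s')) ≤ s' - s := by
    intro s s' hs hss
    have hs' := hs.trans hss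
    have hab : θ s ≤ θ s' := csSup_le_csSup (hbdd s') ⟨0, hmem0 s hs⟩ fun t ht => ⟨ht.1, ht.2.trans hss⟩
    rcases hab.eq_or_lt with hab | hab
    · rw [hab, dist_self]; linarith
    apply le_of_forall_pos_le_add
    intro ε hε
    obtain ⟨δ1, hδ1, H1⟩ := Metric.continuousWithinAt_iff.1 (hcont _ (hθI s hs)) (ε / 2) (by positivity)
    obtain ⟨δ2, hδ2, H2⟩ := Metric.continuousWithinAt_iff.1 (hcont _ (hθI s' hs')) (ε / 2) (by positivity)
    have ha := hθI s hs
    have hb := hθI s' hs'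
    obtain ⟨t', ht'1, ht'2⟩ := exists_between (show θ s < min (θ s + δ1) ((θ s + θ s') / 2) from lt_min (by linarith) (by linarith))
    obtain ⟨ht'2, ht'3⟩ := lt_min_iff.1 ht'2
    obtain ⟨t, htS, ht⟩ := exists_lt_of_lt_csSup ⟨0, hmem0 s' hs'⟩ (show max (θ s' - δ2) ((θ s + θ s') / 2) < sSup (S s') from max_lt (by change _ < θ s'; linarith) (by change _ < θ s'; linarith))
    obtain ⟨ht1, ht2⟩ := max_lt_iff.1 ht
    have htb : t ≤ θ s' := le_csSup (hbdd s') htS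
    have ht'I : t' ∈ Icc (0:ℝ) 1 := ⟨by linarith [ha.1], by linarith [hb.2]⟩
    have hσt' : s < σ t' := by
      by_contra hcon
      push Not at hcon
      have : t' ≤ θ s := le_csSup (hbdd s) ⟨ht'I, hcon⟩
      linarith
    have d1 := H1 ht'I (by rw [Real.dist_eq, abs_lt]; constructor <;> linarith)
    have d2 := H2 htS.1 (by rw [Real.dist_eq, abs_lt]; constructor <;> linarith)
    have d3 := hvd t' ht'I t htS.1 (by linarith)
    have d4 := htS.2
    have d5 := dist_triangle4 (γ (θ s)) (γ t') (γ t) (γ (θ s'))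
    rw [dist_comm] at d1
    linarith
  have hV : 0 < σ 1 := by have := hmono 0 h0 1 h1 zero_le_one; linarith
  refine ⟨fun s => γ (θ (max 0 (σ 1 * s))), (σ 1).toNNReal, ?_, fun s => ⟨_, hθI _ (le_max_left _ _), rfl⟩, ?_⟩
  · have key : ∀ s s', s ≤ s' → dist (γ (θ (max 0 (σ 1 * s)))) (γ (θ (max 0 (σ 1 * s')))) ≤ σ 1 * (s' - s) := by
      intro s s' hss
      have h3 : σ 1 * s ≤ σ 1 * s' := by gcongr
      refine (hlip _ _ (le_max_left _ _) (max_le_max_left 0 h3)).trans ?_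
      have := max_sub_max_le_max 0 (σ 1 * s') 0 (σ 1 * s)
      rw [sub_zero, max_eq_right (a := (0:ℝ)) (b := σ 1 * s' - σ 1 * s) (by linarith)] at this
      linarith
    refine LipschitzWith.of_dist_le_mul fun s s' => ?_
    rw [Real.coe_toNNReal _ hV.le]
    rcases le_total s s' with h | h
    · refine (key s s' h).trans (le_of_eq ?_)
      rw [Real.dist_eq, abs_sub_comm, abs_of_nonneg (by linarith)]
    · rw [dist_comm]
      refine (key s' s h).trans (le_of_eq ?_)
      rw [Real.dist_eq, abs_of_nonneg (by linarith)]
  · rintro _ ⟨t, ht, rfl⟩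
    have h3 := hmono 0 h0 t ht ht.1
    have h4 := hmono t ht 1 h1 ht.2
    refine ⟨σ t / σ 1, ⟨div_nonneg (by linarith [ht.1]) hV.le, (div_le_one hV).2 (by linarith [ht.2])⟩, ?_⟩
    change γ (θ (max 0 (σ 1 * (σ t / σ 1)))) = γ t
    rw [mul_div_cancel₀ _ hV.ne', max_eq_right (by linarith [ht.1]), hθσ t ht]

theorem path_log {c : ℝ → ℂ} (hc : ContinuousOn c (Icc 0 1)) (h0 : ∀ t ∈ Icc (0:ℝ) 1, c t ≠ 0) :
    ∃ G : ℝ → ℂ, Continuous G ∧ G 0 = 0 ∧ ∀ t ∈ Icc (0:ℝ) 1, c t = c 0 * Complex.exp (G t) := by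
  have hI : (0:ℝ) ≤ 1 := zero_le_one
  let g : ℝ → ℂ := IccExtend hI ((Icc (0:ℝ) 1).domRestrict c)
  have hg : Continuous g := Continuous.Icc_extend' (continuousOn_iff_continuous_domRestrict.1 hc)
  have hg0 : ∀ t, g t ≠ 0 := fun t => h0 _ (projIcc 0 1 hI t).2
  have hgt : ∀ t ∈ Icc (0:ℝ) 1, g t = c t := fun t ht => by
    simp only [g]; rw [IccExtend_of_mem hI _ ht]; rfl
  have hsc : IsSimplyConnected (univ : Set ℝ) := by
    have h1 : ContractibleSpace (univ : Set ℝ) := convex_univ.contractibleSpace univ_nonempty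
    change SimplyConnectedSpace (univ : Set ℝ)
    infer_instance
  obtain ⟨F, hF, hFe⟩ := Complex.exists_continuousOn_eqOn_exp_comp hsc isOpen_univ hg.continuousOn (by rintro ⟨t, -, ht⟩; exact hg0 t ht)
  have hFe : ∀ t, Complex.exp (F t) = g t := fun t => hFe (mem_univ t)
  rw [continuousOn_univ] at hF
  refine ⟨fun t => F t - F 0, by fun_prop, sub_self _, fun t ht => ?_⟩
  rw [Complex.exp_sub, hFe, hFe, hgt t ht, hgt 0 ⟨le_rfl, zero_le_one⟩, mul_div_cancel₀ _ (h0 0 ⟨le_rfl, zero_le_one⟩)]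
end SA
end
end

section
open Set Topology MeasureTheory Filter MvPolynomial
noncomputable section
namespace SA
set_option linter.unusedSectionVars false

variable {N : ℕ}

/-- working form of polynomial convexity -/
def PCx (K : Set (Fin N → ℂ)) : Prop := ∀ z, z ∉ K → ∃ p : MvPolynomial (Fin N) ℂ, eval z p = 1 ∧ ∀ x ∈ K, ‖eval x p‖ < 1 / 3

theorem pcx_pow {K : Set (Fin N → ℂ)} {z : Fin N → ℂ} {p : MvPolynomial (Fin N) ℂ} {r : ℝ} (h : ∀ x ∈ K, ‖eval x p‖ ≤ r) (hr : r < ‖eval z p‖) 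
    {ε : ℝ} (hε : 0 < ε) :
    ∃ p : MvPolynomial (Fin N) ℂ, eval z p = 1 ∧ ∀ x ∈ K, ‖eval x p‖ < ε := by
  by_cases hK : K.Nonempty
  swap
  · rw [not_nonempty_iff_eq_empty] at hK
    subst hK
    exact ⟨1, by simp, by simp⟩
  have hr0 : 0 ≤ r := by obtain ⟨x, hx⟩ := hK; exact (norm_nonneg _).trans (h x hx)
  have hz : 0 < ‖eval z p‖ := by linarith
  have hz0 : eval z p ≠ 0 := norm_pos_iff.1 hz
  obtain ⟨n, hn⟩ := exists_pow_lt_of_lt_one hε (show r / ‖eval z p‖ < 1 from (div_lt_one hz).2 hr)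
  refine ⟨(C (eval z p)⁻¹ * p) ^ n, by simp [hz0], fun x hx => ?_⟩
  simp only [map_pow, map_mul, eval_C, norm_pow, norm_mul, norm_inv]
  refine lt_of_le_of_lt ?_ hn
  rw [inv_mul_eq_div]
  gcongr
  exact h x hx

theorem PCx.small {K : Set (Fin N → ℂ)} (h : PCx K) {z : Fin N → ℂ} (hz : z ∉ K) {ε : ℝ} (hε : 0 < ε) :
    ∃ p : MvPolynomial (Fin N) ℂ, eval z p = 1 ∧ ∀ x ∈ K, ‖eval x p‖ < ε := by
  obtain ⟨p, hp, hK⟩ := h z hz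
  exact pcx_pow (r := 1 / 3) (fun x hx => (hK x hx).le) (by rw [hp]; norm_num) hε

theorem avoid {Γ Y : Set (Fin N → ℂ)} (hΓ : dimH Γ ≤ 1) (hY : IsCompact Y) {x0 : Fin N → ℂ} (hx0 : x0 ∉ Γ)
    {f1 : MvPolynomial (Fin N) ℂ} (hf1 : eval x0 f1 = 0) {ε : ℝ} (hε : 0 < ε) : 
    ∃ f : MvPolynomial (Fin N) ℂ, eval x0 f = 0 ∧ (∀ y ∈ Y, ‖eval y f - eval y f1‖ < ε) ∧ ∀ z ∈ Γ, eval z f ≠ 0 := by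
  have key : ∀ (S : Finset (Fin N)) (ε : ℝ), 0 < ε → ∃ f : MvPolynomial (Fin N) ℂ, eval x0 f = 0 ∧ (∀ y ∈ Y, ‖eval y f - eval y f1‖ < ε) ∧ 
      ∀ z ∈ Γ, (∃ j ∈ S, z j ≠ x0 j) → eval z f ≠ 0 := by
    intro S
    induction S using Finset.induction_on with
    | empty => intro ε hε; exact ⟨f1, hf1, by simpa using fun y hy => hε, by simp⟩
    | insert j S hj ih =>
      intro ε hε
      obtain ⟨f, hf0, hfY, hfΓ⟩ := ih (ε / 2) (by positivity)
      obtain ⟨R, hR⟩ := hY.exists_bound_of_continuousOn (f := fun y => y j - x0 j) (by fun_prop)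
      let b : (Fin N → ℂ) → ℂ := fun z => - eval z f / (z j - x0 j)
      have hdim : dimH (b '' (Γ ∩ {z | z j ≠ x0 j})) ≤ 1 := by
        refine (dimH_image_le_of_locally_lipschitzOn ?_).trans ((dimH_mono inter_subset_left).trans hΓ)
        rintro z ⟨-, hz⟩
        have hz' : z j - x0 j ≠ 0 := sub_ne_zero.2 hz
        have hb : ContDiffAt ℂ 1 b z := by
          have h1 : ContDiffAt ℂ 1 (fun z : Fin N → ℂ => eval z f) z := 
            (AnalyticOnNhd.eval_mvPolynomial f z (mem_univ z)).contDiffAt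
          have h2 : ContDiffAt ℂ 1 (fun z : Fin N → ℂ => z j - x0 j) z := by fun_prop
          exact h1.neg.div h2 hz'
        obtain ⟨K, t, ht, hK⟩ := hb.exists_lipschitzOnWith
        exact ⟨K, t, nhdsWithin_le_nhds ht, hK⟩
      have hdense : Dense (b '' (Γ ∩ {z | z j ≠ x0 j}))ᶜ := by
        apply dense_compl_of_dimH_lt_finrank
        rw [Complex.finrank_real_complex]
        exact lt_of_le_of_lt hdim (by norm_num)
      have hδ : 0 < ε / (2 * (|R| + 1)) := by positivity
      obtain ⟨c, hc, hcδ⟩ := hdense.exists_dist_lt 0 hδ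
      rw [dist_comm, dist_zero_right] at hcδ
      refine ⟨f + C c * (X j - C (x0 j)), by simp [hf0], fun y hy => ?_, fun z hz hzS => ?_⟩
      · have h1 := hfY y hy
        have h2 := hR y hy
        have h3 : ‖c‖ * ‖y j - x0 j‖ ≤ ε / 2 := by
          calc _ ≤ ε / (2 * (|R| + 1)) * (|R| + 1) := by gcongr; exact h2.trans ((le_abs_self R).trans (by linarith))
            _ = ε / 2 := by field_simp
        have e : eval y (f + C c * (X j - C (x0 j))) - eval y f1 = (eval y f - eval y f1) + c * (y j - x0 j) := by simp; ring
        rw [e]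
        refine lt_of_le_of_lt (norm_add_le _ _) ?_
        rw [norm_mul]; linarith
      · have e : eval z (f + C c * (X j - C (x0 j))) = eval z f + c * (z j - x0 j) := by simp
        rw [e]
        by_cases hzj : z j = x0 j
        · rw [hzj, sub_self, mul_zero, add_zero]
          apply hfΓ z hz
          obtain ⟨i, hi, hzi⟩ := hzS
          rcases Finset.mem_insert.1 hi with rfl | hi
          · exact absurd hzj hzi
          · exact ⟨i, hi, hzi⟩
        · intro h0
          apply hc
          refine ⟨z, ⟨hz, hzj⟩, ?_⟩
          have hz' : z j - x0 j ≠ 0 := sub_ne_zero.2 hzj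
          change - eval z f / (z j - x0 j) = c
          rw [div_eq_iff hz']
          linear_combination -h0
  obtain ⟨f, h0, h1, h2⟩ := key Finset.univ ε hε
  refine ⟨f, h0, h1, fun z hz => h2 z hz ?_⟩
  by_contra hcon
  push Not at hcon
  apply hx0
  have : z = x0 := funext fun j => hcon j (Finset.mem_univ j)
  rwa [← this]

/-- restriction of polynomials to a set -/
def Phi (X : Set (Fin N → ℂ)) : MvPolynomial (Fin N) ℂ →ₐ[ℂ] C(X, ℂ) := 
  MvPolynomial.aeval fun j => ⟨fun x => x.1 j, (continuous_apply j).comp continuous_subtype_val⟩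

theorem Phi_apply (X : Set (Fin N → ℂ)) (p : MvPolynomial (Fin N) ℂ) (x : X) : Phi X p x = eval x.1 p := by
  induction p using MvPolynomial.induction_on with
  | C a => simp [Phi]
  | add p q hp hq => rw [map_add, map_add, ContinuousMap.add_apply, hp, hq]
  | mul_X p j hp => 
    rw [map_mul, map_mul, ContinuousMap.mul_apply, hp]
    simp [Phi]

theorem Phi_lip {X : Set (Fin N → ℂ)} [CompactSpace X] (p : MvPolynomial (Fin N) ℂ) : 
    ∃ K : ℝ, ∀ x y, ‖Phi X p x - Phi X p y‖ ≤ K * dist x y := by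
  induction p using MvPolynomial.induction_on with
  | C a => exact ⟨0, by simp [Phi_apply]⟩
  | add p q hp hq => 
    obtain ⟨K, hK⟩ := hp
    obtain ⟨L, hL⟩ := hq
    refine ⟨K + L, fun x y => ?_⟩
    rw [map_add, ContinuousMap.add_apply, ContinuousMap.add_apply, add_sub_add_comm, add_mul]
    exact (norm_add_le _ _).trans (add_le_add (hK x y) (hL x y))
  | mul_X p j hp => 
    obtain ⟨K, hK⟩ := hp
    refine ⟨‖Phi X p‖ + ‖Phi X (MvPolynomial.X j)‖ * K, fun x y => ?_⟩
    have e : Phi X (p * MvPolynomial.X j) x - Phi X (p * MvPolynomial.X j) y = Phi X p x * (x.1 j - y.1 j) + Phi X (MvPolynomial.X j) y * (Phi X p x - Phi X p y) := by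
      rw [map_mul, ContinuousMap.mul_apply, ContinuousMap.mul_apply]
      simp only [Phi_apply, eval_X]; ring
    rw [e]
    refine (norm_add_le _ _).trans ?_
    rw [norm_mul, norm_mul, add_mul, mul_assoc]
    have h1 : ‖x.1 j - y.1 j‖ ≤ dist x y := by
      rw [← dist_eq_norm]; exact dist_le_pi_dist x.1 y.1 j
    gcongr
    · exact ContinuousMap.norm_coe_le_norm _ x
    · exact ContinuousMap.norm_coe_le_norm _ y
    · exact hK x y

theorem star {Y : Set (Fin N → ℂ)} (hYc : IsCompact Y) (hY : PCx Y) {γ : ℝ → Fin N → ℂ} (hcont : ContinuousOn γ (Icc 0 1))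
    (hinj : InjOn γ (Icc 0 1)) (hBV : BoundedVariationOn γ (Icc 0 1)) (h0 : γ 0 ∈ Y) (hm : ∀ t ∈ Icc (0:ℝ) 1, γ t ∈ Y → t = 0) : 
    PCx (Y ∪ γ '' Icc 0 1) := by
  classical
  intro x0 hx0
  by_contra hcon
  set X := Y ∪ γ '' Icc 0 1 with hX
  have hXc : IsCompact X := hYc.union (isCompact_Icc.image_of_continuousOn hcont)
  have : CompactSpace X := isCompact_iff_compactSpace.1 hXc
  have : Nonempty X := ⟨⟨γ 0, Or.inl h0⟩⟩
  have hev : ∀ p, ‖(MvPolynomial.aeval x0 : MvPolynomial (Fin N) ℂ →ₐ[ℂ] ℂ) p‖ ≤ ‖Phi X p‖ := by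
    intro p
    by_contra hlt
    push Not at hlt
    refine hcon (pcx_pow (p := p) (r := ‖Phi X p‖) (fun x hx => ?_) ?_ (by norm_num))
    · have := (Phi X p).norm_coe_le_norm ⟨x, hx⟩
      rwa [Phi_apply] at this
    · simpa using! hlt
  obtain ⟨β, Λ, hβ, hβX, hβc⟩ := lip_param hcont hBV
  have hdim : dimH (γ '' Icc 0 1) ≤ 1 := by
    have : γ '' Icc 0 1 ⊆ range β := fun x hx => by
      obtain ⟨s, -, hs⟩ := hβc x hx
      exact ⟨s, hs⟩
    refine (dimH_mono this).trans ?_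
    have := hβ.dimH_range_le
    rwa [Real.dimH_univ] at this
  obtain ⟨g0, hg0, hg0Y⟩ := hY x0 fun h => hx0 (Or.inl h)
  obtain ⟨f0, hf00, hf0Y, hf0Γ⟩ := avoid hdim hYc (fun h => hx0 (Or.inr h)) (f1 := 1 - g0) (by simp [hg0]) (show (0:ℝ) < 1 / 6 by norm_num)
  have hf0Y' : ∀ y ∈ Y, ‖eval y f0 - 1‖ < 1 / 2 := by
    intro y hy
    have h1 := hf0Y y hy
    have h2 := hg0Y y hy
    have e : eval y f0 - 1 = (eval y f0 - eval y (1 - g0)) + (- eval y g0) := by rw [map_sub, map_one]; ring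
    rw [e]
    refine lt_of_le_of_lt (norm_add_le _ _) ?_
    rw [norm_neg]; linarith
  have hY1 : ∀ y ∈ Y, eval y f0 ≠ 0 ∧ ‖1 / eval y f0 - 1‖ < 1 := by
    intro y hy
    have h1 := hf0Y' y hy
    have h2 : 1 / 2 < ‖eval y f0‖ := by
      have := norm_sub_norm_le (1:ℂ) (1 - eval y f0)
      rw [norm_sub_rev (1:ℂ) (eval y f0), sub_sub_cancel, norm_one] at this
      linarith
    have h3 : eval y f0 ≠ 0 := norm_pos_iff.1 (by linarith)
    refine ⟨h3, ?_⟩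
    have e : 1 / eval y f0 - 1 = (1 - eval y f0) / eval y f0 := by field_simp
    rw [e, norm_div, div_lt_one (by linarith), norm_sub_rev]
    linarith
  have hpc : ∀ p : MvPolynomial (Fin N) ℂ, Continuous fun z => eval z p := fun p => p.continuous_eval
  obtain ⟨G, hG, hG0, hGe⟩ := path_log (c := fun t => eval (γ t) f0) ((hpc f0).comp_continuousOn hcont) fun t ht => hf0Γ _ ⟨t, ht, rfl⟩
  -- glue
  have : CompactSpace Y := isCompact_iff_compactSpace.1 hYc
  let q : C(Y ⊕ Icc (0:ℝ) 1, X) := ⟨Sum.elim (fun y => ⟨y.1, Or.inl y.2⟩) (fun t => ⟨γ t.1, Or.inr ⟨t.1, t.2, rfl⟩⟩), by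
    refine Continuous.sumElim (by fun_prop) ?_
    exact Continuous.subtype_mk (continuousOn_iff_continuous_domRestrict.1 hcont) _⟩
  have hqs : Function.Surjective q := by
    rintro ⟨x, hx | ⟨t, ht, rfl⟩⟩
    · exact ⟨Sum.inl ⟨x, hx⟩, rfl⟩
    · exact ⟨Sum.inr ⟨t, ht⟩, rfl⟩
  have hq : IsQuotientMap q := IsQuotientMap.of_surjective_continuous hqs q.continuous
  let g1 : C(Y ⊕ Icc (0:ℝ) 1, ℂ) := ⟨Sum.elim (fun _ => 0) (fun t => G t.1), by
    refine Continuous.sumElim (by fun_prop) (by fun_prop)⟩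
  have hfac : Function.FactorsThrough g1 q := by
    rintro (⟨y, hy⟩ | ⟨t, ht⟩) (⟨y', hy'⟩ | ⟨t', ht'⟩) h
    · rfl
    · have h : y = γ t' := congrArg Subtype.val h
      have := hm t' ht' (h ▸ hy)
      change 0 = G t'
      rw [this, hG0]
    · have h : γ t = y' := congrArg Subtype.val h
      have := hm t ht (h ▸ hy')
      change G t = 0
      rw [this, hG0]
    · have h : γ t = γ t' := congrArg Subtype.val h
      have := hinj ht ht' h
      change G t = G t'
      rw [this]
  let g := hq.lift g1 hfac
  have hgq : ∀ u, g (q u) = g1 u := fun u => DFunLike.congr_fun (hq.lift_comp g1 hfac) u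
  have hgY : ∀ y : X, y.1 ∈ Y → g y = 0 := fun y hy => hgq (Sum.inl ⟨y.1, hy⟩)
  have hgΓ : ∀ t (ht : t ∈ Icc (0:ℝ) 1), g ⟨γ t, Or.inr ⟨t, ht, rfl⟩⟩ = G t := fun t ht => hgq (Sum.inr ⟨t, ht⟩)
  let β' : ℝ → X := fun s => ⟨β s, Or.inr (hβX s)⟩
  have hβ' : LipschitzWith Λ β' := fun s t => hβ s t
  have hI0 : (0:ℝ) ∈ Icc (0:ℝ) 1 := ⟨le_rfl, zero_le_one⟩
  refine core (Phi X) (MvPolynomial.aeval x0) hev ?_ hβ' (Y := {x : X | x.1 ∈ Y}) ?_ ?_ (b0 := f0) ?_ ?_ (g := g) ?_ ?_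
  · rintro _ ⟨p, rfl⟩
    exact Phi_lip p
  · rintro ⟨x, hx⟩ hxY
    obtain ⟨s, hs, hsx⟩ := hβc x (hx.resolve_left hxY)
    exact ⟨s, hs, Subtype.ext hsx⟩
  · rintro x hx y hyx
    obtain ⟨g, hg1, hgY⟩ := hY x.1 hx
    have hyx' : y.1 ≠ x.1 := fun h => hyx (Subtype.ext h)
    obtain ⟨j, hj⟩ := Function.ne_iff.1 hyx'
    obtain ⟨R, hR⟩ := hYc.exists_bound_of_continuousOn (f := fun y => y j - x.1 j) (by fun_prop)
    have main : ∃ ε : ℝ, 0 ≤ ε ∧ ε * (|R| + 1) ≤ 1 / 6 ∧ eval y.1 g + ε * (y.1 j - x.1 j) ≠ 1 := by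
      by_cases h1 : eval y.1 g = 1
      · refine ⟨1 / (6 * (|R| + 1)), by positivity, le_of_eq (by field_simp), ?_⟩
        rw [h1]
        intro h2
        have h3 : ((1 / (6 * (|R| + 1)) : ℝ) : ℂ) * (y.1 j - x.1 j) = 0 := by linear_combination h2
        rcases mul_eq_zero.1 h3 with h4 | h4
        · have h5 : (0:ℝ) < 1 / (6 * (|R| + 1)) := by positivity
          exact h5.ne' (by exact_mod_cast h4)
        · exact hj (sub_eq_zero.1 h4)
      · exact ⟨0, le_rfl, by norm_num, by simpa using h1⟩
    obtain ⟨ε, hε0, hε1, hε2⟩ := main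
    let F : MvPolynomial (Fin N) ℂ := C Complex.I * (g + C (ε : ℂ) * (MvPolynomial.X j - C (x.1 j)) - C (1 / 2 : ℂ))
    have hF : ∀ z, eval z F = Complex.I * (eval z g + ε * (z j - x.1 j) - 1 / 2) := fun z => by simp [F]
    refine ⟨Phi X F, ⟨F, rfl⟩, fun z hz => ?_, ?_, ?_⟩
    · rw [Phi_apply, hF]
      have h1 := hgY z.1 hz
      have h2 := hR z.1 hz
      have h3 : ‖eval z.1 g + ε * (z.1 j - x.1 j)‖ ≤ 1 / 2 := by
        refine (norm_add_le _ _).trans ?_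
        rw [norm_mul, Complex.norm_real, Real.norm_of_nonneg hε0]
        have : ε * ‖z.1 j - x.1 j‖ ≤ ε * (|R| + 1) := by gcongr; exact h2.trans ((le_abs_self R).trans (by linarith))
        linarith
      have h4 := (Complex.abs_re_le_norm _).trans h3
      have h5 := (abs_le.1 h4).2
      rw [Complex.I_mul_im, Complex.sub_re]
      norm_num
      norm_num at h5
      linarith
    · rw [Phi_apply, hF, hg1, sub_self, mul_zero, add_zero]
      norm_num
    · rw [Phi_apply, Phi_apply, hF, hF, hg1, sub_self, mul_zero, add_zero]
      intro h
      apply hε2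
      have := mul_left_cancel₀ Complex.I_ne_zero h
      linear_combination this
  · simpa using! hf00
  · rintro ⟨x, hx | hx⟩
    · rw [Phi_apply]; exact (hY1 x hx).1
    · rw [Phi_apply]; exact hf0Γ x hx
  · exact hgY
  · rintro ⟨x, hx⟩
    rw [Phi_apply]
    rcases hx with hx | ⟨t, ht, rfl⟩
    · rw [hgY _ hx, Complex.exp_zero]
      exact (hY1 x hx).2
    · rw [hgΓ t ht]
      have h1 := hGe t ht
      have h2 := hY1 _ h0
      change eval (γ t) f0 = eval (γ 0) f0 * _ at h1
      change ‖Complex.exp (G t) / eval (γ t) f0 - 1‖ < 1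
      rw [h1]
      have e : Complex.exp (G t) / (eval (γ 0) f0 * Complex.exp (G t)) = 1 / eval (γ 0) f0 := by
        have := Complex.exp_ne_zero (G t)
        have := h2.1
        field_simp
      rw [e]
      exact h2.2
end SA
end
end

section
open Set Topology MeasureTheory Filter MvPolynomial
noncomputable section
namespace SA
set_option linter.unusedSectionVars false

variable {N : ℕ}

/-- `L` is a common zero set of polynomials -/
def ZS (L : Set (Fin N → ℂ)) : Prop := ∀ z, z ∉ L → ∃ l : MvPolynomial (Fin N) ℂ, eval z l ≠ 0 ∧ ∀ x ∈ L, eval x l = 0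

theorem line_ZS (z₀ v : Fin N → ℂ) (hv : v ≠ 0) : ZS {z | ∃ t : ℂ, z = z₀ + t • v} := by
  intro z hz
  obtain ⟨j, hj⟩ := Function.ne_iff.1 hv
  have hj : v j ≠ 0 := hj
  by_contra hcon
  push Not at hcon
  apply hz
  refine ⟨(z j - z₀ j) / v j, funext fun i => ?_⟩
  have := fun h => hcon ((X i - C (z₀ i)) * C (v j) - (X j - C (z₀ j)) * C (v i)) h
  by_contra hne
  obtain ⟨x, ⟨t, rfl⟩, hx⟩ := this (by
    intro h0
    apply hne
    simp only [map_sub, map_mul, eval_X, eval_C] at h0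
    simp only [Pi.add_apply, Pi.smul_apply, smul_eq_mul]
    field_simp
    linear_combination h0)
  apply hx
  simp
  ring

theorem PCx.interZS {K L : Set (Fin N → ℂ)} (hK : PCx K) (hL : ZS L) : PCx (K ∩ L) := by
  intro z hz
  by_cases h : z ∈ K
  · obtain ⟨l, h1, h2⟩ := hL z fun h' => hz ⟨h, h'⟩
    exact pcx_pow (r := 0) (p := l) (fun x hx => by rw [h2 x hx.2, norm_zero]) (norm_pos_iff.2 h1) (by norm_num)
  · obtain ⟨p, h1, h2⟩ := hK z h
    exact ⟨p, h1, fun x hx => h2 x hx.1⟩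

theorem banach1 {R : Type*} [NormedCommRing R] [NormedAlgebra ℂ R] [CompleteSpace R] (Ψ : MvPolynomial (Fin N) ℂ →ₐ[ℂ] R)
    {g : MvPolynomial (Fin N) ℂ} 
    (hchar : ∀ w, (∀ p, Ψ p = 0 → eval w p = 0) → (∀ p, ‖Ψ p‖ < 1 → eval w p ≠ 1) → ‖eval w g‖ < 1 / 3) :
    ∃ n : ℕ, 1 ≤ n ∧ ‖Ψ g ^ n‖ < 1 / 4 := by
  have hchar : ∀ lam ∈ spectrum ℂ (Ψ g), ‖lam‖₊ < 1 / 3 := by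
    intro lam hlam
    rw [spectrum.mem_iff] at hlam
    obtain ⟨φ, hφ⟩ := WeakDual.CharacterSpace.exists_apply_eq_zero hlam
    let ψ : MvPolynomial (Fin N) ℂ →ₐ[ℂ] ℂ := (WeakDual.CharacterSpace.toAlgHom φ).comp Ψ
    let w : Fin N → ℂ := fun j => ψ (X j)
    have hψ : ∀ p, ψ p = eval w p := by
      intro p
      have : ψ = MvPolynomial.aeval w := by
        ext j; simp [w]
      rw [this]; simp
    have hψ' : ∀ p, φ (Ψ p) = eval w p := hψ
    have h1 := hchar w (fun p hp => by rw [← hψ', hp, map_zero]) (fun p hn hp => by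
      have hu := isUnit_one_sub_of_norm_lt_one hn
      have hu2 := hu.map (WeakDual.CharacterSpace.toAlgHom φ)
      rw [map_sub, map_one] at hu2
      have : (WeakDual.CharacterSpace.toAlgHom φ) (Ψ p) = 1 := (hψ p).trans hp
      rw [this, sub_self] at hu2
      exact not_isUnit_zero hu2)
    have h2 : lam = eval w g := by
      rw [map_sub, hψ', AlgHomClass.commutes] at hφ
      exact sub_eq_zero.1 hφ
    rw [h2]
    exact_mod_cast h1
  rcases subsingleton_or_nontrivial R with hs | hs
  · refine ⟨1, le_rfl, ?_⟩
    rw [Subsingleton.elim (Ψ g ^ 1) 0, norm_zero]; norm_num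
  have hrad : spectralRadius ℂ (Ψ g) < ((1/3 : NNReal) : ENNReal) := 
    spectrum.spectralRadius_lt_of_forall_lt _ hchar
  have ht := spectrum.pow_nnnorm_pow_one_div_tendsto_nhds_spectralRadius (Ψ g)
  have hev := (ht.eventually (gt_mem_nhds hrad)).and (eventually_ge_atTop 2)
  obtain ⟨n, hn, hn2⟩ := hev.exists
  refine ⟨n, by omega, ?_⟩
  have hn0 : (0:ℝ) < n := by exact_mod_cast (by omega : 0 < n)
  have h3 : (‖Ψ g ^ n‖₊ : ENNReal) < ((1/3 : NNReal) : ENNReal) ^ (n:ℝ) := by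
    rw [← ENNReal.rpow_lt_rpow_iff (z := 1 / (n:ℝ)) (by positivity), ← ENNReal.rpow_mul, mul_one_div_cancel hn0.ne', ENNReal.rpow_one]
    exact hn
  rw [ENNReal.rpow_natCast, ← ENNReal.coe_pow, ENNReal.coe_lt_coe] at h3
  have h4 : ‖Ψ g ^ n‖ < (1/3 : ℝ) ^ n := by exact_mod_cast h3
  refine h4.trans_le ?_
  calc (1/3:ℝ)^n ≤ (1/3)^2 := pow_le_pow_of_le_one (by norm_num) (by norm_num) hn2
    _ ≤ 1/4 := by norm_num

theorem banach2 {A : Type*} [NormedCommRing A] [NormedAlgebra ℂ A] [CompleteSpace A] (P : MvPolynomial (Fin N) ℂ →ₐ[ℂ] A)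
    (J : Ideal A) (hJ : IsClosed (J : Set A))
    {g : MvPolynomial (Fin N) ℂ} 
    (hchar : ∀ w, (∀ p, P p ∈ J → eval w p = 0) → (∀ p, ‖P p‖ < 1 → eval w p ≠ 1) → ‖eval w g‖ < 1 / 3) :
    ∃ n : ℕ, 1 ≤ n ∧ ∃ m ∈ J, ‖P (g ^ n) + m‖ < 3 / 8 := by
  let Ψ : MvPolynomial (Fin N) ℂ →ₐ[ℂ] A ⧸ J := (Ideal.Quotient.mkₐ ℂ J).comp P
  have hn : ∀ p, ‖Ψ p‖ ≤ ‖P p‖ := fun p => Submodule.Quotient.norm_mk_le J (P p)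
  obtain ⟨n, hn1, hn⟩ := banach1 (R := A ⧸ J) Ψ (g := g) (fun w h1 h2 => hchar w (fun p hp => h1 p (Ideal.Quotient.eq_zero_iff_mem.2 hp)) 
    (fun p hp => h2 p ((hn p).trans_lt hp)))
  refine ⟨n, hn1, ?_⟩
  rw [← map_pow] at hn
  obtain ⟨a, ha, han⟩ := Submodule.Quotient.norm_mk_lt (S := J) (Ψ (g ^ n)) (show (0:ℝ) < 1/8 by norm_num)
  refine ⟨a - P (g ^ n), (Ideal.Quotient.mk_eq_mk_iff_sub_mem _ _).1 ha, ?_⟩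
  rw [add_sub_cancel]
  linarith

theorem line_approx {K L : Set (Fin N → ℂ)} (hKc : IsCompact K) (hK : PCx K) (hL : ZS L) {g : MvPolynomial (Fin N) ℂ}
    (hg : ∀ x ∈ K ∩ L, ‖eval x g‖ < 1 / 3) : 
    ∃ n : ℕ, 1 ≤ n ∧ ∃ h : MvPolynomial (Fin N) ℂ, (∀ x ∈ L, eval x h = 0) ∧ ∀ x ∈ K, ‖eval x (g ^ n + h)‖ < 1 / 2 := by
  classical
  have : CompactSpace K := isCompact_iff_compactSpace.1 hKc
  let A : Subalgebra ℂ C(K, ℂ) := (Phi K).range.topologicalClosure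
  have hAcl : IsClosed (A : Set C(K, ℂ)) := Subalgebra.isClosed_topologicalClosure _
  have : CompleteSpace A := hAcl.completeSpace_coe
  let P : MvPolynomial (Fin N) ℂ →ₐ[ℂ] A := (Phi K).codRestrict A fun p => Subalgebra.le_topologicalClosure _ ⟨p, rfl⟩
  have hPd : ∀ a : A, a ∈ closure (range P) := by
    intro a
    rw [closure_subtype]
    have : (Subtype.val '' range P) = ((Phi K).range : Set C(K, ℂ)) := by
      rw [← range_comp]; rfl
    rw [this]
    exact a.2
  let S : Set A := P '' {h | ∀ x ∈ L, eval x h = 0}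
  have hSadd : ∀ a ∈ S, ∀ b ∈ S, a + b ∈ S := by
    rintro _ ⟨p, hp, rfl⟩ _ ⟨q, hq, rfl⟩
    exact ⟨p + q, fun x hx => by rw [map_add, hp x hx, hq x hx, add_zero], map_add _ _ _⟩
  have hSmul : ∀ a ∈ range P, ∀ b ∈ S, a * b ∈ S := by
    rintro _ ⟨p, rfl⟩ _ ⟨q, hq, rfl⟩
    exact ⟨p * q, fun x hx => by rw [map_mul, hq x hx, mul_zero], map_mul _ _ _⟩
  let J : Ideal A := 
    { carrier := closure S
      zero_mem' := subset_closure ⟨0, fun x hx => by simp, map_zero _⟩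
      add_mem' := fun {a b} ha hb => map_mem_closure₂ continuous_add ha hb hSadd
      smul_mem' := fun c {a} ha => map_mem_closure₂ continuous_mul (hPd c) ha hSmul }
  have hJcl : IsClosed (J : Set A) := isClosed_closure
  have hPn : ∀ p, ‖P p‖ = ‖Phi K p‖ := fun p => rfl
  obtain ⟨n, hn1, m, hm, hmn⟩ := banach2 P J hJcl (g := g) (by
    intro w hw1 hw2
    apply hg
    constructor
    · by_contra hw
      obtain ⟨p, hp1, hp2⟩ := hK w hw
      refine hw2 p ?_ hp1
      rw [hPn]
      refine lt_of_le_of_lt ((ContinuousMap.norm_le _ (show (0:ℝ) ≤ 1 / 3 by norm_num)).2 fun x => ?_) (show (1/3 : ℝ) < 1 by norm_num)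
      rw [Phi_apply]; exact (hp2 x.1 x.2).le
    · by_contra hw
      obtain ⟨l, hl1, hl2⟩ := hL w hw
      exact hl1 (hw1 l (subset_closure ⟨l, hl2, rfl⟩)))
  refine ⟨n, hn1, ?_⟩
  have hm' : m ∈ closure S := hm
  obtain ⟨_, ⟨h, hh, rfl⟩, hd⟩ := Metric.mem_closure_iff.1 hm' (1/8) (by norm_num)
  refine ⟨h, hh, fun x hx => ?_⟩
  have h5 : ‖P (g ^ n + h)‖ < 1 / 2 := by
    have e : P (g ^ n + h) = (P (g ^ n) + m) + (P h - m) := by rw [map_add]; abel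
    rw [e]
    refine lt_of_le_of_lt (norm_add_le _ _) ?_
    rw [dist_comm, dist_eq_norm] at hd
    linarith
  rw [hPn] at h5
  have h6 := (Phi K (g ^ n + h)).norm_coe_le_norm ⟨x, hx⟩
  rw [Phi_apply] at h6
  exact h6.trans_lt h5

theorem line_trick {K L A : Set (Fin N → ℂ)} (hKc : IsCompact K) (hK : PCx K) (hL : ZS L) (hA : A ⊆ L) 
    (hX : PCx ((K ∪ A) ∩ L)) : PCx (K ∪ A) := by
  intro z hz
  by_cases hzL : z ∈ L
  · obtain ⟨g, hg1, hg2⟩ := hX z fun h => hz h.1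
    obtain ⟨n, hn, h, hh, hb⟩ := line_approx hKc hK hL (g := g) fun x hx => hg2 x ⟨Or.inl hx.1, hx.2⟩
    refine pcx_pow (p := g ^ n + h) (r := 1 / 2) ?_ ?_ (by norm_num)
    · rintro x (hx | hx)
      · exact (hb x hx).le
      · rw [map_add, hh x (hA hx), add_zero, map_pow, norm_pow]
        have h1 := hg2 x ⟨Or.inr hx, hA hx⟩
        calc ‖eval x g‖ ^ n ≤ ‖eval x g‖ ^ 1 := pow_le_pow_of_le_one (norm_nonneg _) (by linarith) hn
          _ ≤ 1 / 2 := by rw [pow_one]; linarith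
    · rw [map_add, hh z hzL, map_pow, hg1]; norm_num
  · obtain ⟨l, hl1, hl2⟩ := hL z hzL
    obtain ⟨M, hM⟩ := hKc.exists_bound_of_continuousOn (f := fun x => eval x l) l.continuous_eval.continuousOn
    have hl0 : 0 < ‖eval z l‖ := norm_pos_iff.2 hl1
    obtain ⟨h, hh1, hh2⟩ := hK.small (z := z) (fun h => hz (Or.inl h)) (ε := ‖eval z l‖ / (2 * (|M| + 1))) (by positivity)
    refine pcx_pow (p := h * l) (r := ‖eval z l‖ / 2) ?_ ?_ (by norm_num)
    · rintro x (hx | hx)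
      · rw [map_mul, norm_mul]
        calc _ ≤ ‖eval z l‖ / (2 * (|M| + 1)) * (|M| + 1) := by
              gcongr
              · exact (hh2 x hx).le
              · exact (hM x hx).trans ((le_abs_self M).trans (by linarith))
          _ = _ := by field_simp
      · rw [map_mul, hl2 x (hA hx), mul_zero, norm_zero]; positivity
    · rw [map_mul, hh1, one_mul]; linarith
end SA
end
end

section
open Set Topology MeasureTheory Filter MvPolynomial
noncomputable section
namespace SA
set_option linter.unusedSectionVars false

variable {N : ℕ}

theorem star_affine {Y : Set (Fin N → ℂ)} (hYc : IsCompact Y) (hY : PCx Y) {γ : ℝ → Fin N → ℂ} (hcont : ContinuousOn γ (Icc 0 1))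
    (hinj : InjOn γ (Icc 0 1)) (hBV : BoundedVariationOn γ (Icc 0 1)) {a c : ℝ} (ha : a ∈ Icc (0:ℝ) 1) (hc : c ∈ Icc (0:ℝ) 1) 
    (hac : a ≠ c) (h0 : γ a ∈ Y) (hm : ∀ t ∈ uIcc a c, γ t ∈ Y → t = a) : 
    PCx (Y ∪ γ '' uIcc a c) := by
  let φ : ℝ → ℝ := fun t => a + t * (c - a)
  have hφim : φ '' Icc 0 1 = uIcc a c := by
    rw [← segment_eq_uIcc, segment_eq_image']
    apply image_congr
    intro t _
    simp [φ]
  have hsub : uIcc a c ⊆ Icc 0 1 := uIcc_subset_Icc ha hc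
  have hmaps : MapsTo φ (Icc 0 1) (Icc 0 1) := fun t ht => hsub (hφim ▸ mem_image_of_mem φ ht)
  have hφinj : Function.Injective φ := by
    intro x y h
    have h : a + x * (c - a) = a + y * (c - a) := h
    exact mul_right_cancel₀ (sub_ne_zero.2 hac.symm) (add_left_cancel h)
  have hφc : Continuous φ := by fun_prop
  have hbv : BoundedVariationOn (γ ∘ φ) (Icc 0 1) := by
    rcases le_total a c with h | h
    · refine ne_top_of_le_ne_top hBV (eVariationOn.comp_le_of_monotoneOn γ φ ?_ hmaps)
      intro x _ y _ hxy
      have : 0 ≤ c - a := by linarith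
      change a + x * (c - a) ≤ a + y * (c - a)
      gcongr
    · refine ne_top_of_le_ne_top hBV (eVariationOn.comp_le_of_antitoneOn γ φ ?_ hmaps)
      intro x _ y _ hxy
      change a + y * (c - a) ≤ a + x * (c - a)
      nlinarith
  have := star hYc hY (γ := γ ∘ φ) (hcont.comp hφc.continuousOn hmaps) (hinj.comp hφinj.injOn hmaps) hbv
    (by simpa [φ] using h0) (fun t ht h => by
      have h1 := hm (φ t) (hφim ▸ mem_image_of_mem φ ht) h
      apply hφinj
      rw [h1]; simp [φ])
  rwa [image_comp, hφim] at this

theorem cut {Y : Set (Fin N → ℂ)} (hYc : IsCompact Y) (hY : PCx Y) {γ : ℝ → Fin N → ℂ} (hcont : ContinuousOn γ (Icc 0 1))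
    (hinj : InjOn γ (Icc 0 1)) (hBV : BoundedVariationOn γ (Icc 0 1)) (h0 : γ 0 ∈ Y) (h1 : γ 1 ∈ Y)
    (hm : ∀ t ∈ Icc (0:ℝ) 1, γ t ∈ Y → t = 0 ∨ t = 1) {b c : ℝ} (hb : 0 < b) (hbc : b < c) (hc : c < 1) : 
    IsCompact ((Y ∪ γ '' Icc 0 b) ∪ γ '' Icc c 1) ∧ PCx ((Y ∪ γ '' Icc 0 b) ∪ γ '' Icc c 1) := by
  have hc1 : IsCompact (Y ∪ γ '' Icc 0 b) := hYc.union (isCompact_Icc.image_of_continuousOn (hcont.mono (Icc_subset_Icc_right (by linarith))))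
  have hc2 : IsCompact (γ '' Icc c 1) := isCompact_Icc.image_of_continuousOn (hcont.mono (Icc_subset_Icc_left (by linarith)))
  refine ⟨hc1.union hc2, ?_⟩
  have hp1 : PCx (Y ∪ γ '' Icc 0 b) := by
    have := star_affine hYc hY hcont hinj hBV (a := 0) (c := b) ⟨by linarith, by linarith⟩ ⟨by linarith, by linarith⟩ hb.ne h0 (by
      intro t ht htY
      rw [uIcc_of_le hb.le] at ht
      rcases hm t ⟨ht.1, by linarith [ht.2]⟩ htY with h | h
      · exact h
      · linarith [ht.2])
    rwa [uIcc_of_le hb.le] at this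
  have := star_affine hc1 hp1 hcont hinj hBV (a := 1) (c := c) ⟨by linarith, by linarith⟩ ⟨by linarith, by linarith⟩ hc.ne' (Or.inl h1) (by
    intro t ht htY
    rw [uIcc_of_ge hc.le] at ht
    have ht' : t ∈ Icc (0:ℝ) 1 := ⟨by linarith [ht.1], ht.2⟩
    rcases htY with htY | ⟨u, hu, hut⟩
    · rcases hm t ht' htY with h | h
      · linarith [ht.1]
      · exact h
    · have := hinj ⟨hu.1, by linarith [hu.2]⟩ ht' hut
      linarith [hu.2, ht.1])
  rwa [uIcc_of_ge hc.le] at this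

theorem attach {Y : Set (Fin N → ℂ)} (hYc : IsCompact Y) (hY : PCx Y) {γ : ℝ → Fin N → ℂ} (hcont : ContinuousOn γ (Icc 0 1))
    (hinj : InjOn γ (Icc 0 1)) (hBV : BoundedVariationOn γ (Icc 0 1)) (h0 : γ 0 ∈ Y) (h1 : γ 1 ∈ Y)
    (hm : ∀ t ∈ Icc (0:ℝ) 1, γ t ∈ Y → t = 0 ∨ t = 1) {L : Set (Fin N → ℂ)} (hL : ZS L) {s t : ℝ} (hs : 0 ≤ s) (hst : s < t)
    (ht : t ≤ 1) (hsub : γ '' Ioo s t ⊆ L) (hnsub : ¬ γ '' Icc 0 1 ⊆ L) : PCx (Y ∪ γ '' Icc 0 1) := by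
  have split : ∀ {b c : ℝ}, 0 < b → b < c → c < 1 → Icc (0:ℝ) 1 = Icc 0 b ∪ Icc c 1 ∪ Icc b c := by
    intro b c hb hbc hc
    ext x
    simp only [mem_union, mem_Icc]
    constructor
    · rintro ⟨h1, h2⟩
      rcases le_total x b with h | h
      · exact Or.inl (Or.inl ⟨h1, h⟩)
      · rcases le_total x c with h' | h'
        · exact Or.inr ⟨h, h'⟩
        · exact Or.inl (Or.inr ⟨h', h2⟩)
    · rintro ((⟨h1, h2⟩ | ⟨h1, h2⟩) | ⟨h1, h2⟩) <;> constructor <;> linarith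
  -- a small arc off the line
  obtain ⟨b1, b2, hb1, hb12, hb2, hoff⟩ : ∃ b1 b2 : ℝ, 0 < b1 ∧ b1 < b2 ∧ b2 < 1 ∧ ∀ x ∈ Icc b1 b2, γ x ∉ L := by
    rw [not_subset] at hnsub
    obtain ⟨_, ⟨b, hb, rfl⟩, hbL⟩ := hnsub
    obtain ⟨l, hl1, hl2⟩ := hL _ hbL
    have hlc : ContinuousOn (fun x => eval (γ x) l) (Icc 0 1) := l.continuous_eval.comp_continuousOn hcont
    have hev := (hlc b hb).eventually (isOpen_ne.mem_nhds hl1)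
    rw [eventually_nhdsWithin_iff, Metric.eventually_nhds_iff] at hev
    obtain ⟨ε, hε, hev⟩ := hev
    have hlt : max 0 (b - ε) < min 1 (b + ε) := by
      rw [max_lt_iff, lt_min_iff, lt_min_iff]
      refine ⟨⟨one_pos, ?_⟩, ?_, ?_⟩ <;> linarith [hb.1, hb.2]
    obtain ⟨b1, h1, h2⟩ := exists_between hlt
    obtain ⟨b2, h3, h4⟩ := exists_between h2
    rw [max_lt_iff] at h1
    rw [lt_min_iff] at h4
    refine ⟨b1, b2, h1.1, h3, h4.1, fun x hx hxL => ?_⟩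
    refine hev (y := x) ?_ ⟨by linarith [hx.1], by linarith [hx.2]⟩ (hl2 _ hxL)
    rw [Real.dist_eq, abs_lt]
    constructor <;> linarith [hx.1, hx.2]
  obtain ⟨a1, h2, h3⟩ := exists_between hst
  obtain ⟨a2, h4, h5⟩ := exists_between h3
  obtain ⟨-, hK'⟩ := cut hYc hY hcont hinj hBV h0 h1 hm hb1 hb12 hb2
  obtain ⟨hKc, hK⟩ := cut hYc hY hcont hinj hBV h0 h1 hm (show 0 < a1 by linarith) h4 (by linarith)
  have hXa : Y ∪ γ '' Icc 0 1 = ((Y ∪ γ '' Icc 0 a1) ∪ γ '' Icc a2 1) ∪ γ '' Icc a1 a2 := by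
    rw [split (show 0 < a1 by linarith) h4 (by linarith), image_union, image_union, union_assoc, union_assoc, union_assoc]
  have hXb : Y ∪ γ '' Icc 0 1 = ((Y ∪ γ '' Icc 0 b1) ∪ γ '' Icc b2 1) ∪ γ '' Icc b1 b2 := by
    rw [split hb1 hb12 hb2, image_union, image_union, union_assoc, union_assoc, union_assoc]
  have hXL : PCx ((Y ∪ γ '' Icc 0 1) ∩ L) := by
    have : (Y ∪ γ '' Icc 0 1) ∩ L = ((Y ∪ γ '' Icc 0 b1) ∪ γ '' Icc b2 1) ∩ L := by
      rw [hXb, union_inter_distrib_right _ (γ '' Icc b1 b2)]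
      have : γ '' Icc b1 b2 ∩ L = ∅ := by
        rw [eq_empty_iff_forall_notMem]
        rintro _ ⟨⟨x, hx, rfl⟩, hxL⟩
        exact hoff x hx hxL
      rw [this, union_empty]
    rw [this]
    exact hK'.interZS hL
  rw [hXa] at hXL ⊢
  refine line_trick hKc hK hL ?_ hXL
  have hsub2 : Icc a1 a2 ⊆ Ioo s t := fun x hx => ⟨by linarith [hx.1], by linarith [hx.2]⟩
  exact (image_mono hsub2).trans hsub
end SA
end
end

open Set MvPolynomial Topology MeasureTheory

noncomputable section

theorem pc_iff {N : ℕ} {K : Set (Fin N → ℂ)} (hK : IsCompact K) : IsPolynomiallyConvex K ↔ SA.PCx K := by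
  have key : ∀ p : MvPolynomial (Fin N) ℂ, (∀ x ∈ K, ‖eval x p‖ ≤ ⨆ x ∈ K, ‖eval x p‖) ∧ 
      ∀ r, 0 ≤ r → (∀ x ∈ K, ‖eval x p‖ ≤ r) → (⨆ x ∈ K, ‖eval x p‖) ≤ r := by
    intro p
    have h2 : ∀ r, 0 ≤ r → (∀ x ∈ K, ‖eval x p‖ ≤ r) → ∀ x, (⨆ (_ : x ∈ K), ‖eval x p‖) ≤ r := by
      intro r hr h x
      exact Real.iSup_le (fun hx => h x hx) hr
    refine ⟨fun x hx => ?_, fun r hr h => Real.iSup_le (h2 r hr h) hr⟩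
    obtain ⟨M, hM⟩ := hK.exists_bound_of_continuousOn (f := fun x => eval x p) p.continuous_eval.continuousOn
    have hM0 : 0 ≤ M := (norm_nonneg _).trans (hM x hx)
    have hb : BddAbove (range fun x => ⨆ (_ : x ∈ K), ‖eval x p‖) := ⟨M, by
      rintro _ ⟨y, rfl⟩
      exact h2 M hM0 hM y⟩
    have := le_ciSup hb x
    have e : (⨆ (_ : x ∈ K), ‖eval x p‖) = ‖eval x p‖ := ciSup_pos hx
    simp only [e] at this
    exact this
  have hsub : K ⊆ polyHull K := fun x hx p => (key p).1 x hx
  constructor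
  · intro h z hz
    rw [← h] at hz
    change ¬ ∀ p : MvPolynomial (Fin N) ℂ, ‖eval z p‖ ≤ ⨆ x ∈ K, ‖eval x p‖ at hz
    push Not at hz
    obtain ⟨p, hp⟩ := hz
    exact SA.pcx_pow (key p).1 hp (by norm_num)
  · intro h
    refine Subset.antisymm (fun z hz => ?_) hsub
    by_contra hzK
    obtain ⟨p, hp1, hp2⟩ := h z hzK
    have h3 := hz p
    have h4 := (key p).2 (1/3) (by norm_num) (fun x hx => (hp2 x hx).le)
    rw [hp1, norm_one] at h3
    linarith

/-- Attaching a rectifiable arc, part of which lies in a complex affine line not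
containing all of it, to a compact polynomially convex set along its endpoints
preserves polynomial convexity. -/
theorem stmt_13 (N : ℕ) (Y : Set (Fin N → ℂ)) (hYcomp : IsCompact Y)
    (hYpc : IsPolynomiallyConvex Y) (γ : ℝ → (Fin N → ℂ))
    (hcont : ContinuousOn γ (Icc 0 1)) (hinj : InjOn γ (Icc 0 1))
    (hBV : BoundedVariationOn γ (Icc 0 1))
    (Γ : Set (Fin N → ℂ)) (hΓ : γ '' Icc 0 1 = Γ)
    (h0 : γ 0 ∈ Y) (h1 : γ 1 ∈ Y) (hmeet : Γ ∩ Y = {γ 0, γ 1})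
    (L : Set (Fin N → ℂ)) (hL : IsComplexAffineLine L)
    (s t : ℝ) (hs : 0 ≤ s) (hst : s < t) (ht : t ≤ 1)
    (hsub : γ '' Ioo s t ⊆ L) (hnsub : ¬ Γ ⊆ L) :
    IsPolynomiallyConvex (Y ∪ Γ) := by
  subst hΓ
  have hm : ∀ t ∈ Icc (0:ℝ) 1, γ t ∈ Y → t = 0 ∨ t = 1 := by
    intro u hu huY
    have : γ u ∈ γ '' Icc 0 1 ∩ Y := ⟨⟨u, hu, rfl⟩, huY⟩
    rw [hmeet] at this
    rcases this with h | h
    · exact Or.inl (hinj hu ⟨le_rfl, zero_le_one⟩ h)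
    · exact Or.inr (hinj hu ⟨zero_le_one, le_rfl⟩ h)
  have hXc : IsCompact (Y ∪ γ '' Icc 0 1) := hYcomp.union (isCompact_Icc.image_of_continuousOn hcont)
  rw [pc_iff hXc]
  obtain ⟨z₀, v, hv, rfl⟩ := hL
  exact SA.attach hYcomp ((pc_iff hYcomp).1 hYpc) hcont hinj hBV h0 h1 hm (SA.line_ZS z₀ v hv) hs hst ht hsub hnsub

end
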